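/- arXiv:1505.05209 — 2 statements merged into one kernel-verified Lean document; each statement's English description precedes it below -/
import Mathlib

section
/- Let R be a Cohen-Macaulay standard graded ring with R_0 a field, 𝔪 its maximal homogeneous ideal, and d = dim R. Let C_• : ⋯ → C_2 → C_1 → C_0 → 0 be a graded complex of finitely generated graded R-modules and M = H_0(C_•). Fix an integer t with 1 ≤ t ≤ d and assume: (1) t ≤ depth(M/H^0_𝔪(M)); (2) dim H_j(C_•) ≤ j for all j with 1 ≤ j ≤ d − 1; (3) C_j is a maximal Cohen-Macaulay module for all j with 0 ≤ j ≤ d − 1. Then max{ b_0(H^0_𝔪(M)), reg(M/H^0_𝔪(M)) } ≤ max{ b_0(C_i) − i : 0 ≤ i ≤ d − t } + reg(R). -/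
/-!
Statement 14 (Corollary `partial-reg-` of the paper).

`R` is a Cohen–Macaulay standard graded ring with `R₀ = 𝒜 0` a field, `𝔪` the maximal
homogeneous ideal, `d = dim R`; `C_•` is a graded complex of finitely generated graded
`R`-modules with `M = H₀(C_•)`; `1 ≤ t ≤ d`; and (1) `t ≤ depth M/H⁰_𝔪(M)`,
(2) `dim H_j(C_•) ≤ j` for `1 ≤ j ≤ d-1`, (3) `C_j` is maximal Cohen–Macaulay for
`0 ≤ j ≤ d-1`.  Conclusion:

`max{ b₀(H⁰_𝔪(M)), reg(M/H⁰_𝔪(M)) } ≤ max{ b₀(C_i) − i : 0 ≤ i ≤ d−t } + reg(R)`.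

Rendering: for every `B` with `b₀(C_i) − i ≤ B` for all `0 ≤ i ≤ d−t`, and every `γ`
with `a(R) ≤ γ` (so `reg R = a(R) + d ≤ γ + d`, `R` being Cohen–Macaulay), one has
`b₀(H⁰_𝔪(M)) ≤ B + γ + d` and `a_i(M/H⁰_𝔪(M)) + i ≤ B + γ + d` for every `i`
(the latter being `reg(M/H⁰_𝔪(M)) ≤ B + γ + d`).  Graded pieces of higher local
cohomology are expressed by the Koszul-cohomology direct-limit predicate `KVanish`.
-/

noncomputable section
namespace Paper

variable {R : Type} [CommRing R]

def maxHomIdeal (𝒜 : ℤ → AddSubgroup R) [GradedRing 𝒜] : Ideal R :=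
  Ideal.span ({ r : R | ∃ h : r ∈ 𝒜 0, ¬ IsUnit (⟨r, h⟩ : 𝒜 0) } ∪
    ⋃ (i : ℤ) (_ : i ≠ 0), (𝒜 i : Set R))

def GenDegLE {M : Type} [AddCommGroup M] [Module R M] (ℳ : ℤ → AddSubgroup M) (b : ℤ) : Prop :=
  Submodule.span R (⋃ (j : ℤ) (_ : j ≤ b), (ℳ j : Set M)) = ⊤

def SubGenDegLE {M : Type} [AddCommGroup M] [Module R M] (ℳ : ℤ → AddSubgroup M)
    (T : Submodule R M) (b : ℤ) : Prop :=
  T ≤ Submodule.span R (⋃ (j : ℤ) (_ : j ≤ b), ((T : Set M) ∩ (ℳ j : Set M)))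

def depthGE (I : Ideal R) (N : Type) [AddCommGroup N] [Module R N] (k : ℕ) : Prop :=
  Subsingleton N ∨ ∃ rs : List R, rs.length = k ∧ (∀ r ∈ rs, r ∈ I) ∧
    RingTheory.Sequence.IsRegular N rs

def modDimLE (N : Type) [AddCommGroup N] [Module R N] (b : ℕ) : Prop :=
  ringKrullDim (R ⧸ Module.annihilator R N) ≤ (b : WithBot (WithTop ℕ))

def torsionSubmodule (I : Ideal R) (M : Type) [AddCommGroup M] [Module R M] :
    Submodule R M where
  carrier := { x | ∃ t : ℕ, ∀ r ∈ I ^ t, r • x = 0 }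
  zero_mem' := ⟨0, fun r _ => smul_zero r⟩
  add_mem' := by
    rintro a b ⟨t, ht⟩ ⟨m, hm⟩
    refine ⟨t + m, fun r hr => ?_⟩
    have h1 : r ∈ I ^ t := Ideal.pow_le_pow_right (Nat.le_add_right t m) hr
    have h2 : r ∈ I ^ m := Ideal.pow_le_pow_right (Nat.le_add_left m t) hr
    rw [smul_add, ht r h1, hm r h2, add_zero]
  smul_mem' := by
    rintro c x ⟨t, ht⟩
    exact ⟨t, fun r hr => by rw [smul_comm, ht r hr, smul_zero]⟩

abbrev KCochain (n : ℕ) (M : Type) (i : ℕ) : Type := {S : Finset (Fin n) // S.card = i} → M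

variable {n : ℕ} (y : Fin n → R) {M : Type} [AddCommGroup M] [Module R M]

def kd (t i : ℕ) (f : KCochain n M i) : KCochain n M (i + 1) := fun T =>
  ∑ j ∈ T.1.attach,
    ((-1 : ℤ) ^ ((T.1.filter (fun a => a < j.1)).card)) •
      ((y j.1 ^ t) • f ⟨T.1.erase j.1, by simp [Finset.card_erase_of_mem j.2, T.2]⟩)

def kTrans (s : ℕ) (i : ℕ) (f : KCochain n M i) : KCochain n M i := fun S =>
  ((∏ j ∈ S.1, y j) ^ s) • f S

def KHomog (ℳ : ℤ → AddSubgroup M) (e : Fin n → ℤ) (t : ℕ) (ℓ : ℤ) {i : ℕ}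
    (f : KCochain n M i) : Prop :=
  ∀ S, f S ∈ ℳ (ℓ + (t : ℤ) * ∑ j ∈ S.1, e j)

def IsKBoundary (t : ℕ) : (i : ℕ) → KCochain n M i → Prop
  | 0, f => f = 0
  | (i + 1), f => ∃ g : KCochain n M i, kd y t i g = f

def KVanish (ℳ : ℤ → AddSubgroup M) (e : Fin n → ℤ) (i : ℕ) (ℓ : ℤ) : Prop :=
  ∀ (t : ℕ) (f : KCochain n M i), kd y t i f = 0 → KHomog ℳ e t ℓ f →
    ∃ s : ℕ, IsKBoundary y (t + s) i (kTrans y s i f)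

abbrev Hmod (C : ℕ → Type) [∀ j, AddCommGroup (C j)] [∀ j, Module R (C j)]
    (dl : ∀ j, C (j + 1) →ₗ[R] C j) (j : ℕ) : Type :=
  ↥(LinearMap.ker (dl j)) ⧸
    (Submodule.comap (LinearMap.ker (dl j)).subtype (LinearMap.range (dl (j + 1))))

section Koszul

variable {n : ℕ} {X Y : Type} [AddCommGroup X] [Module R X] [AddCommGroup Y] [Module R Y]

/-- The sign of a vertex in the Koszul complex. -/
def ksgn (j : Fin n) (S : Finset (Fin n)) : ℤ := (-1) ^ (S.filter (fun a => a < j)).card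

/-- The sign picked up by `ksgn j` on adding `i` to the set. -/
def kflip (i j : Fin n) : ℤ := if i < j then -1 else 1

lemma kflip_mul_kflip {i j : Fin n} (h : i ≠ j) : kflip i j * kflip j i = -1 := by
  unfold kflip
  rcases lt_or_gt_of_ne h with h | h <;> simp [h, not_lt.mpr h.le]

lemma kflip_mul_self (i j : Fin n) : kflip i j * kflip i j = 1 := by
  unfold kflip
  split_ifs <;> simp

@[simp] lemma ksgn_mul_self (j : Fin n) (S : Finset (Fin n)) : ksgn j S * ksgn j S = 1 := by
  unfold ksgn
  rw [← mul_pow]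
  simp

lemma ksgn_insert {i : Fin n} {S : Finset (Fin n)} (hi : i ∉ S) (j : Fin n) :
    ksgn j (insert i S) = kflip i j * ksgn j S := by
  unfold ksgn kflip
  rw [Finset.filter_insert]
  split_ifs with h
  · rw [Finset.card_insert_of_notMem (by simp [hi]), pow_succ']
  · simp

lemma ksgn_erase {i : Fin n} {S : Finset (Fin n)} (hi : i ∈ S) (j : Fin n) :
    ksgn j (S.erase i) = kflip i j * ksgn j S := by
  conv_rhs => rw [← Finset.insert_erase hi, ksgn_insert (Finset.notMem_erase i S), ← mul_assoc,
    kflip_mul_self, one_mul]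

@[simp] lemma kflip_self (i : Fin n) : kflip i i = 1 := by simp [kflip]

/-- Exterior multiplication by a basis vector. -/
def kE (j : Fin n) : (Finset (Fin n) → X) →ₗ[R] (Finset (Fin n) → X) where
  toFun f T := if j ∈ T then ksgn j T • f (T.erase j) else 0
  map_add' f g := by
    funext T
    by_cases h : j ∈ T <;> simp [h]
  map_smul' r f := by
    funext T
    by_cases h : j ∈ T <;> simp [h, smul_comm r (ksgn j T)]

/-- Contraction against a dual basis vector. -/
def kI (j : Fin n) : (Finset (Fin n) → X) →ₗ[R] (Finset (Fin n) → X) where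
  toFun f T := if j ∈ T then 0 else ksgn j T • f (insert j T)
  map_add' f g := by
    funext T
    by_cases h : j ∈ T <;> simp [h]
  map_smul' r f := by
    funext T
    by_cases h : j ∈ T <;> simp [h, smul_comm r (ksgn j T)]

lemma kE_apply (j : Fin n) (f : Finset (Fin n) → X) (T : Finset (Fin n)) :
    kE (R := R) j f T = if j ∈ T then ksgn j T • f (T.erase j) else 0 := rfl

lemma kI_apply (j : Fin n) (f : Finset (Fin n) → X) (T : Finset (Fin n)) :
    kI (R := R) j f T = if j ∈ T then 0 else ksgn j T • f (insert j T) := rfl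

lemma kE_self (j : Fin n) (f : Finset (Fin n) → X) : kE (R := R) j (kE (R := R) j f) = 0 := by
  funext T
  simp [kE_apply]

lemma kI_self (j : Fin n) (f : Finset (Fin n) → X) : kI (R := R) j (kI (R := R) j f) = 0 := by
  funext T
  simp [kI_apply]

lemma kE_anticomm {i j : Fin n} (h : i ≠ j) (f : Finset (Fin n) → X) :
    kE (R := R) i (kE (R := R) j f) = - kE (R := R) j (kE (R := R) i f) := by
  funext T
  by_cases hi : i ∈ T <;> by_cases hj : j ∈ T <;>
    simp only [kE_apply, Pi.neg_apply, Finset.mem_erase, hi, hj, h, h.symm, ne_eq, not_false_eq_true,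
      and_self, and_false, if_true, if_false, smul_zero, neg_zero]
  rw [ksgn_erase hi, ksgn_erase hj, Finset.erase_right_comm, smul_smul, smul_smul, ← neg_smul]
  congr 1
  have := kflip_mul_kflip h
  have h2 := kflip_mul_self i j
  have : kflip j i = - kflip i j := by linear_combination kflip i j * this - kflip j i * h2
  rw [this]
  ring

lemma kI_anticomm {i j : Fin n} (h : i ≠ j) (f : Finset (Fin n) → X) :
    kI (R := R) i (kI (R := R) j f) = - kI (R := R) j (kI (R := R) i f) := by
  funext T
  by_cases hi : i ∈ T <;> by_cases hj : j ∈ T <;>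
    simp only [kI_apply, Pi.neg_apply, Finset.mem_insert, hi, hj, h, h.symm, or_true,
      or_self, if_true, if_false, smul_zero, neg_zero]
  rw [ksgn_insert hi, ksgn_insert hj, Finset.insert_comm, smul_smul, smul_smul, ← neg_smul]
  congr 1
  have := kflip_mul_kflip h
  have h2 := kflip_mul_self i j
  have : kflip j i = - kflip i j := by linear_combination kflip i j * this - kflip j i * h2
  rw [this]
  ring

lemma kE_kI_of_ne {i j : Fin n} (h : i ≠ j) (f : Finset (Fin n) → X) :
    kE (R := R) i (kI (R := R) j f) = - kI (R := R) j (kE (R := R) i f) := by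
  funext T
  by_cases hi : i ∈ T <;> by_cases hj : j ∈ T <;>
    simp only [kE_apply, kI_apply, Pi.neg_apply, Finset.mem_insert, Finset.mem_erase, hi, hj, h,
      h.symm, ne_eq, not_false_eq_true, and_true, and_false, or_true, or_self, if_true,
      if_false, smul_zero, neg_zero]
  rw [ksgn_erase hi, ksgn_insert hj, Finset.erase_insert_of_ne h.symm, smul_smul, smul_smul,
    ← neg_smul]
  congr 1
  have := kflip_mul_kflip h
  have h2 := kflip_mul_self i j
  have : kflip j i = - kflip i j := by linear_combination kflip i j * this - kflip j i * h2
  rw [this]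
  ring

lemma kE_kI_add (j : Fin n) (f : Finset (Fin n) → X) :
    kE (R := R) j (kI (R := R) j f) + kI (R := R) j (kE (R := R) j f) = f := by
  funext T
  by_cases hj : j ∈ T
  · simp [kE_apply, kI_apply, hj, ksgn_erase hj, smul_smul, Finset.insert_erase hj]
  · simp [kE_apply, kI_apply, hj, ksgn_insert hj, smul_smul, Finset.erase_insert hj]

/-- The differential of the Koszul cochain complex of `a`. -/
def kup (a : Fin n → R) : (Finset (Fin n) → X) →ₗ[R] (Finset (Fin n) → X) := ∑ j, a j • kE j

/-- The differential of the Koszul chain complex of `a`. -/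
def kdown (a : Fin n → R) : (Finset (Fin n) → X) →ₗ[R] (Finset (Fin n) → X) := ∑ j, a j • kI j

lemma kup_eq (a : Fin n → R) (f : Finset (Fin n) → X) : kup a f = ∑ j, a j • kE (R := R) j f := by
  simp [kup]

lemma kdown_eq (a : Fin n → R) (f : Finset (Fin n) → X) :
    kdown a f = ∑ j, a j • kI (R := R) j f := by
  simp [kdown]

lemma kup_apply (a : Fin n → R) (f : Finset (Fin n) → X) (T : Finset (Fin n)) :
    kup a f T = ∑ j, if j ∈ T then ksgn j T • a j • f (T.erase j) else 0 := by
  simp only [kup_eq, Finset.sum_apply, Pi.smul_apply, kE_apply, smul_ite, smul_zero]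
  simp only [smul_comm (a _)]

lemma kdown_apply (a : Fin n → R) (f : Finset (Fin n) → X) (T : Finset (Fin n)) :
    kdown a f T = ∑ j, if j ∈ T then 0 else ksgn j T • a j • f (insert j T) := by
  simp only [kdown_eq, Finset.sum_apply, Pi.smul_apply, kI_apply, smul_ite, smul_zero]
  simp only [smul_comm (a _)]

lemma sum_sum_eq_zero_of_antisymm {A : Type} [AddCommGroup A] (F : Fin n → Fin n → A)
    (h0 : ∀ i, F i i = 0) (h1 : ∀ i j, i ≠ j → F i j = - F j i) : ∑ i, ∑ j, F i j = 0 := by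
  rw [← Finset.sum_product', Finset.univ_product_univ]
  refine Finset.sum_involution (fun p _ => (p.2, p.1)) ?_ ?_ ?_ ?_
  · rintro ⟨i, j⟩ -
    by_cases h : i = j
    · subst h
      simp [h0]
    · simp [h1 i j h]
  · rintro ⟨i, j⟩ - h hij
    simp only [Prod.mk.injEq] at hij
    obtain ⟨rfl, -⟩ := hij
    exact h (h0 _)
  · simp
  · simp

lemma kup_kup (a : Fin n → R) (f : Finset (Fin n) → X) : kup a (kup a f) = 0 := by
  simp only [kup_eq, map_sum, map_smul, Finset.smul_sum]
  apply sum_sum_eq_zero_of_antisymm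
  · intro i
    simp [kE_self]
  · intro i j h
    rw [kE_anticomm h, smul_neg, smul_neg, smul_comm, neg_neg]

lemma kdown_kdown (a : Fin n → R) (f : Finset (Fin n) → X) : kdown a (kdown a f) = 0 := by
  simp only [kdown_eq, map_sum, map_smul, Finset.smul_sum]
  apply sum_sum_eq_zero_of_antisymm
  · intro i
    simp [kI_self]
  · intro i j h
    rw [kI_anticomm h, smul_neg, smul_neg, smul_comm, neg_neg]

lemma kup_kdown_add (a b : Fin n → R) (f : Finset (Fin n) → X) :
    kup a (kdown b f) + kdown b (kup a f) = (∑ j, a j * b j) • f := by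
  simp only [kup_eq, kdown_eq, map_sum, map_smul, Finset.smul_sum]
  rw [add_comm, Finset.sum_comm, ← Finset.sum_add_distrib, Finset.sum_smul]
  refine Finset.sum_congr rfl fun i _ => ?_
  rw [← Finset.sum_add_distrib, Finset.sum_eq_single i]
  · rw [smul_comm (b i) (a i), ← smul_add, ← smul_add, add_comm, kE_kI_add, smul_smul]
  · intro j _ h
    rw [kE_kI_of_ne h, smul_neg, smul_neg, smul_comm (b i) (a j), add_neg_cancel]
  · simp

/-- Truncation to sets of a given cardinality. -/
def kq (i : ℤ) : (Finset (Fin n) → X) →ₗ[R] (Finset (Fin n) → X) where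
  toFun f T := if (T.card : ℤ) = i then f T else 0
  map_add' f g := by
    funext T
    by_cases h : (T.card : ℤ) = i <;> simp [h]
  map_smul' r f := by
    funext T
    by_cases h : (T.card : ℤ) = i <;> simp [h]

lemma kq_apply (i : ℤ) (f : Finset (Fin n) → X) (T : Finset (Fin n)) :
    kq (R := R) i f T = if (T.card : ℤ) = i then f T else 0 := rfl

lemma kup_kq (a : Fin n → R) (i : ℤ) (f : Finset (Fin n) → X) :
    kup a (kq (R := R) i f) = kq (R := R) (i + 1) (kup a f) := by
  funext T
  rw [kq_apply, kup_apply, kup_apply]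
  by_cases h : (T.card : ℤ) = i + 1
  · rw [if_pos h]
    refine Finset.sum_congr rfl fun j _ => ?_
    split_ifs with hj
    · have := Finset.card_erase_add_one hj
      rw [kq_apply, if_pos (by omega)]
    · rfl
  · rw [if_neg h]
    refine Finset.sum_eq_zero fun j _ => ?_
    split_ifs with hj
    · have := Finset.card_erase_add_one hj
      rw [kq_apply, if_neg (by omega)]
      simp
    · rfl

lemma kdown_kq (a : Fin n → R) (i : ℤ) (f : Finset (Fin n) → X) :
    kdown a (kq (R := R) (i + 1) f) = kq (R := R) i (kdown a f) := by
  funext T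
  rw [kq_apply, kdown_apply, kdown_apply]
  by_cases h : (T.card : ℤ) = i
  · rw [if_pos h]
    refine Finset.sum_congr rfl fun j _ => ?_
    split_ifs with hj
    · rfl
    · have := Finset.card_insert_of_notMem hj
      rw [kq_apply, if_pos (by omega)]
  · rw [if_neg h]
    refine Finset.sum_eq_zero fun j _ => ?_
    split_ifs with hj
    · rfl
    · have := Finset.card_insert_of_notMem hj
      rw [kq_apply, if_neg (by omega)]
      simp

lemma kdown_comp (φ : X →ₗ[R] Y) (a : Fin n → R) (f : Finset (Fin n) → X) :
    kdown a (fun S => φ (f S)) = fun S => φ (kdown a f S) := by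
  funext T
  simp only [kdown_apply, map_sum]
  refine Finset.sum_congr rfl fun j _ => ?_
  split_ifs <;> simp

lemma kup_comp (φ : X →ₗ[R] Y) (a : Fin n → R) (f : Finset (Fin n) → X) :
    kup a (fun S => φ (f S)) = fun S => φ (kup a f S) := by
  funext T
  simp only [kup_apply, map_sum]
  refine Finset.sum_congr rfl fun j _ => ?_
  split_ifs <;> simp

end Koszul

section Cech

variable {n : ℕ} (y : Fin n → R) {X Y Z : Type} [AddCommGroup X] [Module R X]
  [AddCommGroup Y] [Module R Y] [AddCommGroup Z] [Module R Z]

/-- The transition maps between Koszul complexes of powers of `y`, on all degrees at once. -/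
def kT (s : ℕ) : (Finset (Fin n) → X) →ₗ[R] (Finset (Fin n) → X) where
  toFun f S := (∏ j ∈ S, y j) ^ s • f S
  map_add' f g := by
    funext T
    simp
  map_smul' r f := by
    funext T
    simp [smul_comm r]

lemma kT_apply (s : ℕ) (f : Finset (Fin n) → X) (S : Finset (Fin n)) :
    kT y s f S = (∏ j ∈ S, y j) ^ s • f S := rfl

@[simp] lemma kT_zero (f : Finset (Fin n) → X) : kT y 0 f = f := by
  funext S
  simp [kT_apply]

lemma kT_kT (s s' : ℕ) (f : Finset (Fin n) → X) : kT y s (kT y s' f) = kT y (s + s') f := by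
  funext S
  simp [kT_apply, smul_smul, pow_add]

lemma kup_kT (t s : ℕ) (f : Finset (Fin n) → X) :
    kup (fun j => y j ^ (t + s)) (kT y s f) = kT y s (kup (fun j => y j ^ t) f) := by
  funext T
  rw [kT_apply, kup_apply, kup_apply, Finset.smul_sum]
  refine Finset.sum_congr rfl fun j _ => ?_
  split_ifs with hj
  · rw [kT_apply, smul_comm _ (ksgn j T), smul_smul, smul_smul, ← Finset.mul_prod_erase T y hj]
    congr 2
    ring
  · simp

lemma kT_kq (s : ℕ) (i : ℤ) (f : Finset (Fin n) → X) :
    kT y s (kq (R := R) i f) = kq (R := R) i (kT y s f) := by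
  funext T
  simp only [kT_apply, kq_apply]
  split_ifs <;> simp

instance : DirectedSystem (fun _ : ℕ => Finset (Fin n) → X)
    (fun i j (_ : i ≤ j) => ⇑(kT y (X := X) (j - i))) where
  map_self := by intro i x; simp
  map_map := by
    intro k j i hij hjk x
    rw [kT_kT]
    congr 2
    omega

variable (X) in
/-- The Čech complex on `y`, all degrees at once, as the direct limit of Koszul complexes. -/
def Cech : Type :=
  DirectLimit (fun _ : ℕ => Finset (Fin n) → X) (fun i j (_ : i ≤ j) => kT y (X := X) (j - i))

instance : AddCommGroup (Cech y X) :=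
  inferInstanceAs (AddCommGroup (DirectLimit (fun _ : ℕ => Finset (Fin n) → X)
    (fun i j (_ : i ≤ j) => kT y (X := X) (j - i))))

instance : Module R (Cech y X) :=
  inferInstanceAs (Module R (DirectLimit (fun _ : ℕ => Finset (Fin n) → X)
    (fun i j (_ : i ≤ j) => kT y (X := X) (j - i))))

namespace Cech

/-- The class of a Koszul cochain of level `t`. -/
def mk (t : ℕ) : (Finset (Fin n) → X) →ₗ[R] Cech y X where
  toFun f := (⟦⟨t, f⟩⟧ : DirectLimit (fun _ : ℕ => Finset (Fin n) → X)
    (fun i j (_ : i ≤ j) => kT y (X := X) (j - i)))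
  map_add' f g := (DirectLimit.add_def (f := fun i j (_ : i ≤ j) => kT y (X := X) (j - i)) t f g).symm
  map_smul' _ _ := rfl

lemma mk_level (t s : ℕ) (f : Finset (Fin n) → X) : mk y t f = mk y (t + s) (kT y s f) := by
  have := DirectLimit.eq_of_le (f := fun i j (_ : i ≤ j) => kT y (X := X) (j - i)) ⟨t, f⟩ (t + s)
    (Nat.le_add_right t s)
  simp only [Nat.add_sub_cancel_left] at this
  exact this

lemma ind (x : Cech y X) : ∃ t f, x = mk y t f :=
  DirectLimit.exists_eq_mk (f := fun i j (_ : i ≤ j) => kT y (X := X) (j - i)) x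

lemma mk_eq_zero_iff (t : ℕ) (f : Finset (Fin n) → X) : mk y t f = 0 ↔ ∃ s, kT y s f = 0 := by
  constructor
  · intro h
    have h0 : mk y t f = mk y t 0 := by rw [h, map_zero]
    obtain ⟨k, h1, h2, h3⟩ := Quotient.exact h0
    refine ⟨k - t, ?_⟩
    simpa using h3
  · rintro ⟨s, hs⟩
    rw [mk_level y t s, hs, map_zero]

/-- The additive map induced by compatible maps on all levels. -/
def lift (φ : ℕ → (Finset (Fin n) → X) →+ (Finset (Fin n) → Y))
    (h : ∀ t s f, φ (t + s) (kT y s f) = kT y s (φ t f)) : Cech y X →+ Cech y Y where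
  toFun := DirectLimit.map _ _ (fun t => φ t) (by
    intro i j hij f
    obtain ⟨s, rfl⟩ := Nat.exists_eq_add_of_le hij
    simpa using (h i s f).symm)
  map_zero' := by
    rw [← map_zero (mk y 0 : (Finset (Fin n) → X) →ₗ[R] Cech y X)]
    refine Eq.trans ?_ (map_zero (mk y 0 : (Finset (Fin n) → Y) →ₗ[R] Cech y Y))
    rw [← map_zero (φ 0)]
    rfl
  map_add' a b := by
    obtain ⟨s, f, rfl⟩ := ind y a
    obtain ⟨t, g, rfl⟩ := ind y b
    rw [mk_level y s t, mk_level y t s, add_comm t s, ← map_add]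
    refine Eq.trans ?_ (map_add (mk y (s + t) : (Finset (Fin n) → Y) →ₗ[R] Cech y Y) _ _)
    rw [← map_add (φ (s + t))]
    rfl

/-- The linear map induced by compatible linear maps on all levels. -/
def liftₗ (φ : ℕ → (Finset (Fin n) → X) →ₗ[R] (Finset (Fin n) → Y))
    (h : ∀ t s f, φ (t + s) (kT y s f) = kT y s (φ t f)) : Cech y X →ₗ[R] Cech y Y where
  __ := lift y (fun t => (φ t).toAddMonoidHom) h
  map_smul' r a := by
    obtain ⟨s, f, rfl⟩ := ind y a
    change lift y (fun t => (φ t).toAddMonoidHom) h (r • mk y s f) = _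
    rw [← map_smul]
    exact congrArg (mk y s) ((φ s).map_smul r f)

/-- The differential of the Čech complex. -/
def d : Cech y X →ₗ[R] Cech y X := liftₗ y (fun t => kup (fun j => y j ^ t)) (kup_kT y)

@[simp] lemma d_mk (t : ℕ) (f : Finset (Fin n) → X) :
    d y (mk y t f) = mk y t (kup (fun j => y j ^ t) f) := rfl

@[simp] lemma d_d (x : Cech y X) : d y (d y x) = 0 := by
  obtain ⟨t, f, rfl⟩ := ind y x
  simp [kup_kup]

/-- The projection to the part of degree `i`. -/
def q (i : ℤ) : Cech y X →ₗ[R] Cech y X :=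
  liftₗ y (fun _ => kq i) (fun _ s f => (kT_kq y s i f).symm)

@[simp] lemma q_mk (i : ℤ) (t : ℕ) (f : Finset (Fin n) → X) :
    q y i (mk y t f) = mk y t (kq (R := R) i f) := rfl

lemma d_q (i : ℤ) (x : Cech y X) : d y (q y i x) = q y (i + 1) (d y x) := by
  obtain ⟨t, f, rfl⟩ := ind y x
  simp [kup_kq]

/-- The map of Čech complexes induced by a linear map. -/
def map (φ : X →ₗ[R] Y) : Cech y X →ₗ[R] Cech y Y :=
  liftₗ y (fun _ => φ.compLeft _) (fun t s f => by
    funext S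
    simp [kT_apply])

lemma map_mk (φ : X →ₗ[R] Y) (t : ℕ) (f : Finset (Fin n) → X) :
    map y φ (mk y t f) = mk y t (fun S => φ (f S)) := rfl

lemma map_d (φ : X →ₗ[R] Y) (x : Cech y X) : map y φ (d y x) = d y (map y φ x) := by
  obtain ⟨t, f, rfl⟩ := ind y x
  simp [map_mk, kup_comp]

lemma map_q (φ : X →ₗ[R] Y) (i : ℤ) (x : Cech y X) : map y φ (q y i x) = q y i (map y φ x) := by
  obtain ⟨t, f, rfl⟩ := ind y x
  rw [q_mk, map_mk, map_mk, q_mk]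
  congr 1
  funext S
  simp only [kq_apply]
  split_ifs <;> simp

lemma map_injective {φ : X →ₗ[R] Y} (h : Function.Injective φ) :
    Function.Injective (map y φ) := by
  rw [injective_iff_map_eq_zero]
  intro a ha
  obtain ⟨t, f, rfl⟩ := ind y a
  rw [map_mk, mk_eq_zero_iff] at ha
  rw [mk_eq_zero_iff]
  obtain ⟨s, hs⟩ := ha
  refine ⟨s, ?_⟩
  funext S
  apply h
  have := congrFun hs S
  simpa [kT_apply] using this

lemma map_surjective {φ : X →ₗ[R] Y} (h : Function.Surjective φ) :
    Function.Surjective (map y φ) := by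
  intro a
  obtain ⟨t, f, rfl⟩ := ind y a
  refine ⟨mk y t (fun S => (h (f S)).choose), ?_⟩
  rw [map_mk]
  congr 1
  funext S
  exact (h (f S)).choose_spec

lemma map_exact {φ : X →ₗ[R] Y} {ψ : Y →ₗ[R] Z} (h : ∀ b, ψ b = 0 → ∃ a, φ a = b)
    (b : Cech y Y) (hb : map y ψ b = 0) : ∃ a, map y φ a = b := by
  obtain ⟨t, f, rfl⟩ := ind y b
  rw [map_mk, mk_eq_zero_iff] at hb
  obtain ⟨s, hs⟩ := hb
  have h1 : ∀ S, ψ (kT y s f S) = 0 := fun S => by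
    have := congrFun hs S
    simpa [kT_apply] using this
  choose g hg using fun S => h _ (h1 S)
  refine ⟨mk y (t + s) g, ?_⟩
  rw [map_mk, mk_level y t s]
  congr 1
  funext S
  exact hg S

lemma map_comp_apply (φ : X →ₗ[R] Y) (ψ : Y →ₗ[R] Z) (x : Cech y X) :
    map y ψ (map y φ x) = map y (ψ ∘ₗ φ) x := by
  obtain ⟨t, f, rfl⟩ := ind y x
  rfl

lemma map_smul_id (r : R) (x : Cech y X) : map y (r • LinearMap.id) x = r • x := by
  obtain ⟨t, f, rfl⟩ := ind y x
  rw [map_mk, ← map_smul]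
  rfl

lemma map_add_apply (φ ψ : X →ₗ[R] Y) (x : Cech y X) :
    map y (φ + ψ) x = map y φ x + map y ψ x := by
  obtain ⟨t, f, rfl⟩ := ind y x
  rw [map_mk, map_mk, map_mk, ← map_add]
  rfl

lemma map_zero_apply (x : Cech y X) : map y (0 : X →ₗ[R] Y) x = 0 := by
  obtain ⟨t, f, rfl⟩ := ind y x
  rw [map_mk]
  exact map_zero _

end Cech

end Cech

section Cohomology

variable {n : ℕ} (y : Fin n → R) {X Y Z : Type} [AddCommGroup X] [Module R X]
  [AddCommGroup Y] [Module R Y] [AddCommGroup Z] [Module R Z]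

variable (X) in
/-- The cohomology of the Čech complex on `y`, all degrees at once. -/
def HH : Type :=
  ↥(LinearMap.ker (Cech.d y (X := X))) ⧸
    (LinearMap.range (Cech.d y (X := X))).submoduleOf (LinearMap.ker (Cech.d y (X := X)))

instance : AddCommGroup (HH y X) :=
  inferInstanceAs (AddCommGroup (↥(LinearMap.ker (Cech.d y (X := X))) ⧸
    (LinearMap.range (Cech.d y (X := X))).submoduleOf (LinearMap.ker (Cech.d y (X := X)))))

instance : Module R (HH y X) :=
  inferInstanceAs (Module R (↥(LinearMap.ker (Cech.d y (X := X))) ⧸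
    (LinearMap.range (Cech.d y (X := X))).submoduleOf (LinearMap.ker (Cech.d y (X := X)))))

namespace HH

/-- The class of a cocycle. -/
def mk : ↥(LinearMap.ker (Cech.d y (X := X))) →ₗ[R] HH y X := Submodule.mkQ _

lemma mk_eq_zero_iff (z : ↥(LinearMap.ker (Cech.d y (X := X)))) :
    mk y z = 0 ↔ ∃ g : Cech y X, Cech.d y g = z :=
  (Submodule.Quotient.mk_eq_zero _).trans Iff.rfl

lemma mk_eq_mk_iff (z z' : ↥(LinearMap.ker (Cech.d y (X := X)))) :
    mk y z = mk y z' ↔ ∃ g : Cech y X, Cech.d y g = z - z' := by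
  rw [← sub_eq_zero, ← map_sub, mk_eq_zero_iff]
  rfl

lemma ind (h : HH y X) : ∃ z, h = mk y z := by
  obtain ⟨z, hz⟩ := Submodule.mkQ_surjective _ h
  exact ⟨z, hz.symm⟩

variable {y} in
/-- A cocycle representing a class. -/
def rep (h : HH y X) : ↥(LinearMap.ker (Cech.d y (X := X))) := (ind y h).choose

@[simp] lemma mk_rep (h : HH y X) : mk y (rep h) = h := (ind y h).choose_spec.symm

/-- The map induced on cohomology by an additive map of Čech complexes. -/
def lift (φ : Cech y X →+ Cech y Y) (h1 : ∀ z, Cech.d y z = 0 → Cech.d y (φ z) = 0)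
    (h2 : ∀ g, ∃ g', Cech.d y g' = φ (Cech.d y g)) : HH y X →+ HH y Y where
  toFun h := mk y ⟨φ (rep h), h1 _ (rep h).2⟩
  map_zero' := by
    rw [mk_eq_zero_iff]
    obtain ⟨g, hg⟩ := (mk_eq_zero_iff y (rep (0 : HH y X))).1 (mk_rep y 0)
    obtain ⟨g', hg'⟩ := h2 g
    exact ⟨g', by rw [hg', hg]⟩
  map_add' a b := by
    rw [← map_add, mk_eq_mk_iff]
    obtain ⟨g, hg⟩ := (mk_eq_mk_iff y (rep (a + b)) (rep a + rep b)).1 (by simp)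
    obtain ⟨g', hg'⟩ := h2 g
    exact ⟨g', by rw [hg', hg]; simp⟩

@[simp] lemma lift_mk (φ : Cech y X →+ Cech y Y) (h1 : ∀ z, Cech.d y z = 0 → Cech.d y (φ z) = 0)
    (h2 : ∀ g, ∃ g', Cech.d y g' = φ (Cech.d y g)) (z : ↥(LinearMap.ker (Cech.d y (X := X)))) :
    lift y φ h1 h2 (mk y z) = mk y ⟨φ z, h1 _ z.2⟩ := by
  refine (mk_eq_mk_iff y _ _).2 ?_
  obtain ⟨g, hg⟩ := (mk_eq_mk_iff y (rep (mk y z)) z).1 (by simp)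
  obtain ⟨g', hg'⟩ := h2 g
  exact ⟨g', by rw [hg', hg]; simp⟩

/-- The linear map induced on cohomology by a linear map of Čech complexes. -/
def liftₗ (φ : Cech y X →ₗ[R] Cech y Y) (h1 : ∀ z, Cech.d y z = 0 → Cech.d y (φ z) = 0)
    (h2 : ∀ g, ∃ g', Cech.d y g' = φ (Cech.d y g)) : HH y X →ₗ[R] HH y Y where
  __ := lift y φ.toAddMonoidHom h1 h2
  map_smul' r a := by
    obtain ⟨z, rfl⟩ := ind y a
    change lift y φ.toAddMonoidHom h1 h2 (r • mk y z) = r • lift y φ.toAddMonoidHom h1 h2 (mk y z)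
    rw [← map_smul]
    refine (lift_mk y φ.toAddMonoidHom h1 h2 _).trans ?_
    refine Eq.trans ?_ (congrArg (r • ·) (lift_mk y φ.toAddMonoidHom h1 h2 z)).symm
    refine Eq.trans ?_ (map_smul (mk y) r _)
    exact congrArg (mk y) (Subtype.ext (φ.map_smul r z))

@[simp] lemma liftₗ_mk (φ : Cech y X →ₗ[R] Cech y Y)
    (h1 : ∀ z, Cech.d y z = 0 → Cech.d y (φ z) = 0)
    (h2 : ∀ g, ∃ g', Cech.d y g' = φ (Cech.d y g)) (z : ↥(LinearMap.ker (Cech.d y (X := X)))) :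
    liftₗ y φ h1 h2 (mk y z) = mk y ⟨φ z, h1 _ z.2⟩ :=
  lift_mk y φ.toAddMonoidHom h1 h2 z

/-- The projection to the cohomology of degree `i`. -/
def q (i : ℤ) : HH y X →ₗ[R] HH y X :=
  liftₗ y (Cech.q y i) (fun z hz => by rw [Cech.d_q, hz, map_zero])
    (fun g => ⟨Cech.q y (i - 1) g, by rw [Cech.d_q, sub_add_cancel]⟩)

/-- Functoriality of Čech cohomology. -/
def map (φ : X →ₗ[R] Y) : HH y X →ₗ[R] HH y Y :=
  liftₗ y (Cech.map y φ) (fun z hz => by rw [← Cech.map_d, hz, map_zero])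
    (fun g => ⟨Cech.map y φ g, by rw [Cech.map_d]⟩)

lemma q_mk (i : ℤ) (z : ↥(LinearMap.ker (Cech.d y (X := X)))) :
    q y i (mk y z) = mk y ⟨Cech.q y i z, by
      rw [LinearMap.mem_ker, Cech.d_q, LinearMap.mem_ker.1 z.2, map_zero]⟩ :=
  liftₗ_mk _ _ _ _ _

lemma map_mk (φ : X →ₗ[R] Y) (z : ↥(LinearMap.ker (Cech.d y (X := X)))) :
    map y φ (mk y z) = mk y ⟨Cech.map y φ z, by
      rw [LinearMap.mem_ker, ← Cech.map_d, LinearMap.mem_ker.1 z.2, map_zero]⟩ :=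
  liftₗ_mk _ _ _ _ _

lemma map_q (φ : X →ₗ[R] Y) (i : ℤ) (h : HH y X) : map y φ (q y i h) = q y i (map y φ h) := by
  obtain ⟨z, rfl⟩ := ind y h
  simp only [q_mk, map_mk, Cech.map_q]

lemma q_idem (i : ℤ) (h : HH y X) : q y i (q y i h) = q y i h := by
  obtain ⟨⟨z, hz⟩, rfl⟩ := ind y h
  simp only [q_mk]
  congr 2
  obtain ⟨t, f, rfl⟩ := Cech.ind y z
  simp only [Cech.q_mk]
  congr 1
  funext S
  simp only [kq_apply]
  split_ifs <;> rfl

lemma q_neg {i : ℤ} (hi : i < 0) (h : HH y X) : q y i h = 0 := by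
  obtain ⟨⟨z, hz⟩, rfl⟩ := ind y h
  rw [q_mk, ← map_zero (mk y)]
  congr 2
  obtain ⟨t, f, rfl⟩ := Cech.ind y z
  simp only [Cech.q_mk]
  rw [← map_zero (Cech.mk y t)]
  congr 1
  funext S
  rw [kq_apply, if_neg (by omega)]
  rfl

lemma map_comp_apply (φ : X →ₗ[R] Y) (ψ : Y →ₗ[R] Z) (x : HH y X) :
    map y ψ (map y φ x) = map y (ψ ∘ₗ φ) x := by
  obtain ⟨z, rfl⟩ := ind y x
  simp only [map_mk, Cech.map_comp_apply]

lemma map_smul_id (r : R) (x : HH y X) : map y (r • LinearMap.id) x = r • x := by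
  obtain ⟨z, rfl⟩ := ind y x
  simp only [map_mk, Cech.map_smul_id]
  rw [← map_smul]
  rfl

lemma map_add_apply (φ ψ : X →ₗ[R] Y) (x : HH y X) :
    map y (φ + ψ) x = map y φ x + map y ψ x := by
  obtain ⟨z, rfl⟩ := ind y x
  simp only [map_mk, Cech.map_add_apply]
  rw [← map_add]
  rfl

lemma map_zero_apply (x : HH y X) : map y (0 : X →ₗ[R] Y) x = 0 := by
  obtain ⟨z, rfl⟩ := ind y x
  simp only [map_mk, Cech.map_zero_apply]
  exact map_zero _

lemma map_id_apply (x : HH y X) : map y LinearMap.id x = x := by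
  have := map_smul_id y 1 x
  rwa [one_smul, one_smul] at this

end HH

/-- Short exact sequences of modules. -/
structure SES (ι : X →ₗ[R] Y) (φ : Y →ₗ[R] Z) : Prop where
  inj : Function.Injective ι
  surj : Function.Surjective φ
  exact : ∀ b, φ b = 0 → ∃ a, ι a = b
  comp : ∀ a, φ (ι a) = 0

namespace SES

variable {y}
variable {ι : X →ₗ[R] Y} {φ : Y →ₗ[R] Z} (S : SES ι φ)

include S in
lemma cech_comp (a : Cech y X) : Cech.map y φ (Cech.map y ι a) = 0 := by
  rw [Cech.map_comp_apply]
  convert Cech.map_zero_apply y a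
  ext a
  exact S.comp a

include S in
lemma exact_mid (b : HH y Y) (hb : HH.map y φ b = 0) : ∃ a, HH.map y ι a = b := by
  obtain ⟨z, rfl⟩ := HH.ind y b
  rw [HH.map_mk, HH.mk_eq_zero_iff] at hb
  obtain ⟨g, hg⟩ := hb
  obtain ⟨g', rfl⟩ := Cech.map_surjective y S.surj g
  obtain ⟨a, ha⟩ := Cech.map_exact y S.exact (z - Cech.d y g') (by
    rw [map_sub, Cech.map_d, hg, sub_self])
  refine ⟨HH.mk y ⟨a, ?_⟩, ?_⟩
  · rw [LinearMap.mem_ker]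
    apply Cech.map_injective y S.inj
    rw [map_zero, Cech.map_d, ha, map_sub, Cech.d_d, LinearMap.mem_ker.1 z.2, sub_zero]
  · rw [HH.map_mk, HH.mk_eq_mk_iff]
    exact ⟨-g', by simp [ha]⟩

include S in
lemma exists_conn (h : HH y Z) : ∃ (g : Cech y Y) (a : ↥(LinearMap.ker (Cech.d y (X := X))))
    (hg : Cech.map y φ g ∈ LinearMap.ker (Cech.d y)),
    h = HH.mk y ⟨Cech.map y φ g, hg⟩ ∧ Cech.d y g = Cech.map y ι a := by
  obtain ⟨⟨z, hz⟩, rfl⟩ := HH.ind y h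
  obtain ⟨g, rfl⟩ := Cech.map_surjective y S.surj z
  obtain ⟨a, ha⟩ := Cech.map_exact y S.exact (Cech.d y g) (by
    rw [Cech.map_d]
    exact hz)
  refine ⟨g, ⟨a, ?_⟩, hz, rfl, ha.symm⟩
  rw [LinearMap.mem_ker]
  apply Cech.map_injective y S.inj
  rw [map_zero, Cech.map_d, ha, Cech.d_d]

include S in
lemma conn_unique {g : Cech y Y} {a : ↥(LinearMap.ker (Cech.d y (X := X)))}
    {z : ↥(LinearMap.ker (Cech.d y (X := Z)))} (hz : Cech.map y φ g = z)
    (hga : Cech.d y g = Cech.map y ι a) (h0 : HH.mk y z = 0) : HH.mk y a = 0 := by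
  rw [HH.mk_eq_zero_iff] at h0 ⊢
  obtain ⟨c, hc⟩ := h0
  obtain ⟨c', rfl⟩ := Cech.map_surjective y S.surj c
  obtain ⟨b, hb⟩ := Cech.map_exact y S.exact (g - Cech.d y c') (by
    rw [map_sub, Cech.map_d, hz, hc, sub_self])
  refine ⟨b, ?_⟩
  apply Cech.map_injective y S.inj
  rw [Cech.map_d, hb, map_sub, Cech.d_d, sub_zero, hga]

/-- The value of the connecting map. -/
def connFun (h : HH y Z) : HH y X := HH.mk y (S.exists_conn h).choose_spec.choose

lemma connFun_mk {g : Cech y Y} {a : ↥(LinearMap.ker (Cech.d y (X := X)))}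
    {z : ↥(LinearMap.ker (Cech.d y (X := Z)))} (hz : Cech.map y φ g = z)
    (hga : Cech.d y g = Cech.map y ι a) : S.connFun (HH.mk y z) = HH.mk y a := by
  unfold connFun
  generalize_proofs p1 p2
  obtain ⟨hg, h1, h2⟩ := p2.choose_spec
  rw [← sub_eq_zero, ← map_sub]
  refine S.conn_unique (g := p1.choose - g) (z := ⟨_, hg⟩ - z) ?_ ?_ ?_
  · rw [map_sub, hz]
    rfl
  · exact (map_sub _ _ _).trans ((congrArg₂ (· - ·) h2 hga).trans (map_sub _ _ _).symm)
  · rw [map_sub, ← h1, sub_self]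

/-- The connecting map in Čech cohomology. -/
def conn : HH y Z →ₗ[R] HH y X where
  toFun := S.connFun
  map_add' h h' := by
    obtain ⟨g, a, hg, rfl, hga⟩ := S.exists_conn h
    obtain ⟨g', a', hg', rfl, hga'⟩ := S.exists_conn h'
    rw [S.connFun_mk (g := g) rfl hga, S.connFun_mk (g := g') rfl hga', ← map_add, ← map_add]
    refine S.connFun_mk (g := g + g') ?_ ?_
    · simp
    · simp [hga, hga']
  map_smul' r h := by
    obtain ⟨g, a, hg, rfl, hga⟩ := S.exists_conn h
    rw [S.connFun_mk (g := g) rfl hga, RingHom.id_apply, ← map_smul, ← map_smul]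
    refine S.connFun_mk (g := r • g) ?_ ?_
    · simp
    · simp [hga]

lemma conn_mk {g : Cech y Y} {a : ↥(LinearMap.ker (Cech.d y (X := X)))}
    {z : ↥(LinearMap.ker (Cech.d y (X := Z)))} (hz : Cech.map y φ g = z)
    (hga : Cech.d y g = Cech.map y ι a) : S.conn (HH.mk y z) = HH.mk y a := S.connFun_mk hz hga

lemma map_conn (h : HH y Z) : HH.map y ι (S.conn h) = 0 := by
  obtain ⟨g, a, hg, rfl, hga⟩ := S.exists_conn h
  rw [S.conn_mk rfl hga, HH.map_mk, HH.mk_eq_zero_iff]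
  exact ⟨g, hga⟩

lemma exact_right (h : HH y Z) (h0 : S.conn h = 0) : ∃ b, HH.map y φ b = h := by
  obtain ⟨g, a, hg, rfl, hga⟩ := S.exists_conn h
  rw [S.conn_mk rfl hga, HH.mk_eq_zero_iff] at h0
  obtain ⟨c, hc⟩ := h0
  refine ⟨HH.mk y ⟨g - Cech.map y ι c, ?_⟩, ?_⟩
  · rw [LinearMap.mem_ker, map_sub, ← Cech.map_d, hc, hga, sub_self]
  · rw [HH.map_mk]
    congr 2
    rw [map_sub, S.cech_comp, sub_zero]

lemma exact_left (a : HH y X) (ha : HH.map y ι a = 0) : ∃ h, S.conn h = a := by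
  obtain ⟨z, rfl⟩ := HH.ind y a
  rw [HH.map_mk, HH.mk_eq_zero_iff] at ha
  obtain ⟨g, hg⟩ := ha
  refine ⟨HH.mk y ⟨Cech.map y φ g, ?_⟩, S.conn_mk (g := g) rfl hg⟩
  rw [LinearMap.mem_ker, ← Cech.map_d, hg, S.cech_comp]

lemma conn_q (i : ℤ) (h : HH y Z) : S.conn (HH.q y i h) = HH.q y (i + 1) (S.conn h) := by
  obtain ⟨g, a, hg, rfl, hga⟩ := S.exists_conn h
  rw [S.conn_mk (g := g) rfl hga, HH.q_mk, HH.q_mk]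
  refine S.conn_mk (g := Cech.q y i g) ?_ ?_
  · rw [Cech.map_q]
  · rw [Cech.d_q, hga, Cech.map_q]

end SES

end Cohomology

section Grading

variable (𝒜 : ℤ → AddSubgroup R) (X : Type) [AddCommGroup X] [Module R X]

/-- A family of idempotent additive operators on a module, compatible with the grading of the ring.
The projections to the components of a graded module form such a family. -/
structure GrProj where
  P : ℤ → X →+ X
  idem : ∀ ℓ x, P ℓ (P ℓ x) = P ℓ x
  P_smul : ∀ {a r}, r ∈ 𝒜 a → ∀ ℓ x, P (a + ℓ) (r • x) = r • P ℓ x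

variable {𝒜 X} {Y Z : Type} [AddCommGroup Y] [Module R Y] [AddCommGroup Z] [Module R Z]

/-- Linear maps that are homogeneous of degree `β`. -/
def GrHom (P : GrProj 𝒜 X) (Q : GrProj 𝒜 Y) (φ : X →ₗ[R] Y) (β : ℤ) : Prop :=
  ∀ ℓ x, Q.P (β + ℓ) (φ x) = φ (P.P ℓ x)

variable [GradedRing 𝒜] {n : ℕ} {y : Fin n → R} {e : Fin n → ℤ} (hy : ∀ j, y j ∈ 𝒜 (e j))

include hy in
lemma prod_pow_mem (S : Finset (Fin n)) (s : ℕ) :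
    (∏ j ∈ S, y j) ^ s ∈ 𝒜 ((s : ℤ) * ∑ j ∈ S, e j) := by
  have h1 : ∏ j ∈ S, y j ∈ 𝒜 (∑ j ∈ S, e j) := SetLike.prod_mem_graded _ _ _ (fun j _ => hy j)
  have := SetLike.pow_mem_graded s h1
  rwa [nsmul_eq_mul] at this

include hy in
lemma pow_mem_graded (j : Fin n) (s : ℕ) : y j ^ s ∈ 𝒜 ((s : ℤ) * e j) := by
  have := SetLike.pow_mem_graded s (hy j)
  rwa [nsmul_eq_mul] at this

/-- The operators of a graded module on Koszul cochains of level `t`. -/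
def kP (P : GrProj 𝒜 X) (e : Fin n → ℤ) (ℓ : ℤ) (t : ℕ) :
    (Finset (Fin n) → X) →+ (Finset (Fin n) → X) where
  toFun f S := P.P (ℓ + t * ∑ j ∈ S, e j) (f S)
  map_zero' := by
    funext S
    simp
  map_add' f g := by
    funext S
    simp

omit [GradedRing 𝒜] in
lemma kP_apply (P : GrProj 𝒜 X) (e : Fin n → ℤ) (ℓ : ℤ) (t : ℕ) (f : Finset (Fin n) → X)
    (S : Finset (Fin n)) : kP P e ℓ t f S = P.P (ℓ + t * ∑ j ∈ S, e j) (f S) := rfl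

include hy in
lemma kP_kT (P : GrProj 𝒜 X) (ℓ : ℤ) (t s : ℕ) (f : Finset (Fin n) → X) :
    kP P e ℓ (t + s) (kT y s f) = kT y s (kP P e ℓ t f) := by
  funext S
  rw [kP_apply, kT_apply, kT_apply, kP_apply, ← P.P_smul (prod_pow_mem hy S s)]
  congr 2
  push_cast
  ring

include hy in
lemma kup_kP (P : GrProj 𝒜 X) (ℓ : ℤ) (t : ℕ) (f : Finset (Fin n) → X) :
    kup (fun j => y j ^ t) (kP P e ℓ t f) = kP P e ℓ t (kup (fun j => y j ^ t) f) := by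
  funext T
  rw [kP_apply, kup_apply, kup_apply, map_sum]
  refine Finset.sum_congr rfl fun j _ => ?_
  split_ifs with hj
  · rw [kP_apply, ← P.P_smul (pow_mem_graded hy j t), map_zsmul, ← Finset.add_sum_erase T e hj]
    congr 3
    ring
  · simp

/-- The operators of a graded module on the Čech complex. -/
def Cech.p (P : GrProj 𝒜 X) (ℓ : ℤ) : Cech y X →+ Cech y X :=
  Cech.lift y (kP P e ℓ) (kP_kT hy P ℓ)

lemma Cech.p_mk (P : GrProj 𝒜 X) (ℓ : ℤ) (t : ℕ) (f : Finset (Fin n) → X) :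
    Cech.p hy P ℓ (Cech.mk y t f) = Cech.mk y t (kP P e ℓ t f) := rfl

lemma Cech.d_p (P : GrProj 𝒜 X) (ℓ : ℤ) (x : Cech y X) :
    Cech.d y (Cech.p hy P ℓ x) = Cech.p hy P ℓ (Cech.d y x) := by
  obtain ⟨t, f, rfl⟩ := Cech.ind y x
  rw [Cech.p_mk, Cech.d_mk, Cech.d_mk, Cech.p_mk, kup_kP hy]

lemma Cech.p_q (P : GrProj 𝒜 X) (ℓ i : ℤ) (x : Cech y X) :
    Cech.p hy P ℓ (Cech.q y i x) = Cech.q y i (Cech.p hy P ℓ x) := by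
  obtain ⟨t, f, rfl⟩ := Cech.ind y x
  rw [Cech.p_mk, Cech.q_mk, Cech.q_mk, Cech.p_mk]
  congr 1
  funext S
  simp only [kP_apply, kq_apply]
  split_ifs <;> simp

lemma Cech.p_map {P : GrProj 𝒜 X} {Q : GrProj 𝒜 Y} {φ : X →ₗ[R] Y} {β : ℤ} (h : GrHom P Q φ β)
    (ℓ : ℤ) (x : Cech y X) :
    Cech.p hy Q (β + ℓ) (Cech.map y φ x) = Cech.map y φ (Cech.p hy P ℓ x) := by
  obtain ⟨t, f, rfl⟩ := Cech.ind y x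
  rw [Cech.p_mk, Cech.map_mk, Cech.map_mk, Cech.p_mk]
  congr 1
  funext S
  rw [kP_apply, kP_apply, ← h _ _, add_assoc]

/-- The operators of a graded module on Čech cohomology. -/
def HH.p (P : GrProj 𝒜 X) (ℓ : ℤ) : HH y X →+ HH y X :=
  HH.lift y (Cech.p hy P ℓ) (fun z hz => by rw [Cech.d_p, hz, map_zero])
    (fun g => ⟨Cech.p hy P ℓ g, by rw [Cech.d_p]⟩)

lemma HH.p_mk (P : GrProj 𝒜 X) (ℓ : ℤ) (z : ↥(LinearMap.ker (Cech.d y (X := X)))) :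
    HH.p hy P ℓ (HH.mk y z) = HH.mk y ⟨Cech.p hy P ℓ z, by
      rw [LinearMap.mem_ker, Cech.d_p, LinearMap.mem_ker.1 z.2, map_zero]⟩ :=
  HH.lift_mk _ _ _ _ _

lemma HH.p_q (P : GrProj 𝒜 X) (ℓ i : ℤ) (h : HH y X) :
    HH.p hy P ℓ (HH.q y i h) = HH.q y i (HH.p hy P ℓ h) := by
  obtain ⟨z, rfl⟩ := HH.ind y h
  simp only [HH.q_mk, HH.p_mk, Cech.p_q]

lemma HH.p_map {P : GrProj 𝒜 X} {Q : GrProj 𝒜 Y} {φ : X →ₗ[R] Y} {β : ℤ} (h : GrHom P Q φ β)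
    (ℓ : ℤ) (x : HH y X) :
    HH.p hy Q (β + ℓ) (HH.map y φ x) = HH.map y φ (HH.p hy P ℓ x) := by
  obtain ⟨z, rfl⟩ := HH.ind y x
  simp only [HH.map_mk, HH.p_mk, Cech.p_map hy h]

lemma HH.p_map_zero {P : GrProj 𝒜 X} {Q : GrProj 𝒜 Y} {φ : X →ₗ[R] Y} (h : GrHom P Q φ 0)
    (ℓ : ℤ) (x : HH y X) :
    HH.p hy Q ℓ (HH.map y φ x) = HH.map y φ (HH.p hy P ℓ x) := by
  rw [← HH.p_map hy h, zero_add]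

lemma HH.p_smul (P : GrProj 𝒜 X) {a : ℤ} {r : R} (hr : r ∈ 𝒜 a) (ℓ : ℤ) (x : HH y X) :
    HH.p hy P (a + ℓ) (r • x) = r • HH.p hy P ℓ x := by
  have h : GrHom P P (r • LinearMap.id) a := fun ℓ x => P.P_smul hr ℓ x
  rw [← HH.map_smul_id, HH.p_map hy h, HH.map_smul_id]

lemma HH.p_idem (P : GrProj 𝒜 X) (ℓ : ℤ) (h : HH y X) :
    HH.p hy P ℓ (HH.p hy P ℓ h) = HH.p hy P ℓ h := by
  obtain ⟨⟨z, hz⟩, rfl⟩ := HH.ind y h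
  simp only [HH.p_mk]
  congr 2
  obtain ⟨t, f, rfl⟩ := Cech.ind y z
  simp only [Cech.p_mk]
  congr 1
  funext S
  simp only [kP_apply, P.idem]

lemma SES.conn_p {ι : X →ₗ[R] Y} {φ : Y →ₗ[R] Z} (S : SES ι φ) {P : GrProj 𝒜 X} {Q : GrProj 𝒜 Y}
    {T : GrProj 𝒜 Z} (hι : GrHom P Q ι 0) (hφ : GrHom Q T φ 0) (ℓ : ℤ) (h : HH y Z) :
    S.conn (HH.p hy T ℓ h) = HH.p hy P ℓ (S.conn h) := by
  obtain ⟨g, a, hg, rfl, hga⟩ := S.exists_conn h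
  rw [S.conn_mk (g := g) rfl hga, HH.p_mk, HH.p_mk]
  refine S.conn_mk (g := Cech.p hy Q ℓ g) ?_ ?_
  · rw [← Cech.p_map hy hφ, zero_add]
  · rw [Cech.d_p, hga, ← Cech.p_map hy hι, zero_add]

/-- The vanishing of the degree `ℓ` part of the cohomology in degree `i`. -/
def Van (P : GrProj 𝒜 X) (i ℓ : ℤ) : Prop := ∀ h : HH y X, HH.q y i (HH.p hy P ℓ h) = 0

variable (y) in
/-- The vanishing of the cohomology in degree `i`. -/
def Van₀ (X : Type) [AddCommGroup X] [Module R X] (i : ℤ) : Prop := ∀ h : HH y X, HH.q y i h = 0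

lemma Van₀.van {i : ℤ} (h : Van₀ y X i) (P : GrProj 𝒜 X) (ℓ : ℤ) : Van hy P i ℓ :=
  fun _ => h _

lemma Van₀.of_neg {i : ℤ} (hi : i < 0) : Van₀ y X i := fun h => HH.q_neg y hi h

namespace SES

variable {ι : X →ₗ[R] Y} {φ : Y →ₗ[R] Z} {P : GrProj 𝒜 X} {Q : GrProj 𝒜 Y}
    {T : GrProj 𝒜 Z} {i ℓ : ℤ}

lemma van_right (S : SES ι φ) (hι : GrHom P Q ι 0) (hφ : GrHom Q T φ 0)
    (h1 : Van hy Q i ℓ) (h2 : Van hy P (i + 1) ℓ) : Van hy T i ℓ := by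
  intro x
  obtain ⟨c, hc⟩ := S.exact_right (HH.q y i (HH.p hy T ℓ x)) (by
    rw [S.conn_q, S.conn_p hy hι hφ, h2])
  rw [← HH.q_idem, ← HH.p_idem, ← HH.p_q, ← hc, HH.p_map_zero hy hφ, ← HH.map_q, h1, map_zero]

end SES

end Grading

section Ungraded

variable {n : ℕ} {y : Fin n → R} {X Y Z : Type} [AddCommGroup X] [Module R X]
  [AddCommGroup Y] [Module R Y] [AddCommGroup Z] [Module R Z]
  {ι : X →ₗ[R] Y} {φ : Y →ₗ[R] Z} {i : ℤ}

lemma SES.van₀_left (S : SES ι φ) (h1 : Van₀ y Z i) (h2 : Van₀ y Y (i + 1)) :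
    Van₀ y X (i + 1) := by
  intro x
  obtain ⟨c, hc⟩ := S.exact_left (HH.q y (i + 1) x) (by rw [HH.map_q, h2])
  rw [← HH.q_idem, ← hc, ← S.conn_q, h1, map_zero]

lemma SES.van₀_mid (S : SES ι φ) (h1 : Van₀ y X i) (h2 : Van₀ y Z i) : Van₀ y Y i := by
  intro x
  obtain ⟨c, hc⟩ := S.exact_mid (HH.q y i x) (by rw [HH.map_q, h2])
  rw [← HH.q_idem, ← hc, ← HH.map_q, h1, map_zero]

lemma van₀_of_subsingleton [Subsingleton X] (i : ℤ) : Van₀ y X i := by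
  intro h
  have : h = 0 := by
    rw [← HH.map_id_apply y h, ← HH.map_zero_apply y h]
    congr 2
    exact Subsingleton.elim _ _
  rw [this, map_zero]

end Ungraded

section Torsion

variable {n : ℕ} {y : Fin n → R} {X : Type} [AddCommGroup X] [Module R X]

lemma Cech.ind_cocycle (x : Cech y X) (hx : Cech.d y x = 0) :
    ∃ t f, x = Cech.mk y t f ∧ kup (fun j => y j ^ t) f = 0 := by
  obtain ⟨t, f, rfl⟩ := Cech.ind y x
  rw [Cech.d_mk, Cech.mk_eq_zero_iff] at hx
  obtain ⟨s, hs⟩ := hx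
  exact ⟨t + s, kT y s f, Cech.mk_level y t s f, by rw [kup_kT, hs]⟩

lemma HH.exists_pow_smul_eq_zero (j : Fin n) (h : HH y X) : ∃ t : ℕ, y j ^ t • h = 0 := by
  obtain ⟨⟨z, hz⟩, rfl⟩ := HH.ind y h
  obtain ⟨t, f, rfl, hf⟩ := Cech.ind_cocycle z hz
  refine ⟨t, ?_⟩
  rw [← map_smul, HH.mk_eq_zero_iff]
  refine ⟨Cech.mk y t (kdown (Pi.single j (1 : R)) f), ?_⟩
  have := kup_kdown_add (fun j => y j ^ t) (Pi.single j (1 : R)) f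
  rw [hf, map_zero, add_zero] at this
  rw [Cech.d_mk, this]
  simp [Pi.single_apply]

lemma exists_pow_smul_of_radical {H : Type} [AddCommGroup H] [Module R H] {h : H}
    (hh : ∀ j, ∃ t : ℕ, y j ^ t • h = 0) {r : R}
    (hr : r ∈ (Ideal.span (Set.range y)).radical) : ∃ t : ℕ, r ^ t • h = 0 := by
  have h1 : Ideal.span (Set.range y) ≤ (Ideal.torsionOf R H h).radical := by
    rw [Ideal.span_le]
    rintro _ ⟨j, rfl⟩
    exact hh j
  have h2 := Ideal.radical_mono h1 hr
  rw [Ideal.radical_idem] at h2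
  exact h2

lemma HH.eq_zero_of_smul {r : R} (hr : r ∈ (Ideal.span (Set.range y)).radical) {i : ℤ}
    (h0 : ∀ h : HH y X, r • HH.q y i h = 0 → HH.q y i h = 0) : Van₀ y X i := by
  intro h
  obtain ⟨t, ht⟩ := exists_pow_smul_of_radical (fun j => HH.exists_pow_smul_eq_zero j h) hr
  induction t generalizing h with
  | zero => rw [pow_zero, one_smul] at ht; rw [ht, map_zero]
  | succ t ih =>
    rw [pow_succ, mul_smul] at ht
    have := ih (r • h) ht
    rw [map_smul] at this
    exact h0 h this

lemma van₀_of_torsion (hX : ∀ (x : X) j, ∃ t : ℕ, y j ^ t • x = 0) {i : ℤ} (hi : 1 ≤ i) :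
    Van₀ y X i := by
  intro h
  obtain ⟨⟨z, hz⟩, rfl⟩ := HH.ind y h
  obtain ⟨t, f, rfl⟩ := Cech.ind y z
  rw [HH.q_mk, ← map_zero (HH.mk y)]
  congr 2
  rw [Cech.q_mk, Cech.mk_eq_zero_iff]
  choose g hg using hX
  refine ⟨∑ S, ∑ j, g (f S) j, ?_⟩
  funext S
  rw [kT_apply, kq_apply]
  split_ifs with hS
  · have hne : S.Nonempty := by
      rw [← Finset.card_pos]
      omega
    obtain ⟨j, hj⟩ := hne
    have h1 : g (f S) j ≤ ∑ S, ∑ j, g (f S) j :=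
      (Finset.single_le_sum (f := fun j => g (f S) j) (fun _ _ => Nat.zero_le _)
        (Finset.mem_univ j)).trans
        (Finset.single_le_sum (f := fun S => ∑ j, g (f S) j) (fun _ _ => Nat.zero_le _)
          (Finset.mem_univ S))
    obtain ⟨c, hc⟩ : y j ^ g (f S) j ∣ (∏ j ∈ S, y j) ^ ∑ S, ∑ j, g (f S) j :=
      (pow_dvd_pow _ h1).trans (pow_dvd_pow_of_dvd (Finset.dvd_prod_of_mem y hj) _)
    rw [hc, mul_comm, mul_smul, hg, smul_zero]
    rfl
  · exact smul_zero _

open Pointwise in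
/-- Multiplication by a nonzerodivisor. -/
lemma SES.of_isSMulRegular {r : R} (hr : IsSMulRegular X r) :
    SES (r • LinearMap.id : X →ₗ[R] X) (r • (⊤ : Submodule R X)).mkQ where
  inj := hr
  surj := Submodule.mkQ_surjective _
  exact b hb := by
    rw [Submodule.mkQ_apply, Submodule.Quotient.mk_eq_zero,
      Submodule.mem_smul_pointwise_iff_exists] at hb
    obtain ⟨a, -, ha⟩ := hb
    exact ⟨a, ha⟩
  comp a := by
    rw [Submodule.mkQ_apply, Submodule.Quotient.mk_eq_zero,
      Submodule.mem_smul_pointwise_iff_exists]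
    exact ⟨a, trivial, rfl⟩

/-- The sequence of a submodule and its quotient. -/
lemma SES.of_submodule (N : Submodule R X) : SES N.subtype N.mkQ where
  inj := N.subtype_injective
  surj := N.mkQ_surjective
  exact b hb := ⟨⟨b, (Submodule.Quotient.mk_eq_zero N).1 hb⟩, rfl⟩
  comp a := (Submodule.Quotient.mk_eq_zero N).2 a.2

lemma van₀_of_van₀_quot {r : R} (hr : r ∈ (Ideal.span (Set.range y)).radical)
    (hreg : IsSMulRegular X r) {i : ℤ} (h : Van₀ y (QuotSMulTop r X) (i - 1)) : Van₀ y X i := by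
  refine HH.eq_zero_of_smul hr fun x hx => ?_
  obtain ⟨c, hc⟩ := (SES.of_isSMulRegular hreg).exact_left (HH.q y i x) (by
    rw [HH.map_smul_id, hx])
  have := congrArg (HH.q y i) hc
  rw [HH.q_idem] at this
  have h2 := (SES.of_isSMulRegular hreg).conn_q (i - 1) c
  rw [sub_add_cancel, h c, map_zero] at h2
  rw [← this, ← h2]

lemma van₀_of_isWeaklyRegular {rs : List R}
    (hrs : ∀ r ∈ rs, r ∈ (Ideal.span (Set.range y)).radical)
    (hreg : RingTheory.Sequence.IsWeaklyRegular X rs) {i : ℤ} (hi : i < rs.length) :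
    Van₀ y X i := by
  induction rs generalizing X i with
  | nil => exact Van₀.of_neg (by simpa using hi)
  | cons r rs ih =>
    rw [RingTheory.Sequence.isWeaklyRegular_cons_iff] at hreg
    refine van₀_of_van₀_quot (hrs r (by simp)) hreg.1
      (ih (fun r hr => hrs r (by simp [hr])) hreg.2 ?_)
    simp only [List.length_cons] at hi
    push_cast at hi
    omega

lemma van₀_of_depthGE {I : Ideal R} (hI : I ≤ (Ideal.span (Set.range y)).radical) {k : ℕ}
    (h : depthGE I X k) {i : ℤ} (hi : i < k) : Van₀ y X i := by
  rcases h with h | ⟨rs, rfl, h1, h2⟩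
  · exact van₀_of_subsingleton i
  · exact van₀_of_isWeaklyRegular (fun r hr => hI (h1 r hr)) h2.toIsWeaklyRegular hi

lemma mem_torsionSubmodule_iff [IsNoetherianRing R] {I : Ideal R} {x : X} :
    x ∈ torsionSubmodule I X ↔ I ≤ (Ideal.torsionOf R X x).radical := by
  constructor
  · rintro ⟨t, ht⟩ r hr
    exact ⟨t, ht _ (Ideal.pow_mem_pow hr t)⟩
  · intro h
    obtain ⟨t, ht⟩ := Ideal.exists_pow_le_of_le_radical_of_fg h (IsNoetherian.noetherian I)
    exact ⟨t, fun r hr => ht hr⟩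

lemma mem_torsionSubmodule_iff_y [IsNoetherianRing R] {I : Ideal R}
    (hI : (Ideal.span (Set.range y)).radical = I.radical) {x : X} :
    x ∈ torsionSubmodule I X ↔ ∀ j, ∃ t : ℕ, y j ^ t • x = 0 := by
  rw [mem_torsionSubmodule_iff, ← Ideal.IsRadical.radical_le_iff (Ideal.radical_isRadical _), ← hI,
    Ideal.IsRadical.radical_le_iff (Ideal.radical_isRadical _), Ideal.span_le]
  exact ⟨fun h j => h ⟨j, rfl⟩, fun h => by rintro _ ⟨j, rfl⟩; exact h j⟩

lemma van₀_torsionSubmodule [IsNoetherianRing R] {I : Ideal R}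
    (hI : (Ideal.span (Set.range y)).radical = I.radical) {i : ℤ} (hi : 1 ≤ i) :
    Van₀ y (torsionSubmodule I X) i := by
  refine van₀_of_torsion (fun x j => ?_) hi
  obtain ⟨t, ht⟩ := (mem_torsionSubmodule_iff_y hI).1 x.2 j
  exact ⟨t, Subtype.ext ht⟩

lemma eq_zero_of_smul_eq_zero_quot_torsion [IsNoetherianRing R] {I : Ideal R}
    (x : X ⧸ torsionSubmodule I X) (hx : ∀ r ∈ I, r • x = 0) : x = 0 := by
  obtain ⟨x, rfl⟩ := Submodule.Quotient.mk_surjective _ x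
  rw [Submodule.Quotient.mk_eq_zero, mem_torsionSubmodule_iff]
  intro r hr
  have h1 := hx r hr
  rw [← Submodule.Quotient.mk_smul, Submodule.Quotient.mk_eq_zero, mem_torsionSubmodule_iff] at h1
  obtain ⟨k, hk⟩ := h1 hr
  refine ⟨k + 1, ?_⟩
  rw [Ideal.mem_torsionOf_iff, smul_smul, ← pow_succ] at hk
  exact hk

lemma exists_isSMulRegular_quot_torsion [IsNoetherianRing R] [Module.Finite R X] (I : Ideal R) :
    ∃ r ∈ I, IsSMulRegular (X ⧸ torsionSubmodule I X) r := by
  have : Subsingleton ((R ⧸ I) →ₗ[R] (X ⧸ torsionSubmodule I X)) := by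
    refine ⟨fun f g => ?_⟩
    refine Submodule.linearMap_qext _ (LinearMap.ext_ring ?_)
    rw [← sub_eq_zero]
    apply eq_zero_of_smul_eq_zero_quot_torsion
    intro r hr
    have h0 : Submodule.Quotient.mk (p := I) r = 0 := (Submodule.Quotient.mk_eq_zero I).2 hr
    have h1 : r • (Submodule.Quotient.mk (p := I) (1 : R)) = 0 := by
      rw [← Submodule.Quotient.mk_smul, smul_eq_mul, mul_one, h0]
    simp only [LinearMap.comp_apply, Submodule.mkQ_apply]
    rw [smul_sub, ← map_smul, ← map_smul, h1, map_zero, map_zero, sub_zero]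
  obtain ⟨r, hr, h⟩ := IsSMulRegular.subsingleton_linearMap_iff.1 this
  rw [Ideal.annihilator_quotient] at hr
  exact ⟨r, hr, h⟩

lemma van₀_of_supportDim_lt [IsNoetherianRing R] [Module.Finite R X] {b : ℕ}
    (hb : Module.supportDim R X < b) {i : ℤ} (hi : b ≤ i) : Van₀ y X i := by
  induction b generalizing X i with
  | zero =>
    have : Subsingleton X := by
      by_contra h
      rw [not_subsingleton_iff_nontrivial, ← Module.supportDim_ne_bot_iff_nontrivial R,
        WithBot.ne_bot_iff_exists] at h
      obtain ⟨a, ha⟩ := h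
      rw [← ha] at hb
      exact absurd hb (not_lt.2 (WithBot.coe_le_coe.2 (zero_le : (0 : ℕ∞) ≤ a)))
    exact van₀_of_subsingleton i
  | succ b ih =>
    set I := Ideal.span (Set.range y)
    have hT : Van₀ y (torsionSubmodule I X) i := van₀_torsionSubmodule rfl (by push_cast at hi; omega)
    refine (SES.of_submodule (torsionSubmodule I X)).van₀_mid hT ?_
    obtain ⟨r, hr, hreg⟩ := exists_isSMulRegular_quot_torsion (X := X) I
    refine van₀_of_van₀_quot (Ideal.le_radical hr) hreg (ih ?_ (by push_cast at hi; omega))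
    have h1 := Module.supportDim_quotSMulTop_succ_le_of_notMem_minimalPrimes (R := R)
      (M := X ⧸ torsionSubmodule I X) (x := r) (fun _ => hreg.notMem_of_mem_minimalPrimes)
    have h2 := Module.supportDim_le_of_surjective _ (torsionSubmodule I X).mkQ_surjective
    have h3 := (h1.trans h2).trans_lt hb
    push_cast at h3
    exact lt_of_add_lt_add_right h3

end Torsion

section KoszulHomology

variable {n m : ℕ} {y : Fin n → R} {z : Fin m → R} {X : Type} [AddCommGroup X] [Module R X]

lemma supportDim_quotSMulTop_lt [IsNoetherianRing R] [Module.Finite R X] {r : R}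
    (hreg : IsSMulRegular X r) {k : ℕ}
    (hk : Module.supportDim R X < ((k + 1 : ℕ) : WithBot ℕ∞)) :
    Module.supportDim R (QuotSMulTop r X) < (k : WithBot ℕ∞) := by
  have h1 := Module.supportDim_quotSMulTop_succ_le_of_notMem_minimalPrimes (R := R)
    (M := X) (x := r) (fun _ => hreg.notMem_of_mem_minimalPrimes)
  have h3 := h1.trans_lt hk
  push_cast at h3
  exact lt_of_add_lt_add_right h3

/-- Multiplication by a regular element is surjective on the top cohomology. -/
lemma exists_smul_eq_of_supportDim_le [IsNoetherianRing R] [Module.Finite R X] {r : R}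
    (hreg : IsSMulRegular X r) {k : ℕ}
    (hk : Module.supportDim R X < ((k + 1 + 1 : ℕ) : WithBot ℕ∞)) (h : HH y X)
    (hh : HH.q y ((k + 1 : ℕ) : ℤ) h = h) :
    ∃ h', HH.q y ((k + 1 : ℕ) : ℤ) h' = h' ∧ r • h' = h := by
  have hv : Van₀ y (QuotSMulTop r X) ((k + 1 : ℕ) : ℤ) :=
    van₀_of_supportDim_lt (b := k + 1) (supportDim_quotSMulTop_lt hreg hk) le_rfl
  obtain ⟨c, hc⟩ := (SES.of_isSMulRegular hreg).exact_mid h (by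
    rw [← hh, HH.map_q]
    exact hv _)
  refine ⟨HH.q y _ c, HH.q_idem y _ _, ?_⟩
  rw [HH.map_smul_id] at hc
  rw [← map_smul, hc, hh]

/-- The Koszul homology of the top cohomology of a Cohen-Macaulay module. -/
lemma exists_kdown_eq [IsNoetherianRing R] [Module.Finite R X] {rs : List R}
    (hy : ∀ r ∈ rs, r ∈ (Ideal.span (Set.range y)).radical)
    (hz : ∀ r ∈ rs, r ∈ Ideal.span (Set.range z))
    (hreg : RingTheory.Sequence.IsWeaklyRegular X rs)
    (hX : Module.supportDim R X < ((rs.length + 1 : ℕ) : WithBot ℕ∞)) {j : ℤ} (hj : j < rs.length)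
    (w : Finset (Fin m) → HH y X) (hw : ∀ S, HH.q y rs.length (w S) = w S)
    (hwj : kq (R := R) j w = w) (hw0 : kdown z w = 0) : ∃ v, kdown z v = w := by
  induction rs generalizing X j with
  | nil =>
    refine ⟨0, ?_⟩
    rw [map_zero, ← hwj]
    funext S
    rw [kq_apply, if_neg]
    · rfl
    · simp at hj
      omega
  | cons r rs ih =>
    have hreg' := (RingTheory.Sequence.isWeaklyRegular_cons_iff _ _ _).1 hreg
    obtain ⟨a, ha⟩ := Ideal.mem_span_range_iff_exists_fun.1 (hz r (by simp))
    have key : ∀ c : Finset (Fin m) → HH y X, kdown z c = 0 → kdown z (kup a c) = r • c := by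
      intro c hc
      have := kup_kdown_add a z c
      rwa [hc, map_zero, zero_add, ha] at this
    set D := SES.of_isSMulRegular hreg'.1 with hD
    have hDr : ∀ h, r • D.conn (y := y) h = 0 := fun h => by
      have := D.map_conn (y := y) h
      rwa [HH.map_smul_id] at this
    have hex := fun S => exists_smul_eq_of_supportDim_le (y := y) hreg'.1 (k := rs.length) hX
      (w S) (hw S)
    choose v hv1 hv2 using hex
    have hv : r • kq (R := R) j v = w := by
      rw [← map_smul, ← hwj]
      congr 1
      funext S
      exact hv2 S
    have hu1 : ∀ S, HH.q y ((rs.length + 1 : ℕ) : ℤ) (kdown z (kq (R := R) j v) S) =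
        kdown z (kq (R := R) j v) S := by
      intro S
      rw [← congrFun (kdown_comp (HH.q y ((rs.length + 1 : ℕ) : ℤ)) z (kq (R := R) j v)) S]
      refine congrFun (congrArg _ (funext fun S => ?_)) S
      rw [kq_apply]
      split_ifs
      · exact hv1 S
      · exact map_zero _
    have hu2 : ∀ S, r • kdown z (kq (R := R) j v) S = 0 := by
      intro S
      rw [← Pi.smul_apply, ← map_smul, hv, hw0]
      rfl
    have hex2 : ∀ S, ∃ u' : HH y (QuotSMulTop r X), HH.q y rs.length u' = u' ∧
        D.conn u' = kdown z (kq (R := R) j v) S := by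
      intro S
      obtain ⟨u', hu'⟩ := D.exact_left (kdown z (kq (R := R) j v) S) (by
        rw [HH.map_smul_id, hu2])
      refine ⟨HH.q y rs.length u', HH.q_idem y _ _, ?_⟩
      rw [D.conn_q, hu']
      exact_mod_cast hu1 S
    choose u hu3 hu4 using hex2
    have hu5 : (fun S => D.conn (kq (R := R) (j - 1) u S)) = kdown z (kq (R := R) j v) := by
      have h1 := kdown_kq z (j - 1) v
      rw [sub_add_cancel] at h1
      have h2 : kq (R := R) (j - 1) (kdown z (kq (R := R) j v)) = kdown z (kq (R := R) j v) := by
        rw [h1]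
        funext S
        simp only [kq_apply]
        split_ifs <;> rfl
      rw [← h2]
      funext S
      simp only [kq_apply]
      split_ifs
      · exact hu4 S
      · exact map_zero _
    have hinj : ∀ h : HH y (QuotSMulTop r X), HH.q y rs.length h = h → D.conn h = 0 → h = 0 := by
      intro h hq h0
      obtain ⟨b, rfl⟩ := D.exact_right h h0
      rw [← hq, ← HH.map_q,
        van₀_of_isWeaklyRegular hy hreg (i := rs.length) (by simp) b, map_zero]
    have huq : ∀ S, HH.q y rs.length (kq (R := R) (j - 1) u S) = kq (R := R) (j - 1) u S := by
      intro S
      rw [kq_apply]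
      split_ifs
      · exact hu3 S
      · exact map_zero _
    obtain ⟨v', hv'⟩ := ih (X := QuotSMulTop r X) (j := j - 1)
      (fun r hr => hy r (by simp [hr])) (fun r hr => hz r (by simp [hr])) hreg'.2
      (supportDim_quotSMulTop_lt hreg'.1 hX) (by simp at hj; omega) (kq (R := R) (j - 1) u) huq
      (by
        funext S
        simp only [kq_apply]
        split_ifs <;> rfl)
      (by
        funext S
        apply hinj
        · rw [← congrFun (kdown_comp (HH.q y (rs.length : ℤ)) z (kq (R := R) (j - 1) u)) S]
          simp only [huq]
        · rw [← congrFun (kdown_comp D.conn z (kq (R := R) (j - 1) u)) S, hu5, kdown_kdown]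
          rfl)
    refine ⟨kup a (kq (R := R) j v - fun S => D.conn (v' S)), ?_⟩
    rw [key, smul_sub, hv, sub_eq_self]
    · funext S
      exact hDr _
    · rw [map_sub, kdown_comp, hv', hu5, sub_self]

end KoszulHomology

section KoszulCochains

variable {n : ℕ} {y : Fin n → R} {X : Type} [AddCommGroup X] [Module R X]

/-- The restriction of a function on all subsets to a cochain. -/
def kres (i : ℕ) (F : Finset (Fin n) → X) : KCochain n X i := fun S => F S.1

/-- The extension by zero of a cochain. -/
def kext (i : ℕ) (f : KCochain n X i) (S : Finset (Fin n)) : X :=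
  if h : S.card = i then f ⟨S, h⟩ else 0

lemma kres_kext (i : ℕ) (f : KCochain n X i) : kres i (kext i f) = f := by
  funext S
  exact dif_pos S.2

lemma kext_kres (i : ℕ) (F : Finset (Fin n) → X) : kext i (kres i F) = kq (R := R) i F := by
  funext S
  rw [kq_apply, kext]
  simp only [Nat.cast_inj]
  split_ifs <;> rfl

lemma kq_kext (i : ℕ) (f : KCochain n X i) : kq (R := R) i (kext i f) = kext i f := by
  rw [← kext_kres, kres_kext]

lemma kext_zero (i : ℕ) : kext i (0 : KCochain n X i) = 0 := by
  funext S
  rw [kext]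
  split_ifs <;> rfl

lemma kd_kres (t i : ℕ) (F : Finset (Fin n) → X) :
    kd y t i (kres i F) = kres (i + 1) (kup (fun j => y j ^ t) F) := by
  funext T
  rw [kres, kup_apply, ← Finset.sum_filter, Finset.filter_mem_eq_inter, Finset.univ_inter,
    ← Finset.sum_attach]
  rfl

lemma kup_kext (t i : ℕ) (g : KCochain n X i) :
    kup (fun j => y j ^ t) (kext i g) = kext (i + 1) (kd y t i g) := by
  have := kup_kq (fun j => y j ^ t) i (kext i g)
  rw [kq_kext] at this
  rw [this]
  have h := kext_kres (R := R) (i + 1) (kup (fun j => y j ^ t) (kext i g))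
  push_cast at h
  rw [← h, ← kd_kres, kres_kext]

lemma kTrans_kres (s i : ℕ) (F : Finset (Fin n) → X) :
    kTrans y s i (kres i F) = kres i (kT y s F) := rfl

lemma kT_kext (s i : ℕ) (f : KCochain n X i) : kT y s (kext i f) = kext i (kTrans y s i f) := by
  funext S
  rw [kT_apply, kext, kext]
  split_ifs
  · rfl
  · exact smul_zero _

lemma isKBoundary_kres (t : ℕ) (i : ℕ) (G : Finset (Fin n) → X) :
    IsKBoundary y t i (kres i (kup (fun j => y j ^ t) G)) := by
  cases i with
  | zero =>
    funext S
    have : S.1 = ∅ := Finset.card_eq_zero.1 S.2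
    rw [kres, this, kup_apply]
    simp
  | succ i => exact ⟨kres i G, kd_kres t i G⟩

lemma IsKBoundary.exists_kup {t i : ℕ} {f : KCochain n X i} (h : IsKBoundary y t i f) :
    ∃ G, kup (fun j => y j ^ t) G = kext i f := by
  cases i with
  | zero =>
    refine ⟨0, ?_⟩
    rw [map_zero, show f = 0 from h, kext_zero]
  | succ i =>
    obtain ⟨g, rfl⟩ := h
    exact ⟨kext i g, kup_kext t i g⟩

variable {𝒜 : ℤ → AddSubgroup R} [GradedRing 𝒜] {e : Fin n → ℤ} (hy : ∀ j, y j ∈ 𝒜 (e j))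
  {P : GrProj 𝒜 X} {ℳ : ℤ → AddSubgroup X}

lemma Van.kVanish (hP : ∀ ℓ x, x ∈ ℳ ℓ → P.P ℓ x = x) {i : ℕ} {ℓ : ℤ} (h : Van hy P i ℓ) :
    KVanish y ℳ e i ℓ := by
  intro t f hf hhom
  have hc : Cech.d y (Cech.mk y t (kext i f)) = 0 := by
    rw [Cech.d_mk, kup_kext, hf, kext_zero, map_zero]
  have h0 := h (HH.mk y ⟨_, hc⟩)
  have hp : kP P e ℓ t (kext i f) = kext i f := by
    funext S
    rw [kP_apply, kext]
    split_ifs with hS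
    · exact hP _ _ (hhom ⟨S, hS⟩)
    · exact map_zero _
  simp only [HH.p_mk, HH.q_mk, Cech.p_mk, Cech.q_mk, hp, kq_kext] at h0
  rw [HH.mk_eq_zero_iff] at h0
  obtain ⟨g, hg⟩ := h0
  obtain ⟨t', G, rfl⟩ := Cech.ind y g
  have h1 : Cech.mk y (t + t') (kT y t' (kext i f) - kup (fun j => y j ^ (t + t')) (kT y t G)) =
      0 := by
    rw [map_sub, ← Cech.mk_level, ← Cech.d_mk, add_comm t t', ← Cech.mk_level, hg, sub_self]
  rw [Cech.mk_eq_zero_iff] at h1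
  obtain ⟨s, hs⟩ := h1
  rw [map_sub, sub_eq_zero, ← kup_kT, kT_kT] at hs
  refine ⟨t' + s, ?_⟩
  rw [← kres_kext i f, kTrans_kres, ← add_assoc, add_comm t' s, hs]
  exact isKBoundary_kres _ _ _

lemma van_of_kVanish (hP : ∀ ℓ x, P.P ℓ x = x → x ∈ ℳ ℓ) {i : ℕ} {ℓ : ℤ}
    (h : KVanish y ℳ e i ℓ) : Van hy P i ℓ := by
  intro x
  obtain ⟨⟨z, hz⟩, rfl⟩ := HH.ind y x
  obtain ⟨t, F, rfl, hF⟩ := Cech.ind_cocycle z hz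
  obtain ⟨s, hs⟩ := h t (kres i (kP P e ℓ t F))
    (by rw [kd_kres, kup_kP hy, hF, map_zero]; rfl) (fun S => hP _ _ (P.idem _ _))
  obtain ⟨G, hG⟩ := hs.exists_kup
  rw [← kT_kext, kext_kres (R := R)] at hG
  simp only [HH.p_mk, HH.q_mk, Cech.p_mk, Cech.q_mk]
  rw [HH.mk_eq_zero_iff]
  refine ⟨Cech.mk y (t + s) G, ?_⟩
  rw [Cech.d_mk, hG, ← Cech.mk_level]

end KoszulCochains

section GradedModules

variable {𝒜 : ℤ → AddSubgroup R} {X Y : Type} [AddCommGroup X] [Module R X]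
  [AddCommGroup Y] [Module R Y]

namespace GrProj

/-- The operators on a stable submodule. -/
def sub (P : GrProj 𝒜 X) (N : Submodule R X) (hN : ∀ ℓ, ∀ x ∈ N, P.P ℓ x ∈ N) :
    GrProj 𝒜 N where
  P ℓ := ((P.P ℓ).comp N.subtype.toAddMonoidHom).codRestrict N.toAddSubmonoid
    (fun x => hN ℓ x x.2)
  idem ℓ x := Subtype.ext (P.idem ℓ x)
  P_smul hr ℓ x := Subtype.ext (P.P_smul hr ℓ x)

/-- The operators on the quotient by a stable submodule. -/
def quot (P : GrProj 𝒜 X) (N : Submodule R X) (hN : ∀ ℓ, ∀ x ∈ N, P.P ℓ x ∈ N) :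
    GrProj 𝒜 (X ⧸ N) where
  P ℓ := QuotientAddGroup.map N.toAddSubgroup N.toAddSubgroup (P.P ℓ) (fun x hx => hN ℓ x hx)
  idem ℓ x := by
    obtain ⟨x, rfl⟩ := Submodule.Quotient.mk_surjective _ x
    exact congrArg (Submodule.Quotient.mk (p := N)) (P.idem ℓ x)
  P_smul hr ℓ x := by
    obtain ⟨x, rfl⟩ := Submodule.Quotient.mk_surjective _ x
    exact congrArg (Submodule.Quotient.mk (p := N)) (P.P_smul hr ℓ x)

section Decomposition

variable (ℳ : ℤ → AddSubgroup X) [DirectSum.Decomposition ℳ]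
  [SetLike.GradedSMul 𝒜 ℳ]

lemma decompose_smul_add {a : ℤ} {r : R} (hr : r ∈ 𝒜 a) (ℓ : ℤ) (x : X) :
    (DirectSum.decompose ℳ (r • x) (a + ℓ) : X) = r • (DirectSum.decompose ℳ x ℓ : X) := by
  induction x using DirectSum.Decomposition.inductionOn ℳ with
  | zero => simp
  | add x x' h h' =>
    simp only [smul_add, DirectSum.decompose_add, DirectSum.add_apply, AddSubgroup.coe_add, h, h']
  | @homogeneous i x =>
    have hm : r • (x : X) ∈ ℳ (a + i) := SetLike.GradedSMul.smul_mem hr x.2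
    by_cases h : i = ℓ
    · subst h
      rw [DirectSum.decompose_of_mem_same _ hm, DirectSum.decompose_of_mem_same _ x.2]
    · rw [DirectSum.decompose_of_mem_ne _ hm (by simpa using h),
        DirectSum.decompose_of_mem_ne _ x.2 h, smul_zero]

variable (𝒜) in
/-- The projections to the components of a graded module. -/
def ofDecomposition : GrProj 𝒜 X where
  P ℓ := (ℳ ℓ).subtype.comp ((DFinsupp.evalAddMonoidHom ℓ).comp
    (DirectSum.decomposeAddEquiv ℳ).toAddMonoidHom)
  idem _ _ := DirectSum.decompose_of_mem_same _ (SetLike.coe_mem _)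
  P_smul hr ℓ x := decompose_smul_add ℳ hr ℓ x

lemma ofDecomposition_apply (ℓ : ℤ) (x : X) :
    (ofDecomposition 𝒜 ℳ).P ℓ x = DirectSum.decompose ℳ x ℓ := rfl

lemma ofDecomposition_eq_iff (ℓ : ℤ) (x : X) : (ofDecomposition 𝒜 ℳ).P ℓ x = x ↔ x ∈ ℳ ℓ :=
  ⟨fun h => h ▸ SetLike.coe_mem _, fun h => DirectSum.decompose_of_mem_same _ h⟩

lemma grHom_ofDecomposition {𝒩 : ℤ → AddSubgroup Y} [DirectSum.Decomposition 𝒩]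
    [SetLike.GradedSMul 𝒜 𝒩] {φ : X →ₗ[R] Y} {β : ℤ} (h : ∀ ℓ, ∀ x ∈ ℳ ℓ, φ x ∈ 𝒩 (β + ℓ)) :
    GrHom (ofDecomposition 𝒜 ℳ) (ofDecomposition 𝒜 𝒩) φ β := by
  intro ℓ x
  simp only [ofDecomposition_apply]
  induction x using DirectSum.Decomposition.inductionOn ℳ with
  | zero => simp
  | add x x' h h' =>
    simp only [map_add, DirectSum.decompose_add, DirectSum.add_apply, AddSubgroup.coe_add, h, h']
  | @homogeneous i x =>
    have hm := h i x x.2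
    by_cases hi : i = ℓ
    · subst hi
      rw [DirectSum.decompose_of_mem_same _ hm, DirectSum.decompose_of_mem_same _ x.2]
    · rw [DirectSum.decompose_of_mem_ne _ hm (by simpa using hi),
        DirectSum.decompose_of_mem_ne _ x.2 hi, map_zero]

end Decomposition

end GrProj

end GradedModules

section TopCohomology

variable [IsNoetherianRing R] {d : ℕ} (hd : ringKrullDim R ≤ (d : WithBot ℕ∞))
  {n m : ℕ} {y : Fin n → R} {X : Type} [AddCommGroup X] [Module R X] [Module.Finite R X]

include hd in
omit [IsNoetherianRing R] [Module.Finite R X] in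
lemma supportDim_lt_succ : Module.supportDim R X < ((d + 1 : ℕ) : WithBot ℕ∞) :=
  ((Module.supportDim_le_ringKrullDim R X).trans hd).trans_lt (by exact_mod_cast Nat.lt_succ_self d)

include hd in
lemma van₀_of_ringKrullDim_le {i : ℤ} (hi : d < i) : Van₀ y X i :=
  van₀_of_supportDim_lt (supportDim_lt_succ hd) (by push_cast; omega)

include hd in
/-- The top cohomology of a finitely generated module is generated by multiples of the generators
of the maximal ideal. -/
lemma exists_sum_smul_eq_of_top {z : Fin m → R}
    (hz : (Ideal.span (Set.range y)).radical = (Ideal.span (Set.range z)).radical) (hd1 : 1 ≤ d)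
    (h : HH y X) (hh : HH.q y d h = h) : ∃ (r : R) (a : Fin m → R) (h' : HH y X),
      ∑ i, a i * z i = r ∧ HH.q y d h' = h' ∧ r • h' = h := by
  set I := Ideal.span (Set.range z)
  obtain ⟨r, hr, hreg⟩ := exists_isSMulRegular_quot_torsion (X := X) I
  obtain ⟨a, ha⟩ := Ideal.mem_span_range_iff_exists_fun.1 hr
  obtain ⟨k, rfl⟩ : ∃ k, d = k + 1 := ⟨d - 1, by omega⟩
  have hS := SES.of_submodule (torsionSubmodule I X)
  obtain ⟨c, hc1, hc2⟩ := exists_smul_eq_of_supportDim_le hreg (y := y) (k := k)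
    (supportDim_lt_succ hd) (HH.map y (torsionSubmodule I X).mkQ h) (by rw [← HH.map_q, hh])
  obtain ⟨h', rfl⟩ := hS.exact_right c (by
    rw [← hc1, hS.conn_q]
    exact van₀_torsionSubmodule hz (by omega) _)
  refine ⟨r, a, HH.q y _ h', ha, HH.q_idem y _ _, ?_⟩
  rw [← sub_eq_zero]
  obtain ⟨b, hb⟩ := hS.exact_mid (r • HH.q y ((k + 1 : ℕ) : ℤ) h' - h) (by
    rw [map_sub, map_smul, HH.map_q, hc1, hc2, sub_self])
  have : HH.q y ((k + 1 : ℕ) : ℤ) (r • HH.q y ((k + 1 : ℕ) : ℤ) h' - h) =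
      r • HH.q y ((k + 1 : ℕ) : ℤ) h' - h := by
    rw [map_sub, map_smul, HH.q_idem, hh]
  rw [← this, ← hb, ← HH.map_q, van₀_torsionSubmodule hz (by omega) b, map_zero]

omit [IsNoetherianRing R] [Module.Finite R X] in
lemma HH.map_sum_apply {Y ι : Type} [AddCommGroup Y] [Module R Y] (s : Finset ι)
    (φ : ι → Y →ₗ[R] X) (h : HH y Y) : HH.map y (∑ k ∈ s, φ k) h = ∑ k ∈ s, HH.map y (φ k) h :=
  map_sum (⟨⟨fun φ => HH.map y φ h, HH.map_zero_apply y h⟩,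
    fun φ ψ => HH.map_add_apply y φ ψ h⟩ : (Y →ₗ[R] X) →+ HH y X) φ s

variable {𝒜 : ℤ → AddSubgroup R} [GradedRing 𝒜] {e : Fin n → ℤ} (hy : ∀ j, y j ∈ 𝒜 (e j))

include hd in
/-- The top cohomology of a module vanishes in large degrees. -/
lemma GenDegLE.van {ℳ : ℤ → AddSubgroup X} [DirectSum.Decomposition ℳ] [SetLike.GradedSMul 𝒜 ℳ]
    {b γ : ℤ} (hb : GenDegLE (R := R) ℳ b)
    (hR : ∀ ℓ, γ < ℓ → Van hy (GrProj.ofDecomposition 𝒜 𝒜) d ℓ) {ℓ : ℤ} (hℓ : b + γ < ℓ) :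
    Van hy (GrProj.ofDecomposition 𝒜 ℳ) d ℓ := by
  have hfg : (Submodule.span R (⋃ (j : ℤ) (_ : j ≤ b), (ℳ j : Set X))).FG := by
    rw [show Submodule.span R _ = ⊤ from hb]
    exact Module.Finite.fg_top
  obtain ⟨s, hs, hs2⟩ := (Submodule.fg_span_iff_fg_span_finset_subset _).1 hfg
  rw [show Submodule.span R _ = ⊤ from hb] at hs2
  have hdeg : ∀ c : s, ∃ j ≤ b, (c : X) ∈ ℳ j := by
    intro c
    simpa using hs c.2
  choose β hβ1 hβ2 using hdeg
  set φ : (s → R) →ₗ[R] X := Fintype.linearCombination R (fun c : s => (c : X)) with hφ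
  have hsurj : Function.Surjective φ := by
    rw [← LinearMap.range_eq_top, hφ, Fintype.range_linearCombination, hs2]
    simp
  have hS : SES (LinearMap.ker φ).subtype φ :=
    ⟨Subtype.val_injective, hsurj, fun b hb => ⟨⟨b, hb⟩, rfl⟩, fun a => a.2⟩
  intro h
  obtain ⟨g, hg⟩ := hS.exact_right (HH.q y d h) (by
    rw [hS.conn_q]
    exact van₀_of_ringKrullDim_le hd (by omega) _)
  have hφs : φ = ∑ c : s, LinearMap.toSpanSingleton R X (c : X) ∘ₗ LinearMap.proj c := by
    ext c
    simp [hφ, Fintype.linearCombination_apply]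
  have hgr : ∀ c : s, GrHom (GrProj.ofDecomposition 𝒜 𝒜) (GrProj.ofDecomposition 𝒜 ℳ)
      (LinearMap.toSpanSingleton R X (c : X)) (β c) := by
    intro c
    apply GrProj.grHom_ofDecomposition
    intro k x hx
    rw [LinearMap.toSpanSingleton_apply, add_comm]
    exact SetLike.GradedSMul.smul_mem hx (hβ2 c)
  rw [← HH.q_idem, ← HH.p_q, ← hg, hφs, HH.map_sum_apply, map_sum, map_sum]
  refine Finset.sum_eq_zero fun c _ => ?_
  have hc : ℓ = β c + (ℓ - β c) := by ring
  rw [← HH.map_comp_apply, hc, HH.p_map hy (hgr c), ← HH.map_q,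
    hR _ (by linarith [hβ1 c]), map_zero]

end TopCohomology

section MaximalIdeal

variable (𝒜 : ℤ → AddSubgroup R) [GradedRing 𝒜]

lemma maxHomIdeal_eq_span (hnonneg : ∀ i : ℤ, i < 0 → 𝒜 i = ⊥) (hfield : IsField ↥(𝒜 0))
    (hstd : Subring.closure ((𝒜 0 : Set R) ∪ (𝒜 1 : Set R)) = ⊤) :
    maxHomIdeal 𝒜 = Ideal.span (𝒜 1 : Set R) := by
  have hneg : ∀ i < 0, ∀ x ∈ 𝒜 i, x = 0 := fun i hi x hx => by
    rw [hnonneg i hi] at hx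
    simpa using hx
  apply le_antisymm
  · have hdec : ∀ x : R, x - DirectSum.decompose 𝒜 x 0 ∈ Ideal.span (𝒜 1 : Set R) := by
      intro x
      have hx : x ∈ Subring.closure ((𝒜 0 : Set R) ∪ (𝒜 1 : Set R)) := hstd ▸ Subring.mem_top x
      have : ∃ c ∈ 𝒜 0, x - c ∈ Ideal.span (𝒜 1 : Set R) := by
        induction hx using Subring.closure_induction with
        | mem x hx =>
          rcases hx with hx | hx
          · exact ⟨x, hx, by simp⟩
          · exact ⟨0, zero_mem _, by simpa using Ideal.subset_span hx⟩
        | zero => exact ⟨0, zero_mem _, by simp⟩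
        | one => exact ⟨1, SetLike.one_mem_graded 𝒜, by simp⟩
        | add x x' _ _ h h' =>
          obtain ⟨c, hc, h⟩ := h
          obtain ⟨c', hc', h'⟩ := h'
          exact ⟨c + c', add_mem hc hc', by
            rw [show x + x' - (c + c') = (x - c) + (x' - c') by ring]
            exact add_mem h h'⟩
        | neg x _ h =>
          obtain ⟨c, hc, h⟩ := h
          exact ⟨-c, neg_mem hc, by
            rw [show -x - -c = -(x - c) by ring]
            exact neg_mem h⟩
        | mul x x' _ _ h h' =>
          obtain ⟨c, hc, h⟩ := h
          obtain ⟨c', hc', h'⟩ := h'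
          refine ⟨c * c', by simpa using SetLike.mul_mem_graded hc hc', ?_⟩
          rw [show x * x' - c * c' = x' * (x - c) + c * (x' - c') by ring]
          exact add_mem (Ideal.mul_mem_left _ _ h) (Ideal.mul_mem_left _ _ h')
      obtain ⟨c, hc, h⟩ := this
      have h0 : ∀ x ∈ Ideal.span (𝒜 1 : Set R), (DirectSum.decompose 𝒜 x 0 : R) = 0 := by
        intro x hx
        induction hx using Submodule.span_induction with
        | mem x hx => exact DirectSum.decompose_of_mem_ne _ hx one_ne_zero
        | zero => simp
        | add x x' _ _ h h' => simp [DirectSum.decompose_add, h, h']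
        | smul a x _ h =>
          rw [smul_eq_mul]
          induction a using DirectSum.Decomposition.inductionOn 𝒜 with
          | zero => simp
          | add a a' h h' =>
            rw [add_mul, DirectSum.decompose_add, DirectSum.add_apply, AddSubgroup.coe_add, h, h',
              add_zero]
          | @homogeneous i a =>
            have h2 := GrProj.decompose_smul_add 𝒜 a.2 (-i) x
            rw [add_neg_cancel, smul_eq_mul] at h2
            rw [h2]
            rcases lt_trichotomy i 0 with hi | hi | hi
            · rw [hneg i hi a a.2, zero_smul]
            · subst hi
              rw [neg_zero, h, smul_zero]
            · rw [hneg (-i) (by omega) _ (SetLike.coe_mem (DirectSum.decompose 𝒜 x (-i))),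
                smul_zero]
      have h1 := h0 _ h
      rw [DirectSum.decompose_sub, DirectSum.sub_apply, AddSubgroup.coe_sub,
        DirectSum.decompose_of_mem_same _ hc, sub_eq_zero] at h1
      rwa [h1]
    rw [maxHomIdeal, Ideal.span_le]
    rintro x (⟨hx0, hxu⟩ | hx)
    · have : (⟨x, hx0⟩ : 𝒜 0) = 0 := by
        by_contra h
        obtain ⟨b, hb⟩ := hfield.mul_inv_cancel h
        exact hxu (IsUnit.of_mul_eq_one b hb)
      have : x = 0 := congrArg Subtype.val this
      rw [this]
      exact zero_mem _
    · simp only [Set.mem_iUnion] at hx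
      obtain ⟨i, hi, hx⟩ := hx
      have := hdec x
      rwa [DirectSum.decompose_of_mem_ne _ hx hi, sub_zero] at this
  · refine Ideal.span_mono fun x hx => Or.inr ?_
    simp only [Set.mem_iUnion]
    exact ⟨1, one_ne_zero, hx⟩

lemma exists_span_range_eq [IsNoetherianRing R] (s : Set R) :
    ∃ (m : ℕ) (z : Fin m → R), (∀ i, z i ∈ s) ∧ Ideal.span (Set.range z) = Ideal.span s := by
  obtain ⟨u, hu, hu2⟩ := (Submodule.fg_span_iff_fg_span_finset_subset s).1
    (IsNoetherian.noetherian (Submodule.span R s))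
  refine ⟨u.card, fun i => u.equivFin.symm i, fun i => hu (Subtype.mem _), ?_⟩
  have : Set.range (fun i => (u.equivFin.symm i : R)) = u := by
    ext x
    constructor
    · rintro ⟨i, rfl⟩
      exact Subtype.mem _
    · intro hx
      exact ⟨u.equivFin ⟨x, hx⟩, by simp⟩
  rw [this]
  exact hu2.symm

end MaximalIdeal

section Complexes

variable {X Y : Type} [AddCommGroup X] [Module R X] [AddCommGroup Y] [Module R Y]

lemma SES.of_rangeRestrict (φ : X →ₗ[R] Y) : SES (LinearMap.ker φ).subtype φ.rangeRestrict where
  inj := Subtype.val_injective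
  surj := φ.surjective_rangeRestrict
  exact b hb := ⟨⟨b, congrArg Subtype.val hb⟩, rfl⟩
  comp a := Subtype.ext a.2

lemma SES.of_inclusion {N N' : Submodule R X} (h : N ≤ N') :
    SES (Submodule.inclusion h) (Submodule.comap N'.subtype N).mkQ where
  inj := Submodule.inclusion_injective h
  surj := Submodule.mkQ_surjective _
  exact b hb := by
    have h : b ∈ Submodule.comap N'.subtype N := (Submodule.Quotient.mk_eq_zero _).1 hb
    exact ⟨⟨b, h⟩, rfl⟩
  comp a := (Submodule.Quotient.mk_eq_zero _).2 a.2

section GrHom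

variable {𝒜 : ℤ → AddSubgroup R} {P : GrProj 𝒜 X} {Q : GrProj 𝒜 Y} {φ : X →ₗ[R] Y}

lemma GrHom.map_P (h : GrHom P Q φ 0) (ℓ : ℤ) (x : X) : Q.P ℓ (φ x) = φ (P.P ℓ x) := by
  rw [← h, zero_add]

lemma GrHom.of_map_P (h : ∀ ℓ x, Q.P ℓ (φ x) = φ (P.P ℓ x)) : GrHom P Q φ 0 := fun ℓ x => by
  rw [zero_add, h]

lemma GrHom.P_mem_ker (h : GrHom P Q φ 0) (ℓ : ℤ) (x : X) (hx : x ∈ LinearMap.ker φ) :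
    P.P ℓ x ∈ LinearMap.ker φ := by
  rw [LinearMap.mem_ker, ← h.map_P, LinearMap.mem_ker.1 hx, map_zero]

lemma GrHom.P_mem_range (h : GrHom P Q φ 0) (ℓ : ℤ) (x : Y) (hx : x ∈ LinearMap.range φ) :
    Q.P ℓ x ∈ LinearMap.range φ := by
  obtain ⟨x, rfl⟩ := hx
  exact ⟨P.P ℓ x, (h.map_P ℓ x).symm⟩

lemma GrProj.grHom_subtype (N : Submodule R X) (hN : ∀ ℓ, ∀ x ∈ N, P.P ℓ x ∈ N) :
    GrHom (P.sub N hN) P N.subtype 0 := .of_map_P fun _ _ => rfl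

lemma GrProj.grHom_mkQ (N : Submodule R X) (hN : ∀ ℓ, ∀ x ∈ N, P.P ℓ x ∈ N) :
    GrHom P (P.quot N hN) N.mkQ 0 := .of_map_P fun _ _ => rfl

lemma GrHom.rangeRestrict (h : GrHom P Q φ 0) :
    GrHom P (Q.sub (LinearMap.range φ) h.P_mem_range) φ.rangeRestrict 0 :=
  .of_map_P fun ℓ x => Subtype.ext (h.map_P ℓ x)

end GrHom

variable {n : ℕ} {y : Fin n → R} {K : ℕ → Type} [∀ j, AddCommGroup (K j)] [∀ j, Module R (K j)]
  {D : ∀ j, K (j + 1) →ₗ[R] K j} {d : ℕ}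

variable (y D d) in
/-- The vanishing properties of the complex `⋯ → K 2 → K 1 → K 0` that enter the proof. -/
structure Tower : Prop where
  le : ∀ q, LinearMap.range (D (q + 1)) ≤ LinearMap.ker (D q)
  cm : ∀ q < d, ∀ i : ℤ, i < d → Van₀ y (K (q + 1)) i
  hom : ∀ q < d, ∀ i : ℤ, q < i → Van₀ y (↥(LinearMap.ker (D q)) ⧸
    Submodule.comap (LinearMap.ker (D q)).subtype (LinearMap.range (D (q + 1)))) i
  top : ∀ q, ∀ i : ℤ, d < i → Van₀ y ↥(LinearMap.ker (D q)) i

namespace Tower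

variable (T : Tower y D d)

lemma van₀_bdry (T : Tower y D d) {i : ℤ} (hi : 1 ≤ i) (h : Van₀ y ↥(LinearMap.range (D 0)) i)
    (q : ℕ) (hq : i + q < d) : Van₀ y ↥(LinearMap.range (D q)) (i + q) := by
  induction q with
  | zero => simpa using h
  | succ q ih =>
    push_cast at hq ⊢
    rw [← add_assoc]
    exact (SES.of_inclusion (T.le q)).van₀_left (T.hom q (by omega) _ (by omega))
      ((SES.of_rangeRestrict (D q)).van₀_left (ih (by omega)) (T.cm q (by omega) _ (by omega)))

variable {𝒜 : ℤ → AddSubgroup R} [GradedRing 𝒜] {e : Fin n → ℤ} (hy : ∀ j, y j ∈ 𝒜 (e j))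
  {P : ∀ j, GrProj 𝒜 (K j)} (hD : ∀ j, GrHom (P (j + 1)) (P j) (D j) 0)

include T in
lemma van_bdry {i : ℕ} {ℓ : ℤ} (q₀ : ℕ) (h : Van hy (P (q₀ + 1)) d ℓ) (hi : i + q₀ = d) {q : ℕ}
    (hq : q ≤ q₀) :
    Van hy ((P q).sub (LinearMap.range (D q)) (hD q).P_mem_range) (i + q : ℕ) ℓ := by
  obtain ⟨k, hk⟩ := Nat.exists_eq_add_of_le hq
  induction k generalizing q with
  | zero =>
    obtain rfl : q₀ = q := hk
    rw [hi]
    exact (SES.of_rangeRestrict (D q₀)).van_right hy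
      (GrProj.grHom_subtype (P := P (q₀ + 1)) _ (hD q₀).P_mem_ker)
      (hD q₀).rangeRestrict h ((T.top q₀ _ (by omega)).van hy _ _)
  | succ k ih =>
    replace ih := ih (q := q + 1) (by omega) (by omega)
    have h1 : Van hy ((P (q + 1)).sub (LinearMap.ker (D q)) (hD q).P_mem_ker)
        ((i + q : ℕ) + 1 : ℤ) ℓ := by
      intro x
      obtain ⟨c, hc⟩ := (SES.of_inclusion (T.le q)).exact_mid
        (HH.q y ((i + q : ℕ) + 1 : ℤ) (HH.p hy _ ℓ x)) (by
          rw [HH.map_q]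
          exact T.hom q (by omega) _ (by push_cast; omega) _)
      rw [← HH.q_idem, ← HH.p_idem, ← HH.p_q, ← hc,
        HH.p_map_zero hy (P := (P (q + 1)).sub (LinearMap.range (D (q + 1)))
          (hD (q + 1)).P_mem_range) (.of_map_P fun _ _ => rfl), ← HH.map_q]
      have := ih c
      rw [show ((i + (q + 1) : ℕ) : ℤ) = ((i + q : ℕ) : ℤ) + 1 by push_cast; ring] at this
      rw [this, map_zero]
    exact (SES.of_rangeRestrict (D q)).van_right hy (GrProj.grHom_subtype _ _)
      (hD q).rangeRestrict ((T.cm q (by omega) _ (by push_cast; omega)).van hy _ _) h1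

end Tower

end Complexes

section Normalization

variable {n m : ℕ} {y : Fin n → R} {𝒜 : ℤ → AddSubgroup R} [GradedRing 𝒜] {e : Fin n → ℤ}
  (hy : ∀ j, y j ∈ 𝒜 (e j)) {X Y : Type} [AddCommGroup X] [Module R X] [AddCommGroup Y]
  [Module R Y] (P : GrProj 𝒜 X) (Q : GrProj 𝒜 Y)

/-- The projection of Koszul chains with coefficients in Čech cohomology to the chains on `s`
vertices with coefficients of cohomological degree `i` and internal degree `a`. -/
def kN (i a s : ℤ) (f : Finset (Fin m) → HH y X) : Finset (Fin m) → HH y X :=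
  kq (R := R) s fun S => HH.q y i (HH.p hy P a (f S))

lemma kN_apply (i a s : ℤ) (f : Finset (Fin m) → HH y X) (S : Finset (Fin m)) :
    kN hy P i a s f S = if (S.card : ℤ) = s then HH.q y i (HH.p hy P a (f S)) else 0 := rfl

lemma kN_kN (i a s : ℤ) (f : Finset (Fin m) → HH y X) :
    kN hy P i a s (kN hy P i a s f) = kN hy P i a s f := by
  funext S
  simp only [kN_apply]
  split_ifs with h
  · rw [HH.p_q, HH.q_idem, HH.p_idem]
  · rfl

lemma q_of_kN_eq {i a s : ℤ} {f : Finset (Fin m) → HH y X} (hf : kN hy P i a s f = f)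
    (S : Finset (Fin m)) : HH.q y i (f S) = f S := by
  rw [← hf, kN_apply]
  split_ifs
  · rw [HH.q_idem]
  · exact map_zero _

lemma kq_of_kN_eq {i a s : ℤ} {f : Finset (Fin m) → HH y X} (hf : kN hy P i a s f = f) :
    kq (R := R) s f = f := by
  rw [← hf]
  funext S
  simp only [kq_apply, kN_apply]
  split_ifs <;> rfl

lemma kN_kdown {z : Fin m → R} (hz : ∀ j, z j ∈ 𝒜 1) (i a s : ℤ) (f : Finset (Fin m) → HH y X) :
    kdown z (kN hy P i (a - 1) (s + 1) f) = kN hy P i a s (kdown z f) := by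
  rw [kN, kdown_kq, kdown_comp]
  funext S
  rw [kN_apply, kq_apply]
  congr 2
  rw [kdown_apply, kdown_apply, map_sum]
  refine Finset.sum_congr rfl fun j _ => ?_
  split_ifs
  · rw [map_zero]
  · have := HH.p_smul hy P (hz j) (a - 1) (f (insert j S))
    rw [add_sub_cancel] at this
    rw [map_zsmul, this]

variable {P Q} in
lemma kN_map {φ : X →ₗ[R] Y} (h : GrHom P Q φ 0) (i a s : ℤ) (f : Finset (Fin m) → HH y X) :
    (fun S => HH.map y φ (kN hy P i a s f S)) = kN hy Q i a s fun S => HH.map y φ (f S) := by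
  funext S
  simp only [kN_apply]
  split_ifs
  · rw [HH.map_q, HH.p_map_zero hy h]
  · exact map_zero _

end Normalization

section KoszulExactness

variable {n m : ℕ} {y : Fin n → R} {K : ℕ → Type} [∀ j, AddCommGroup (K j)] [∀ j, Module R (K j)]
  {D : ∀ j, K (j + 1) →ₗ[R] K j} {d : ℕ}

namespace Tower

/-- Exactness of the complex of top cohomology modules. -/
lemma exact_top (T : Tower y D d) {q : ℕ} (hq : q + 1 < d)
    (hv : Van₀ y ↥(LinearMap.range (D q)) (d - 1)) (h : HH y (K (q + 1 + 1)))
    (hh : HH.q y d h = h) (h0 : HH.map y (D (q + 1)) h = 0) :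
    ∃ g, HH.map y (D (q + 1 + 1)) g = h := by
  have h1 : HH.map y (Submodule.inclusion (T.le q)) (HH.map y (D (q + 1)).rangeRestrict h) = 0 := by
    obtain ⟨c, hc⟩ := (SES.of_rangeRestrict (D q)).exact_left
      (HH.map y (Submodule.inclusion (T.le q)) (HH.map y (D (q + 1)).rangeRestrict h)) (by
        rw [HH.map_comp_apply, HH.map_comp_apply]
        exact h0)
    have h2 := (SES.of_rangeRestrict (D q)).conn_q (d - 1) c
    rw [hv, map_zero, hc, sub_add_cancel, ← HH.map_q, ← HH.map_q, hh] at h2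
    exact h2.symm
  have h2 : HH.map y (D (q + 1)).rangeRestrict h = 0 := by
    obtain ⟨c, hc⟩ := (SES.of_inclusion (T.le q)).exact_left _ h1
    have h2 := (SES.of_inclusion (T.le q)).conn_q (d - 1) c
    rw [T.hom q (by omega) _ (by omega), map_zero, hc, sub_add_cancel, ← HH.map_q, hh] at h2
    exact h2.symm
  obtain ⟨b, hb⟩ := (SES.of_rangeRestrict (D (q + 1))).exact_mid h h2
  obtain ⟨c, hc⟩ := (SES.of_inclusion (T.le (q + 1))).exact_mid (HH.q y d b) (by
    rw [HH.map_q]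
    exact T.hom (q + 1) hq _ (by exact_mod_cast hq) _)
  obtain ⟨g, hg⟩ := (SES.of_rangeRestrict (D (q + 1 + 1))).exact_right (HH.q y d c) (by
    rw [SES.conn_q]
    exact T.top _ _ (by omega) _)
  refine ⟨g, ?_⟩
  have h3 : HH.map y (D (q + 1 + 1)) g = HH.map y (LinearMap.ker (D (q + 1))).subtype
      (HH.map y (Submodule.inclusion (T.le (q + 1)))
        (HH.map y (D (q + 1 + 1)).rangeRestrict g)) := by
    rw [HH.map_comp_apply, HH.map_comp_apply]
    rfl
  rw [h3, hg, HH.map_q, hc, HH.q_idem, HH.map_q, hb, hh]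

end Tower

variable {𝒜 : ℤ → AddSubgroup R} [GradedRing 𝒜] {e : Fin n → ℤ} (hy : ∀ j, y j ∈ 𝒜 (e j))
  (P : ∀ j, GrProj 𝒜 (K j)) (z : Fin m → R) (D d)

/-- Koszul cycles on `s` vertices with coefficients of degree `ℓ - s` in the kernel of the top
cohomology of `D q` are boundaries of chains with coefficients in the kernel. -/
def KerExact (ℓ : ℤ) (q s : ℕ) : Prop :=
  ∀ f : Finset (Fin m) → HH y (K (q + 1)), kN hy (P (q + 1)) d (ℓ - s) s f = f → kdown z f = 0 →
    (∀ S, HH.map y (D q) (f S) = 0) → ∃ g : Finset (Fin m) → HH y (K (q + 1)),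
      (∀ S, HH.map y (D q) (g S) = 0) ∧ kdown z g = f

/-- Koszul cycles on `s` vertices with coefficients of degree `ℓ - s` in the kernel of the top
cohomology of `D q` are boundaries of chains with coefficients in the image of `D (q + 1)`. -/
def RangeExact (ℓ : ℤ) (q s : ℕ) : Prop :=
  ∀ f : Finset (Fin m) → HH y (K (q + 1)), kN hy (P (q + 1)) d (ℓ - s) s f = f → kdown z f = 0 →
    (∀ S, HH.map y (D q) (f S) = 0) → ∃ g : Finset (Fin m) → HH y (K (q + 1 + 1)),
      kdown z (fun S => HH.map y (D (q + 1)) (g S)) = f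

variable {D d P z}

lemma RangeExact.of_van {ℓ : ℤ} {q s : ℕ} (h : Van hy (P (q + 1)) d (ℓ - s)) :
    RangeExact D d hy P z ℓ q s := by
  intro f hf _ _
  refine ⟨0, ?_⟩
  rw [← hf]
  trans 0
  · have h0 : (fun S => HH.map y (D (q + 1)) ((0 : Finset (Fin m) → HH y (K (q + 1 + 1))) S)) =
        0 := funext fun _ => map_zero _
    rw [h0, map_zero]
  · funext S
    rw [kN_apply, h]
    simp

lemma RangeExact.kerExact (hz : ∀ j, z j ∈ 𝒜 1) (hD : ∀ j, GrHom (P (j + 1)) (P j) (D j) 0)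
    (hDD : ∀ q, LinearMap.range (D (q + 1)) ≤ LinearMap.ker (D q)) {ℓ : ℤ} {q s : ℕ}
    (hkos : ∀ w : Finset (Fin m) → HH y (K (q + 1 + 1)), (∀ S, HH.q y d (w S) = w S) →
      kq (R := R) s w = w → kdown z w = 0 → ∃ v, kdown z v = w)
    (h : RangeExact D d hy P z ℓ q (s + 1)) : KerExact D d hy P z ℓ (q + 1) s := by
  have hDD0 : ∀ j, ∀ x : HH y (K (j + 1 + 1)), HH.map y (D j) (HH.map y (D (j + 1)) x) = 0 := by
    intro j x
    rw [HH.map_comp_apply, show D j ∘ₗ D (j + 1) = 0 from LinearMap.range_le_ker_iff.1 (hDD j),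
      HH.map_zero_apply]
  intro f hf hf0 hfD
  obtain ⟨g, hg⟩ := hkos f (q_of_kN_eq hy _ hf) (kq_of_kN_eq hy _ hf) hf0
  have hg' := kN_kdown hy (P (q + 1 + 1)) hz d (ℓ - s) s g
  rw [hg, hf] at hg'
  set g' := kN hy (P (q + 1 + 1)) d (ℓ - s - 1) (s + 1) g with hg'_def
  have hkd : kdown z (fun S => HH.map y (D (q + 1)) (g' S)) = 0 := by
    rw [kdown_comp, hg']
    exact funext hfD
  obtain ⟨v, hv⟩ := h (fun S => HH.map y (D (q + 1)) (g' S)) (by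
    rw [← kN_map hy (hD (q + 1))]
    push_cast
    rw [← sub_sub, hg'_def, kN_kN]) hkd (fun S => hDD0 q _)
  refine ⟨g' - kdown z v, fun S => ?_, by rw [map_sub, hg', kdown_kdown, sub_zero]⟩
  rw [Pi.sub_apply, map_sub, ← congrFun hv S, ← congrFun (kdown_comp (HH.map y (D (q + 1))) z v) S,
    sub_self]

lemma KerExact.rangeExact (T : Tower y D d) (hz : ∀ j, z j ∈ 𝒜 1)
    (hD : ∀ j, GrHom (P (j + 1)) (P j) (D j) 0) {ℓ : ℤ} {q s : ℕ} (hq : q + 1 < d)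
    (hv : Van₀ y ↥(LinearMap.range (D q)) (d - 1)) (h : KerExact D d hy P z ℓ (q + 1) s) :
    RangeExact D d hy P z ℓ (q + 1) s := by
  intro f hf hf0 hfD
  obtain ⟨g, hg1, hg2⟩ := h f hf hf0 hfD
  have hg' := kN_kdown hy (P (q + 1 + 1)) hz d (ℓ - s) s g
  rw [hg2, hf] at hg'
  have hker : ∀ S, HH.map y (D (q + 1)) (kN hy (P (q + 1 + 1)) d (ℓ - s - 1) (s + 1) g S) = 0 := by
    intro S
    rw [congrFun (kN_map hy (hD (q + 1)) d (ℓ - s - 1) (s + 1) g) S, kN_apply, hg1]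
    simp
  choose v hv using fun S => T.exact_top hq hv _ (q_of_kN_eq hy _ (kN_kN hy _ _ _ _ g) S) (hker S)
  exact ⟨v, by rw [← hg', funext hv]⟩

lemma Tower.kerExact (T : Tower y D d) (hz : ∀ j, z j ∈ 𝒜 1)
    (hD : ∀ j, GrHom (P (j + 1)) (P j) (D j) 0) {ℓ : ℤ} {c t : ℕ} (ht : 1 ≤ t) (hc : c + t = d)
    (hkos : ∀ q s, q + s = d → s < t → ∀ w : Finset (Fin m) → HH y (K (q + 1)),
      (∀ S, HH.q y d (w S) = w S) → kq (R := R) s w = w → kdown z w = 0 → ∃ v, kdown z v = w)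
    (hv : ∀ i : ℕ, 1 ≤ i → i < t → Van₀ y ↥(LinearMap.range (D 0)) i)
    (hvan : Van hy (P (c + 1)) d (ℓ - t)) : KerExact D d hy P z ℓ d 0 := by
  have key : ∀ k s, 1 ≤ s → s + k = t → RangeExact D d hy P z ℓ (c + k) s := by
    intro k
    induction k with
    | zero =>
      intro s _ hs
      obtain rfl : s = t := hs
      exact .of_van hy hvan
    | succ k ih =>
      intro s hs1 hs
      refine KerExact.rangeExact hy (q := c + k) T hz hD (by omega) ?_ ((ih (s + 1) (by omega)
        (by omega)).kerExact hy hz hD T.le (hkos (c + k + 1) s (by omega) (by omega)))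
      have h := T.van₀_bdry (i := s) (by omega) (hv s hs1 (by omega)) (c + k) (by omega)
      rwa [show (s : ℤ) + (c + k : ℕ) = d - 1 by omega] at h
  obtain ⟨k, rfl⟩ : ∃ k, t = k + 1 := ⟨t - 1, by omega⟩
  have hd : c + k + 1 = d := hc
  have h := (key k 1 le_rfl (by omega)).kerExact hy hz hD T.le (hkos (c + k + 1) 0 (by omega) (by omega))
  rw [hd] at h
  exact h

end KoszulExactness

section BoundaryGenerators

variable {n m : ℕ} {y : Fin n → R} {K : ℕ → Type} [∀ j, AddCommGroup (K j)] [∀ j, Module R (K j)]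
  {D : ∀ j, K (j + 1) →ₗ[R] K j} {d : ℕ}
  {𝒜 : ℤ → AddSubgroup R} [GradedRing 𝒜] {e : Fin n → ℤ} (hy : ∀ j, y j ∈ 𝒜 (e j))
  {P : ∀ j, GrProj 𝒜 (K j)} {z : Fin m → R} (hD : ∀ j, GrHom (P (j + 1)) (P j) (D j) 0)

variable (z) in
/-- The classes of degree `ℓ` in the kernel of `H^q(range (D q)) → H^q(K q)` are combinations of
the `z i` with coefficients in the kernel. -/
def BdryGen (ℓ : ℤ) (q : ℕ) : Prop :=
  ∀ h : HH y ↥(LinearMap.range (D q)),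
    HH.q y q (HH.p hy ((P q).sub (LinearMap.range (D q)) (hD q).P_mem_range) ℓ h) = h →
    HH.map y (LinearMap.range (D q)).subtype h = 0 →
    ∃ u : Fin m → HH y ↥(LinearMap.range (D q)),
      (∀ i, HH.map y (LinearMap.range (D q)).subtype (u i) = 0) ∧ ∑ i, z i • u i = h

lemma HH.map_subtype_map_rangeRestrict {X Y : Type} [AddCommGroup X] [Module R X] [AddCommGroup Y]
    [Module R Y] (φ : X →ₗ[R] Y) (b : HH y X) :
    HH.map y (LinearMap.range φ).subtype (HH.map y φ.rangeRestrict b) = HH.map y φ b := by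
  rw [HH.map_comp_apply]
  rfl

lemma KerExact.bdryGen (T : Tower y D d) {ℓ : ℤ} (h : KerExact D d hy P z ℓ d 0) :
    BdryGen hy z hD ℓ d := by
  intro x hx hx0
  obtain ⟨b, hb⟩ := (SES.of_rangeRestrict (D d)).exact_right x (by
    rw [← hx, SES.conn_q]
    exact T.top d _ (by omega) _)
  have hb' : HH.map y (D d).rangeRestrict (HH.q y d (HH.p hy (P (d + 1)) ℓ b)) = x := by
    rw [HH.map_q, ← HH.p_map_zero hy (hD d).rangeRestrict, hb, hx]
  set f : Finset (Fin m) → HH y (K (d + 1)) :=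
    kN hy (P (d + 1)) d (ℓ - (0 : ℕ)) (0 : ℕ) fun _ => b with hf
  obtain ⟨g, hg1, hg2⟩ := h f (kN_kN hy _ _ _ _ _) (by
    funext S
    rw [kdown_apply]
    refine Finset.sum_eq_zero fun j _ => ?_
    split_ifs with hj
    · rfl
    · rw [hf, kN_apply, if_neg (by simp [Finset.card_insert_of_notMem hj]; omega), smul_zero,
        smul_zero]) (fun S => by
    rw [hf, kN_apply]
    split_ifs
    · rw [Nat.cast_zero, sub_zero, ← HH.map_subtype_map_rangeRestrict, hb', hx0]
    · exact map_zero _)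
  refine ⟨fun j => HH.map y (D d).rangeRestrict (g (insert j ∅)), fun i => ?_, ?_⟩
  · rw [HH.map_subtype_map_rangeRestrict, hg1]
  · have h1 := congrFun hg2 ∅
    rw [hf, kN_apply, if_pos (by simp), Nat.cast_zero, sub_zero, kdown_apply] at h1
    rw [← hb', ← h1, map_sum]
    refine Finset.sum_congr rfl fun j _ => ?_
    simp [ksgn]

lemma BdryGen.exists_sum (T : Tower y D d) {ℓ : ℤ} {q : ℕ} (hq : q < d)
    (h : BdryGen hy z hD ℓ (q + 1)) (x : HH y ↥(LinearMap.range (D q)))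
    (hx : HH.q y q (HH.p hy ((P q).sub (LinearMap.range (D q)) (hD q).P_mem_range) ℓ x) = x) :
    ∃ u : Fin m → HH y ↥(LinearMap.range (D q)), ∑ i, z i • u i = x := by
  set S1 := SES.of_rangeRestrict (D q)
  set S2 := SES.of_inclusion (T.le q)
  set Pker := (P (q + 1)).sub (LinearMap.ker (D q)) (hD q).P_mem_ker
  have hker : GrHom Pker (P (q + 1)) (LinearMap.ker (D q)).subtype 0 := GrProj.grHom_subtype _ _
  have hsub : ∀ v, HH.map y (LinearMap.ker (D q)).subtype
      (HH.map y (Submodule.inclusion (T.le q)) v) =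
        HH.map y (LinearMap.range (D (q + 1))).subtype v := fun v => by
    rw [HH.map_comp_apply]
    rfl
  have hc : HH.q y ((q + 1 : ℕ) : ℤ) (HH.p hy Pker ℓ (S1.conn x)) = S1.conn x := by
    conv_rhs => rw [← hx, S1.conn_q, S1.conn_p hy hker (hD q).rangeRestrict]
    push_cast
    rfl
  obtain ⟨x', hx'⟩ := S2.exact_mid (S1.conn x) (by
    rw [← hc, HH.map_q]
    exact T.hom q hq _ (by push_cast; omega) _)
  set Pran := (P (q + 1)).sub (LinearMap.range (D (q + 1))) (hD (q + 1)).P_mem_range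
  set x'' := HH.q y ((q + 1 : ℕ) : ℤ) (HH.p hy Pran ℓ x')
  have hx'' : HH.map y (Submodule.inclusion (T.le q)) x'' = S1.conn x := by
    rw [HH.map_q, ← HH.p_map_zero hy (Q := Pker) (.of_map_P fun _ _ => rfl), hx', hc]
  obtain ⟨u, hu, hux⟩ := h x'' (by rw [HH.p_q, HH.q_idem, HH.p_idem]) (by
    rw [← hsub, hx'', S1.map_conn])
  choose v hv using fun i => S1.exact_left (HH.map y (Submodule.inclusion (T.le q)) (u i)) (by
    rw [hsub, hu])
  obtain ⟨b, hb⟩ := S1.exact_right (x - ∑ i, z i • v i) (by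
    simp only [map_sub, map_sum, map_smul, hv]
    rw [← hx'', ← hux]
    simp only [map_sum, map_smul, sub_self])
  refine ⟨fun i => HH.q y q (v i), ?_⟩
  have h1 := congrArg (HH.q y q) hb
  rw [← HH.map_q, T.cm q hq _ (by exact_mod_cast hq), map_zero, map_sub, ← hx, HH.q_idem, hx] at h1
  simp only [map_sum, map_smul] at h1
  exact (sub_eq_zero.1 h1.symm).symm

lemma BdryGen.of_exists_sum (T : Tower y D d) (hz : ∀ j, z j ∈ 𝒜 1) {ℓ : ℤ} {q : ℕ}
    (hq : q + 1 < d) (h : ∀ x : HH y ↥(LinearMap.range (D (q + 1))),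
      HH.q y ((q + 1 : ℕ) : ℤ) (HH.p hy
        ((P (q + 1)).sub (LinearMap.range (D (q + 1))) (hD (q + 1)).P_mem_range) ℓ x) = x →
      ∃ u : Fin m → HH y ↥(LinearMap.range (D (q + 1))), ∑ i, z i • u i = x) :
    BdryGen hy z hD ℓ (q + 1) := by
  intro x hx _
  obtain ⟨u, hu⟩ := h x hx
  set Pran := (P (q + 1)).sub (LinearMap.range (D (q + 1))) (hD (q + 1)).P_mem_range
  refine ⟨fun i => HH.q y ((q + 1 : ℕ) : ℤ) (HH.p hy Pran (ℓ - 1) (u i)), fun i => ?_, ?_⟩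
  · rw [HH.map_q]
    exact T.cm q (by omega) _ (by exact_mod_cast hq) _
  · rw [← hx, ← hu, map_sum, map_sum]
    refine Finset.sum_congr rfl fun i _ => ?_
    have := HH.p_smul hy Pran (hz i) (ℓ - 1) (u i)
    rw [add_sub_cancel] at this
    rw [this, map_smul]

lemma KerExact.exists_sum (T : Tower y D d) (hz : ∀ j, z j ∈ 𝒜 1) (hd : 1 ≤ d) {ℓ : ℤ}
    (h : KerExact D d hy P z ℓ d 0) (x : HH y ↥(LinearMap.range (D 0)))
    (hx : HH.q y 0 (HH.p hy ((P 0).sub (LinearMap.range (D 0)) (hD 0).P_mem_range) ℓ x) = x) :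
    ∃ u : Fin m → HH y ↥(LinearMap.range (D 0)), ∑ i, z i • u i = x := by
  have key : ∀ k q, q + 1 + k = d → BdryGen hy z hD ℓ (q + 1) := by
    intro k
    induction k with
    | zero =>
      rintro q rfl
      exact h.bdryGen hy hD T
    | succ k ih =>
      intro q hq
      exact .of_exists_sum hy hD T hz (by omega) ((ih (q + 1) (by omega)).exists_sum hy hD T
        (by omega))
  exact (key (d - 1) 0 (by omega)).exists_sum hy hD T (by omega) x (by exact_mod_cast hx)

end BoundaryGenerators

section Evaluation

variable {n : ℕ} (y : Fin n → R) {X : Type} [AddCommGroup X] [Module R X]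

/-- The component of a Čech cochain in degree zero. -/
def Cech.ev : Cech y X →ₗ[R] X where
  toFun := DirectLimit.lift _ (fun _ f => f ∅) (by
    intro i j hij f
    simp [kT_apply])
  map_add' a b := by
    obtain ⟨s, f, rfl⟩ := Cech.ind y a
    obtain ⟨t, g, rfl⟩ := Cech.ind y b
    rw [Cech.mk_level y s t, Cech.mk_level y t s, add_comm t s, ← map_add]
    rfl
  map_smul' r a := by
    obtain ⟨s, f, rfl⟩ := Cech.ind y a
    rw [← map_smul]
    rfl

lemma Cech.ev_mk (t : ℕ) (f : Finset (Fin n) → X) : Cech.ev y (Cech.mk y t f) = f ∅ := rfl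

lemma Cech.ev_d (x : Cech y X) : Cech.ev y (Cech.d y x) = 0 := by
  obtain ⟨t, f, rfl⟩ := Cech.ind y x
  rw [Cech.d_mk, Cech.ev_mk, kup_apply]
  simp

/-- The map from the Čech cohomology to the module given by the component in degree zero. -/
def HH.ev : HH y X →ₗ[R] X :=
  Submodule.liftQ _ (Cech.ev y ∘ₗ (LinearMap.ker (Cech.d y (X := X))).subtype) (by
    rintro ⟨_, _⟩ ⟨g, rfl⟩
    exact Cech.ev_d y g)

lemma HH.ev_mk (x : ↥(LinearMap.ker (Cech.d y (X := X)))) :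
    HH.ev y (HH.mk y x) = Cech.ev y (x : Cech y X) := rfl

lemma HH.ev_q_zero (h : HH y X) : HH.ev y (HH.q y 0 h) = HH.ev y h := by
  obtain ⟨⟨x, hx⟩, rfl⟩ := HH.ind y h
  obtain ⟨t, f, rfl⟩ := Cech.ind y x
  rw [HH.q_mk, HH.ev_mk, HH.ev_mk]
  change Cech.ev y (Cech.q y 0 (Cech.mk y t f)) = Cech.ev y (Cech.mk y t f)
  rw [Cech.q_mk, Cech.ev_mk, Cech.ev_mk, kq_apply]
  simp

variable {y}

lemma HH.exists_ev_eq {x : X} (hx : ∀ j, ∃ t : ℕ, y j ^ t • x = 0) : ∃ h : HH y X, HH.ev y h = x := by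
  choose t ht using hx
  have hc : Cech.d y (Cech.mk y (∑ j, t j) fun S : Finset (Fin n) => if S = ∅ then x else 0) = 0 := by
    rw [Cech.d_mk, ← map_zero (Cech.mk y _)]
    congr 1
    funext S
    rw [kup_apply]
    refine Finset.sum_eq_zero fun j _ => ?_
    split_ifs
    · obtain ⟨s, hs⟩ := Nat.exists_eq_add_of_le
        (Finset.single_le_sum (f := t) (fun _ _ => Nat.zero_le _) (Finset.mem_univ j))
      rw [hs, add_comm, pow_add, mul_smul, ht, smul_zero, smul_zero]
    · rw [smul_zero, smul_zero]
    · rfl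
  refine ⟨HH.mk y ⟨_, hc⟩, ?_⟩
  rw [HH.ev_mk, Cech.ev_mk, if_pos rfl]

variable {𝒜 : ℤ → AddSubgroup R} [GradedRing 𝒜] {e : Fin n → ℤ} (hy : ∀ j, y j ∈ 𝒜 (e j))

lemma HH.ev_p (P : GrProj 𝒜 X) (ℓ : ℤ) (h : HH y X) :
    HH.ev y (HH.p hy P ℓ h) = P.P ℓ (HH.ev y h) := by
  obtain ⟨⟨x, hx⟩, rfl⟩ := HH.ind y h
  obtain ⟨t, f, rfl⟩ := Cech.ind y x
  rw [HH.p_mk, HH.ev_mk, HH.ev_mk]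
  change Cech.ev y (Cech.p hy P ℓ (Cech.mk y t f)) = P.P ℓ (Cech.ev y (Cech.mk y t f))
  rw [Cech.p_mk, Cech.ev_mk, Cech.ev_mk, kP_apply]
  simp

include hy in
lemma GrProj.P_mem_torsionSubmodule [IsNoetherianRing R] {I : Ideal R}
    (hI : (Ideal.span (Set.range y)).radical = I.radical) (P : GrProj 𝒜 X) (ℓ : ℤ) (x : X)
    (hx : x ∈ torsionSubmodule I X) : P.P ℓ x ∈ torsionSubmodule I X := by
  rw [mem_torsionSubmodule_iff_y hI] at hx ⊢
  intro j
  obtain ⟨t, ht⟩ := hx j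
  exact ⟨t, by rw [← P.P_smul (pow_mem_graded hy j t), ht, map_zero]⟩

include hy in
/-- A bound for the degrees of the generators of the torsion submodule. -/
lemma subGenDegLE_torsionSubmodule [IsNoetherianRing R] {I : Ideal R}
    (hI : (Ideal.span (Set.range y)).radical = I.radical) (ℳ : ℤ → AddSubgroup X)
    [DirectSum.Decomposition ℳ] [SetLike.GradedSMul 𝒜 ℳ] {m : ℕ} {z : Fin m → R}
    (hz : ∀ j, z j ∈ 𝒜 1) {r : ℤ} (h : ∀ ℓ, r < ℓ → ∀ x : HH y X,
      HH.q y 0 (HH.p hy (GrProj.ofDecomposition 𝒜 ℳ) ℓ x) = x →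
      ∃ u : Fin m → HH y X, ∑ i, z i • u i = x) :
    SubGenDegLE (R := R) ℳ (torsionSubmodule I X) r := by
  classical
  set P := GrProj.ofDecomposition 𝒜 ℳ
  set N := Submodule.span R (⋃ (j : ℤ) (_ : j ≤ r),
    ((torsionSubmodule I X : Set X) ∩ (ℳ j : Set X)))
  have key : ∀ (k : ℕ) (ℓ : ℤ), ℓ ≤ r + k → ∀ x ∈ torsionSubmodule I X, P.P ℓ x = x → x ∈ N := by
    intro k
    induction k with
    | zero =>
      intro ℓ hℓ x hx hxℓ
      refine Submodule.subset_span (Set.mem_iUnion₂.2 ⟨ℓ, by simpa using hℓ, hx, ?_⟩)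
      exact (GrProj.ofDecomposition_eq_iff ℳ ℓ x).1 hxℓ
    | succ k ih =>
      intro ℓ hℓ x hx hxℓ
      by_cases hk : ℓ ≤ r + k
      · exact ih ℓ hk x hx hxℓ
      obtain ⟨w, hw⟩ := HH.exists_ev_eq ((mem_torsionSubmodule_iff_y hI).1 hx)
      obtain ⟨u, hu⟩ := h ℓ (by omega) (HH.q y 0 (HH.p hy P ℓ w))
        (by rw [HH.p_q, HH.q_idem, HH.p_idem])
      have hu' := congrArg (HH.ev y) hu
      rw [HH.ev_q_zero, HH.ev_p, hw, hxℓ] at hu'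
      rw [← hxℓ, ← hu', map_sum, map_sum]
      refine Submodule.sum_mem _ fun i _ => ?_
      have h1 := P.P_smul (hz i) (ℓ - 1) (HH.ev y (u i))
      rw [add_sub_cancel] at h1
      rw [map_smul, h1]
      refine Submodule.smul_mem _ _ (ih (ℓ - 1) (by push_cast at hℓ; omega) _ ?_ (P.idem _ _))
      refine P.P_mem_torsionSubmodule hy hI _ _ ((mem_torsionSubmodule_iff_y hI).2 fun j => ?_)
      obtain ⟨t, ht⟩ := HH.exists_pow_smul_eq_zero j (u i)
      exact ⟨t, by rw [← map_smul, ht, map_zero]⟩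
  intro x hx
  rw [← DirectSum.sum_support_decompose ℳ x]
  refine Submodule.sum_mem _ fun ℓ _ => ?_
  exact key (ℓ - r).toNat ℓ (by omega) _ (P.P_mem_torsionSubmodule hy hI ℓ x hx) (P.idem ℓ x)

end Evaluation

section Retracts

variable {n : ℕ} {y : Fin n → R} {X Y : Type} [AddCommGroup X] [Module R X] [AddCommGroup Y]
  [Module R Y] {σ : X →ₗ[R] Y} {τ : Y →ₗ[R] X}

lemma HH.map_map_of_comp_eq_id (h : τ ∘ₗ σ = LinearMap.id) (x : HH y X) :
    HH.map y τ (HH.map y σ x) = x := by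
  rw [HH.map_comp_apply, h, HH.map_id_apply]

lemma Van₀.of_retract (h : τ ∘ₗ σ = LinearMap.id) {i : ℤ} (hv : Van₀ y Y i) : Van₀ y X i := by
  intro x
  rw [← HH.map_map_of_comp_eq_id h x, ← HH.map_q, hv, map_zero]

lemma Van.of_retract {𝒜 : ℤ → AddSubgroup R} [GradedRing 𝒜] {e : Fin n → ℤ}
    {hy : ∀ j, y j ∈ 𝒜 (e j)} {P : GrProj 𝒜 X} {Q : GrProj 𝒜 Y} (h : τ ∘ₗ σ = LinearMap.id)
    (hτ : GrHom Q P τ 0) {i ℓ : ℤ} (hv : Van hy Q i ℓ) : Van hy P i ℓ := by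
  intro x
  rw [← HH.map_map_of_comp_eq_id h x, HH.p_map_zero hy hτ, ← HH.map_q, hv, map_zero]

end Retracts

section TopKoszul

variable [IsNoetherianRing R] {d : ℕ} (hd : ringKrullDim R ≤ (d : WithBot ℕ∞))
  {n m : ℕ} {y : Fin n → R} {X : Type} [AddCommGroup X] [Module R X] [Module.Finite R X]

include hd in
/-- The top cohomology is generated by its products with the generators of the maximal ideal, as
the exactness of the Koszul complex on no vertices. -/
lemma exists_kdown_eq_of_top {z : Fin m → R}
    (hz : (Ideal.span (Set.range y)).radical = (Ideal.span (Set.range z)).radical) (hd1 : 1 ≤ d)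
    (w : Finset (Fin m) → HH y X) (hw : ∀ S, HH.q y d (w S) = w S) (hw0 : kq (R := R) 0 w = w) :
    ∃ v, kdown z v = w := by
  obtain ⟨r, a, x, hr, -, hx⟩ := exists_sum_smul_eq_of_top hd hz hd1 (w ∅) (hw ∅)
  set g : Finset (Fin m) → HH y X := fun S => if S = ∅ then x else 0 with hg
  have h0 : kdown z g = 0 := by
    funext S
    rw [kdown_apply]
    refine Finset.sum_eq_zero fun j _ => ?_
    simp [hg]
  refine ⟨kup a g, ?_⟩
  have h1 := kup_kdown_add a z g
  rw [h0, map_zero, zero_add, hr] at h1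
  rw [h1, ← hw0]
  funext S
  rw [kq_apply, Pi.smul_apply, hg]
  by_cases hS : S = ∅
  · simp [hS, hx]
  · simp [hS]

end TopKoszul

section Regularity

lemma supportDim_lt_of_modDimLE {X : Type} [AddCommGroup X] [Module R X] [Module.Finite R X]
    {b : ℕ} (h : modDimLE (R := R) X b) :
    Module.supportDim R X < ((b + 1 : ℕ) : WithBot ℕ∞) := by
  rw [Module.supportDim_eq_ringKrullDim_quotient_annihilator]
  exact lt_of_le_of_lt h (by
    change ((b : ℕ∞) : WithBot ℕ∞) < (((b + 1 : ℕ) : ℕ∞) : WithBot ℕ∞)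
    exact WithBot.coe_lt_coe.2 (Nat.cast_lt.2 b.lt_succ_self))

variable [IsNoetherianRing R] {𝒜 : ℤ → AddSubgroup R} [GradedRing 𝒜] {d t : ℕ}
  {K : ℕ → Type} [∀ j, AddCommGroup (K j)] [∀ j, Module R (K j)] [∀ j, Module.Finite R (K j)]
  {D : ∀ j, K (j + 1) →ₗ[R] K j} {𝒦 : ∀ j, ℤ → AddSubgroup (K j)}
  [∀ j, DirectSum.Decomposition (𝒦 j)] [∀ j, SetLike.GradedSMul 𝒜 (𝒦 j)]
  {n m : ℕ} {y : Fin n → R} {z : Fin m → R} {e : Fin n → ℤ} {I : Ideal R}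

lemma Tower.of_modDimLE (hd : ringKrullDim R ≤ (d : WithBot ℕ∞))
    (hI : (Ideal.span (Set.range y)).radical = I.radical)
    (hcomplex : ∀ j, D j ∘ₗ D (j + 1) = 0)
    (hexact : LinearMap.ker (D 0) = LinearMap.range (D 1))
    (hH : ∀ q, 1 ≤ q → q < d → modDimLE (R := R) (↥(LinearMap.ker (D q)) ⧸
      (LinearMap.range (D (q + 1))).comap (LinearMap.ker (D q)).subtype) q)
    (hMCM : ∀ q < d, depthGE I (K (q + 1)) d) : Tower y D d where
  le q := LinearMap.range_le_ker_iff.2 (hcomplex q)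
  cm q hq _ hi := van₀_of_depthGE (hI ▸ Ideal.le_radical) (hMCM q hq) hi
  hom q hq i hi := by
    rcases Nat.eq_zero_or_pos q with rfl | hq1
    · have : Subsingleton (↥(LinearMap.ker (D 0)) ⧸
          (LinearMap.range (D (0 + 1))).comap (LinearMap.ker (D 0)).subtype) := by
        rw [Submodule.Quotient.subsingleton_iff]
        exact Submodule.comap_subtype_eq_top.2 hexact.le
      exact van₀_of_subsingleton i
    · exact van₀_of_supportDim_lt (supportDim_lt_of_modDimLE (hH q hq1 hq))
        (by push_cast; omega)
  top _ _ hi := van₀_of_ringKrullDim_le hd hi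

variable (hd : ringKrullDim R ≤ (d : WithBot ℕ∞)) (hy : ∀ j, y j ∈ 𝒜 (e j))
  (hI : (Ideal.span (Set.range y)).radical = I.radical) (T : Tower y D d)
  (hD : ∀ j, GrHom (GrProj.ofDecomposition 𝒜 (𝒦 (j + 1))) (GrProj.ofDecomposition 𝒜 (𝒦 j)) (D j) 0)
  (hsurj : Function.Surjective (D 0)) (ht1 : 1 ≤ t) (htd : t ≤ d)
  (hdepth : depthGE I (K 0 ⧸ torsionSubmodule I (K 0)) t)

omit [∀ j, Module.Finite R (K j)] in
include hI hsurj hdepth in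
lemma van₀_range_of_depthGE {i : ℕ} (hi1 : 1 ≤ i) (hi : i < t) :
    Van₀ y ↥(LinearMap.range (D 0)) i := by
  have h : Van₀ y (K 0) i := (SES.of_submodule (torsionSubmodule I (K 0))).van₀_mid
    (van₀_torsionSubmodule hI (by omega))
    (van₀_of_depthGE (hI ▸ Ideal.le_radical) hdepth (by omega))
  exact h.of_retract (σ := (LinearMap.range (D 0)).subtype)
    (τ := (LinearMap.id : K 0 →ₗ[R] K 0).codRestrict _ fun x => hsurj x) rfl

include hd hy hI T hD hsurj ht1 htd hdepth in
lemma subGenDegLE_torsionSubmodule_of_tower (hIz : I = Ideal.span (Set.range z))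
    (hz : ∀ j, z j ∈ 𝒜 1) (hMCM : ∀ q < d, depthGE I (K (q + 1)) d) {r : ℤ}
    (hvan : ∀ ℓ, r < ℓ →
      Van hy (GrProj.ofDecomposition 𝒜 (𝒦 (d - t + 1))) d (ℓ - t)) :
    SubGenDegLE (R := R) (𝒦 0) (torsionSubmodule I (K 0)) r := by
  refine subGenDegLE_torsionSubmodule hy hI (𝒦 0) hz fun ℓ hℓ x hx => ?_
  have hker := Tower.kerExact hy T hz hD ht1 (Nat.sub_add_cancel htd) (fun q s hqs hst w hw hw1 hw0 => by
    rcases Nat.eq_zero_or_pos s with rfl | hs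
    · exact exists_kdown_eq_of_top hd (by rw [hI, hIz]) (by omega) w hw hw1
    · rcases hMCM q (by omega) with hs0 | ⟨rs, hlen, hrs, hreg⟩
      · refine ⟨0, ?_⟩
        rw [map_zero]
        funext S
        rw [← hw S]
        exact (van₀_of_subsingleton (d : ℤ) (w S)).symm
      · subst hlen
        exact exists_kdown_eq (fun r hr => hI ▸ Ideal.le_radical (hrs r hr))
          (fun r hr => hIz ▸ hrs r hr) hreg.toIsWeaklyRegular (supportDim_lt_succ hd) (by omega)
          w hw hw1 hw0)
    (fun i hi1 hi => van₀_range_of_depthGE hI hsurj hdepth hi1 hi) (hvan ℓ hℓ)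
  set σ := (LinearMap.id : K 0 →ₗ[R] K 0).codRestrict (LinearMap.range (D 0)) fun x => hsurj x
  have hσ : GrHom (GrProj.ofDecomposition 𝒜 (𝒦 0))
      ((GrProj.ofDecomposition 𝒜 (𝒦 0)).sub (LinearMap.range (D 0)) (hD 0).P_mem_range) σ 0 :=
    .of_map_P fun _ _ => rfl
  obtain ⟨u, hu⟩ := hker.exists_sum hy hD T hz (by omega) (HH.map y σ x) (by
    rw [HH.p_map_zero hy hσ, ← HH.map_q, hx])
  refine ⟨fun i => HH.map y (LinearMap.range (D 0)).subtype (u i), ?_⟩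
  rw [← HH.map_map_of_comp_eq_id (y := y) (σ := σ) (τ := (LinearMap.range (D 0)).subtype) rfl x,
    ← hu, map_sum]
  simp only [map_smul]

include hd hy hI T hD hsurj htd hdepth in
lemma kVanish_quotient_torsionSubmodule_of_tower {B γ : ℤ} {i : ℕ} {ℓ : ℤ}
    (hℓ : B + γ + d - i < ℓ)
    (hvan : ∀ j ≤ d - t, ∀ ℓ, B + j + γ < ℓ → Van hy (GrProj.ofDecomposition 𝒜 (𝒦 (j + 1))) d ℓ) :
    KVanish y (fun k => AddSubgroup.map ((torsionSubmodule I (K 0)).mkQ).toAddMonoidHom (𝒦 0 k))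
      e i ℓ := by
  set P := GrProj.ofDecomposition 𝒜 (𝒦 0) with hP
  have hN := fun ℓ x hx => P.P_mem_torsionSubmodule hy hI ℓ x hx
  refine Van.kVanish hy (P := P.quot _ hN) ?_ ?_
  · rintro k _ ⟨x, hx, rfl⟩
    exact congrArg (torsionSubmodule I (K 0)).mkQ
      ((GrProj.ofDecomposition_eq_iff (𝒜 := 𝒜) (𝒦 0) k x).2 hx)
  · rcases lt_or_ge i t with hit | hti
    · exact (van₀_of_depthGE (hI ▸ Ideal.le_radical) hdepth (by omega)).van hy _ _
    rcases lt_or_ge d i with hdi | hid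
    · exact (van₀_of_ringKrullDim_le hd (by omega)).van hy _ _
    have h1 := T.van_bdry hy hD (i := i) (ℓ := ℓ) (d - i)
      (hvan _ (by omega) ℓ (by push_cast [hid]; omega)) (by omega) (Nat.zero_le _)
    rw [add_zero] at h1
    have h2 : Van hy P i ℓ := h1.of_retract
      (σ := (LinearMap.id : K 0 →ₗ[R] K 0).codRestrict _ fun x => hsurj x)
      (τ := (LinearMap.range (D 0)).subtype) rfl (GrProj.grHom_subtype _ _)
    exact (SES.of_submodule (torsionSubmodule I (K 0))).van_right hy (GrProj.grHom_subtype _ hN)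
      (GrProj.grHom_mkQ _ _) h2 ((van₀_torsionSubmodule hI (by omega)).van hy _ _)

end Regularity

section Augmentation

variable (M : Type) (C : ℕ → Type)

/-- The terms of the complex `⋯ → C 1 → C 0 → M`. -/
def augTerm : ℕ → Type
  | 0 => M
  | j + 1 => C j

variable [AddCommGroup M] [Module R M] [∀ j, AddCommGroup (C j)] [∀ j, Module R (C j)]

instance : ∀ j, AddCommGroup (augTerm M C j)
  | 0 => inferInstanceAs (AddCommGroup M)
  | j + 1 => inferInstanceAs (AddCommGroup (C j))

instance : ∀ j, Module R (augTerm M C j)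
  | 0 => inferInstanceAs (Module R M)
  | j + 1 => inferInstanceAs (Module R (C j))

variable {M C}

/-- The differentials of the complex `⋯ → C 1 → C 0 → M`. -/
def augMap (π : C 0 →ₗ[R] M) (dl : ∀ j, C (j + 1) →ₗ[R] C j) :
    ∀ j, augTerm M C (j + 1) →ₗ[R] augTerm M C j
  | 0 => π
  | j + 1 => dl j

/-- The gradings of the terms of the complex `⋯ → C 1 → C 0 → M`. -/
def augGrading (ℳ : ℤ → AddSubgroup M) (𝒞 : ∀ j, ℤ → AddSubgroup (C j)) :
    ∀ j, ℤ → AddSubgroup (augTerm M C j)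
  | 0 => ℳ
  | j + 1 => 𝒞 j

variable {ℳ : ℤ → AddSubgroup M} {𝒞 : ∀ j, ℤ → AddSubgroup (C j)}

instance [DirectSum.Decomposition ℳ] [∀ j, DirectSum.Decomposition (𝒞 j)] :
    ∀ j, DirectSum.Decomposition (augGrading ℳ 𝒞 j)
  | 0 => inferInstanceAs (DirectSum.Decomposition ℳ)
  | j + 1 => inferInstanceAs (DirectSum.Decomposition (𝒞 j))

instance {𝒜 : ℤ → AddSubgroup R} [SetLike.GradedSMul 𝒜 ℳ] [∀ j, SetLike.GradedSMul 𝒜 (𝒞 j)] :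
    ∀ j, SetLike.GradedSMul 𝒜 (augGrading ℳ 𝒞 j)
  | 0 => inferInstanceAs (SetLike.GradedSMul 𝒜 ℳ)
  | j + 1 => inferInstanceAs (SetLike.GradedSMul 𝒜 (𝒞 j))

end Augmentation

theorem statement14
    (𝒜 : ℤ → AddSubgroup R) [GradedRing 𝒜]
    (hNoeth : IsNoetherianRing R)
    (hnonneg : ∀ i : ℤ, i < 0 → 𝒜 i = ⊥)
    -- `R₀` is a field and `R` is standard graded: `R = R₀[R₁]`
    (hfield : IsField ↥(𝒜 0))
    (hstd : Subring.closure ((𝒜 0 : Set R) ∪ (𝒜 1 : Set R)) = ⊤)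
    -- `d = dim R` and `R` is Cohen–Macaulay
    (d : ℕ) (hdim : ringKrullDim R = (d : WithBot (WithTop ℕ)))
    (hCM : depthGE (maxHomIdeal 𝒜) R d)
    -- `M = H₀(C_•)` for a graded complex of finitely generated graded modules
    (M : Type) [AddCommGroup M] [Module R M]
    (ℳ : ℤ → AddSubgroup M) [DirectSum.Decomposition ℳ] [SetLike.GradedSMul 𝒜 ℳ]
    (C : ℕ → Type) [∀ j, AddCommGroup (C j)] [∀ j, Module R (C j)]
    (hCfin : ∀ j, Module.Finite R (C j))
    (dl : ∀ j, C (j + 1) →ₗ[R] C j)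
    (hcomplex : ∀ j, (dl j).comp (dl (j + 1)) = 0)
    (𝒞 : ∀ j, ℤ → AddSubgroup (C j))
    [∀ j, DirectSum.Decomposition (𝒞 j)] [∀ j, SetLike.GradedSMul 𝒜 (𝒞 j)]
    (hdlhomog : ∀ (j : ℕ) (ℓ : ℤ), ∀ x ∈ 𝒞 (j + 1) ℓ, dl j x ∈ 𝒞 j ℓ)
    (π : C 0 →ₗ[R] M) (hπsurj : Function.Surjective π)
    (hπker : LinearMap.ker π = LinearMap.range (dl 0))
    (hπhomog : ∀ (ℓ : ℤ), ∀ x ∈ 𝒞 0 ℓ, π x ∈ ℳ ℓ)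
    -- `1 ≤ t ≤ d`
    (t : ℕ) (ht1 : 1 ≤ t) (htd : t ≤ d)
    -- (1) `t ≤ depth M/H⁰_𝔪(M)`
    (hdepthM : depthGE (maxHomIdeal 𝒜) (M ⧸ torsionSubmodule (maxHomIdeal 𝒜) M) t)
    -- (2) `dim H_j(C_•) ≤ j` for `1 ≤ j ≤ d − 1`
    (hHdim : ∀ jm1 : ℕ, ((jm1 + 1 : ℕ) : ℤ) ≤ (d : ℤ) - 1 →
      modDimLE (R := R) (Hmod C dl jm1) (jm1 + 1))
    -- (3) `C_j` is maximal Cohen–Macaulay for `0 ≤ j ≤ d − 1`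
    (hMCM : ∀ j : ℕ, (j : ℤ) ≤ (d : ℤ) - 1 → depthGE (maxHomIdeal 𝒜) (C j) d) :
    -- conclusion
    ∀ (m : ℕ) (y : Fin m → R) (e : Fin m → ℤ),
      (∀ j, y j ∈ 𝒜 (e j)) →
      (Ideal.span (Set.range y)).radical = (maxHomIdeal 𝒜).radical →
      ∀ B γ : ℤ,
        -- `max{ b₀(C_i) − i : 0 ≤ i ≤ d − t } ≤ B`
        (∀ i : ℕ, i ≤ d - t → GenDegLE (R := R) (𝒞 i) (B + i)) →
        -- `a(R) ≤ γ`, so that `reg R ≤ γ + d`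
        (∀ ℓ : ℤ, γ < ℓ → KVanish y (fun j => 𝒜 j) e d ℓ) →
        -- `b₀(H⁰_𝔪(M)) ≤ B + reg R`
        (SubGenDegLE (R := R) ℳ (torsionSubmodule (maxHomIdeal 𝒜) M) (B + γ + d)
        -- `reg (M/H⁰_𝔪(M)) ≤ B + reg R`, i.e. `a_i + i ≤ B + γ + d` for all `i`
        ∧ ∀ i : ℕ, ∀ ℓ : ℤ, B + γ + d - i < ℓ →
            KVanish y
              (fun z => AddSubgroup.map
                ((torsionSubmodule (maxHomIdeal 𝒜) M).mkQ).toAddMonoidHom (ℳ z))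
              e i ℓ) := by
  intro n y e hy hrad B γ hgen hγ
  have hd : ringKrullDim R ≤ (d : WithBot ℕ∞) := hdim.le
  obtain ⟨m, z, hz, hspan⟩ := exists_span_range_eq (𝒜 1 : Set R)
  rw [← maxHomIdeal_eq_span 𝒜 hnonneg hfield hstd] at hspan
  have hKfin : ∀ j, Module.Finite R (augTerm M C j)
    | 0 => Module.Finite.of_surjective π hπsurj
    | j + 1 => hCfin j
  have hhom : ∀ (j : ℕ) (ℓ : ℤ), ∀ x ∈ augGrading ℳ 𝒞 (j + 1) ℓ,
      augMap π dl j x ∈ augGrading ℳ 𝒞 j (0 + ℓ) := by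
    intro j ℓ x hx
    rw [zero_add]
    cases j with
    | zero => exact hπhomog ℓ x hx
    | succ j => exact hdlhomog j ℓ x hx
  have hD : ∀ j, GrHom (GrProj.ofDecomposition 𝒜 (augGrading ℳ 𝒞 (j + 1)))
      (GrProj.ofDecomposition 𝒜 (augGrading ℳ 𝒞 j)) (augMap π dl j) 0 :=
    fun j => GrProj.grHom_ofDecomposition _ (hhom j)
  have hCM' : ∀ q < d, depthGE (maxHomIdeal 𝒜) (augTerm M C (q + 1)) d :=
    fun q hq => hMCM q (by omega)
  have T : Tower y (augMap π dl) d := by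
    refine Tower.of_modDimLE hd hrad ?_ hπker ?_ hCM'
    · rintro (_ | j)
      · exact LinearMap.range_le_ker_iff.1 hπker.ge
      · exact hcomplex j
    · rintro (_ | q) hq1 hq
      · exact absurd hq1 (by omega)
      · exact hHdim q (by omega)
  have hvan : ∀ j ≤ d - t, ∀ ℓ, B + j + γ < ℓ →
      Van hy (GrProj.ofDecomposition 𝒜 (augGrading ℳ 𝒞 (j + 1))) d ℓ := fun j hj ℓ hℓ =>
    GenDegLE.van hd hy (ℳ := 𝒞 j) (hgen j hj) (fun k hk => van_of_kVanish hy
      (fun l x => (GrProj.ofDecomposition_eq_iff 𝒜 l x).1) (hγ k hk)) hℓ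
  exact ⟨subGenDegLE_torsionSubmodule_of_tower hd hy hrad T hD hπsurj ht1 htd hdepthM hspan.symm
      hz hCM' fun ℓ hℓ => hvan _ le_rfl _ (by push_cast [htd]; omega),
    fun i ℓ hℓ => kVanish_quotient_torsionSubmodule_of_tower hd hy hrad T hD hπsurj htd hdepthM
      hℓ hvan⟩

end Paper
end
end

section
/- Let k be an infinite field and R a standard graded Cohen-Macaulay ring with R_0 = k and dim R = d. Let s and n be integers with 3 ≤ n, n odd, and let φ be an n×n alternating matrix with homogeneous linear entries from R. Suppose (a) d < binom(s+2, 2), (b) 3 ≤ ht Pf_{n−1}(φ), and (c) n − i ≤ ht I_i(φ) for all i with n − s ≤ i ≤ n − 1. Then there exists an n×n alternating matrix Φ with homogeneous linear entries from the standard graded k-algebra R[x_{d+1}] such that: (1) Φ specializes to φ under x_{d+1} ↦ 0; (2) 3 ≤ ht Pf_{n−1}(Φ); and (3) n − i ≤ ht I_i(Φ) for all i with n − s − 1 ≤ i ≤ n − 1. -/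
/-!
Statement 18 (Lemma `deform` of the paper).

`k` an infinite field, `R` a standard graded Cohen–Macaulay ring with `R₀ = 𝒜 0 = k`
(encoded via the grading `𝒜` with `𝒜 0` an infinite field and `R = R₀[R₁]`),
`dim R = d`; `3 ≤ n` odd and `φ` an `n × n` alternating matrix with homogeneous
linear entries; assume (a) `d < (s+2)(s+1)/2`, (b) `3 ≤ ht Pf_{n-1}(φ)`, and
(c) `n − i ≤ ht I_i(φ)` for `n − s ≤ i ≤ n − 1`.  Then there is an `n × n`
alternating matrix `φ'` of constants (entries in `𝒜 0`) such that, with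
`Φ = φ + x_{d+1}·φ'` over `R[x_{d+1}]` (so `Φ` has homogeneous linear entries and
specializes to `φ` under `x_{d+1} ↦ 0`):
(2) `3 ≤ ht Pf_{n-1}(Φ)`, and (3) `n − i ≤ ht I_i(Φ)` for `n − s − 1 ≤ i ≤ n − 1`.
-/

noncomputable section
namespace Paper

variable {R : Type} [CommRing R]

def pf : (n : ℕ) → Matrix (Fin n) (Fin n) R → R
  | 0, _ => 1
  | 1, _ => 0
  | (n + 2), A =>
    ∑ j : Fin (n + 1),
      (-1 : R) ^ (j : ℕ) * A 0 j.succ *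
        pf n (A.submatrix (fun i => Fin.succ (j.succAbove i))
          (fun i => Fin.succ (j.succAbove i)))

def pfaffianIdeal (n r : ℕ) (A : Matrix (Fin n) (Fin n) R) : Ideal R :=
  Ideal.span { x | ∃ (S : Finset (Fin n)) (h : S.card = r),
    x = pf r (A.submatrix (S.orderEmbOfFin h) (S.orderEmbOfFin h)) }

def minorsIdeal (n r : ℕ) (A : Matrix (Fin n) (Fin n) R) : Ideal R :=
  Ideal.span { x | ∃ f g : Fin r → Fin n, x = (A.submatrix f g).det }

def idealHeight (I : Ideal R) : ℕ∞ :=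
  ⨅ (𝔭 : PrimeSpectrum R) (_ : I ≤ 𝔭.asIdeal), Order.height 𝔭

def IsAlternating {n : ℕ} (A : Matrix (Fin n) (Fin n) R) : Prop :=
  (∀ i, A i i = 0) ∧ ∀ i j, A j i = - A i j

/-- A property of vectors with entries in `k` that holds somewhere and fails for only finitely many
points on every `k`-line through a point where it holds. -/
def LineGeneric (k : Subring R) {m : ℕ} (U : (Fin m → R) → Prop) : Prop :=
  (∃ w, (∀ j, w j ∈ k) ∧ U w) ∧
    ∀ w u, (∀ j, w j ∈ k) → (∀ j, u j ∈ k) → U w → {t : k | ¬ U (w + (t : R) • u)}.Finite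

section LineGeneric

variable {k : Subring R} {m : ℕ}

lemma LineGeneric.and [Infinite k] {U V : (Fin m → R) → Prop} (hU : LineGeneric k U)
    (hV : LineGeneric k V) : LineGeneric k fun w => U w ∧ V w := by
  refine ⟨?_, fun w u hw hu h => ?_⟩
  · obtain ⟨⟨a, ha, hUa⟩, hU'⟩ := hU
    obtain ⟨⟨b, hb, hVb⟩, hV'⟩ := hV
    have h1 := hU' a (b - a) ha (fun j => k.sub_mem (hb j) (ha j)) hUa
    have h2 := hV' b (b - a) hb (fun j => k.sub_mem (hb j) (ha j)) hVb
    have h3 : {t : k | ¬ V (a + (t : R) • (b - a))}.Finite := by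
      refine (h2.image (fun t => t + 1)).subset fun t ht => ⟨t - 1, ?_, by simp⟩
      have : b + ((t - 1 : k) : R) • (b - a) = a + (t : R) • (b - a) := by
        funext j
        simp only [Pi.add_apply, Pi.smul_apply, Pi.sub_apply, smul_eq_mul]
        push_cast
        ring
      change ¬ V _
      rw [this]
      exact ht
    obtain ⟨t, ht⟩ := (h1.union h3).infinite_compl.nonempty
    simp only [Set.mem_compl_iff, Set.mem_union, Set.mem_ofPred_eq, not_or, not_not] at ht
    exact ⟨a + (t : R) • (b - a),
      fun j => k.add_mem (ha j) (k.mul_mem t.2 (k.sub_mem (hb j) (ha j))), ht⟩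
  · refine ((hU.2 w u hw hu h.1).union (hV.2 w u hw hu h.2)).subset fun t ht => ?_
    simp only [Set.mem_ofPred_eq, not_and_or] at ht
    exact ht

lemma LineGeneric.forall_of_finite [Infinite k] {ι : Type*} {T : Set ι} (hT : T.Finite)
    {U : ι → (Fin m → R) → Prop} (hU : ∀ i ∈ T, LineGeneric k (U i)) :
    LineGeneric k fun w => ∀ i ∈ T, U i w := by
  induction T, hT using Set.Finite.induction_on with
  | empty => exact ⟨⟨0, by simp⟩, by simp⟩
  | insert _ _ ih =>
    simp only [Set.forall_mem_insert] at hU ⊢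
    exact hU.1.and (ih hU.2)

lemma exists_lineGeneric_forall_of_finite [Infinite k] {ι : Type*} {T : Set ι} (hT : T.Finite)
    {V : ι → (Fin m → R) → Prop}
    (hV : ∀ i ∈ T, ∃ U, LineGeneric k U ∧ ∀ w, U w → V i w) :
    ∃ U, LineGeneric k U ∧ ∀ w, U w → ∀ i ∈ T, V i w := by
  choose! U hU using hV
  exact ⟨_, LineGeneric.forall_of_finite hT fun i hi => (hU i hi).1,
    fun w hw i hi => (hU i hi).2 w (hw i hi)⟩

lemma lineGeneric_add_notMem (hk : ∀ a ∈ k, a ≠ 0 → IsUnit a) {P : Ideal R} (hP : P.IsPrime)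
    (c : R) (L : (Fin m → R) →ₗ[R] R) {w₁ : Fin m → R} (hw₁ : ∀ j, w₁ j ∈ k) (h : L w₁ ∉ P) :
    LineGeneric k fun w => c + L w ∉ P := by
  constructor
  · by_cases h0 : c ∈ P
    · exact ⟨w₁, hw₁, fun h' => h ((P.add_mem_iff_right h0).1 h')⟩
    · exact ⟨0, by simp, by simpa using h0⟩
  · intro w u _ _ hwu
    refine Set.Subsingleton.finite fun t ht t' ht' => ?_
    by_contra hne
    simp only [Set.mem_ofPred_eq, not_not, map_add, map_smul, smul_eq_mul] at ht ht'
    have h1 : ((t : R) - t') * L u ∈ P := by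
      convert P.sub_mem ht ht' using 1
      ring
    have h2 : IsUnit ((t : R) - t') :=
      hk _ (k.sub_mem t.2 t'.2) (by simpa [sub_eq_zero] using hne)
    have h3 : L u ∈ P := (hP.mem_or_mem h1).resolve_left
      fun h' => hP.ne_top (P.eq_top_of_isUnit_mem h' h2)
    refine hwu ?_
    have := P.sub_mem ht (P.mul_mem_left (t : R) h3)
    convert this using 1
    ring

lemma single_mem (ρ : Fin m) (j : Fin m) : (Pi.single ρ 1 : Fin m → R) j ∈ k := by
  rw [Pi.single_apply]
  split_ifs
  exacts [k.one_mem, k.zero_mem]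

end LineGeneric

/-- The points of the spectrum that are minimal over `I`. -/
def minimalPoints (I : Ideal R) : Set (PrimeSpectrum R) :=
  {Q | Q.asIdeal ∈ I.minimalPrimes}

lemma finite_minimalPoints [IsNoetherianRing R] (I : Ideal R) : (minimalPoints I).Finite :=
  (I.finite_minimalPrimes_of_isNoetherianRing).preimage
    fun _ _ _ _ h => PrimeSpectrum.ext h

lemma exists_minimalPoints_le {I : Ideal R} {P : PrimeSpectrum R} (h : I ≤ P.asIdeal) :
    ∃ Q ∈ minimalPoints I, Q.asIdeal ≤ P.asIdeal := by
  obtain ⟨Q, hQ, hQP⟩ := Ideal.exists_minimalPrimes_le h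
  exact ⟨⟨Q, hQ.1.1⟩, hQ, hQP⟩

lemma minimalPoints.le {I : Ideal R} {Q : PrimeSpectrum R} (h : Q ∈ minimalPoints I) :
    I ≤ Q.asIdeal :=
  h.1.2

lemma height_le_height_of_asIdeal_le {P Q : PrimeSpectrum R} (h : Q.asIdeal ≤ P.asIdeal) :
    Order.height Q ≤ Order.height P :=
  Order.height_mono (α := PrimeSpectrum R) h

lemma height_add_one_le_of_mem_of_notMem {P Q : PrimeSpectrum R} (h : Q.asIdeal ≤ P.asIdeal)
    {a : R} (ha : a ∈ P.asIdeal) (ha' : a ∉ Q.asIdeal) : Order.height Q + 1 ≤ Order.height P :=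
  Order.height_add_one_le (lt_of_le_of_ne h fun e => ha' (e ▸ ha))

/-- The matrix obtained from `T` by adding a first row `(0, u)` and the first column `(0, -u)`. -/
def border {m : ℕ} (u : Fin m → R) (T : Matrix (Fin m) (Fin m) R) :
    Matrix (Fin (m + 1)) (Fin (m + 1)) R :=
  fun i j => Fin.cases (Fin.cases 0 u j) (fun i' => Fin.cases (-u i') (fun j' => T i' j') j) i

@[simp] lemma border_zero_zero {m : ℕ} (u : Fin m → R) (T : Matrix (Fin m) (Fin m) R) :
    border u T 0 0 = 0 := rfl

@[simp] lemma border_zero_succ {m : ℕ} (u : Fin m → R) (T : Matrix (Fin m) (Fin m) R)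
    (j : Fin m) : border u T 0 j.succ = u j := rfl

@[simp] lemma border_succ_zero {m : ℕ} (u : Fin m → R) (T : Matrix (Fin m) (Fin m) R)
    (i : Fin m) : border u T i.succ 0 = -u i := rfl

@[simp] lemma border_succ_succ {m : ℕ} (u : Fin m → R) (T : Matrix (Fin m) (Fin m) R)
    (i j : Fin m) : border u T i.succ j.succ = T i j := rfl

/-- Away from `x = 0`, the ideal of `i × i` minors of `T` has height at least `m - i`. -/
def MinorsBound (x : R) {m : ℕ} (T : Matrix (Fin m) (Fin m) R) : Prop :=
  ∀ P : PrimeSpectrum R, x ∉ P.asIdeal → ∀ i : ℕ, minorsIdeal m i T ≤ P.asIdeal →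
    (m : ℕ∞) ≤ Order.height P + i

/-- Away from `x = 0`, the submaximal Pfaffians of `T` generate an ideal of height at least 3. -/
def PfaffianBound (x : R) {m : ℕ} (T : Matrix (Fin (m + 1)) (Fin (m + 1)) R) : Prop :=
  ∀ P : PrimeSpectrum R, x ∉ P.asIdeal →
    (∀ i : Fin (m + 1), pf m (T.submatrix i.succAbove i.succAbove) ∈ P.asIdeal) →
    3 ≤ Order.height P

/-- The minor of `border u T` on the first column and one further row `ρ` is affine in `u`. -/
lemma exists_det_border_eq {m r : ℕ} (T : Matrix (Fin m) (Fin m) R) (f g : Fin r → Fin m)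
    (ρ : Fin m) (hρ : ∀ l, f l ≠ ρ) :
    ∃ L : (Fin m → R) →ₗ[R] R,
      (∀ u, ((border u T).submatrix (Fin.cons ρ.succ (Fin.succ ∘ f) : Fin (r + 1) → Fin (m + 1))
        (Fin.cons 0 (Fin.succ ∘ g) : Fin (r + 1) → Fin (m + 1))).det = L u) ∧
      L (Pi.single ρ 1) = -(T.submatrix f g).det := by
  let F : Fin (r + 1) → Fin m := Fin.cons ρ f
  refine ⟨∑ l : Fin (r + 1), ((-1) ^ (l : ℕ) * -(T.submatrix (F ∘ l.succAbove) g).det) •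
    LinearMap.proj (F l), fun u => ?_, ?_⟩
  · have hF : (Fin.cons ρ.succ (Fin.succ ∘ f) : Fin (r + 1) → Fin (m + 1)) = Fin.succ ∘ F := by
      funext l
      refine Fin.cases ?_ (fun l => ?_) l <;> simp [F]
    rw [hF, Matrix.det_succ_column_zero, LinearMap.sum_apply]
    refine Finset.sum_congr rfl fun l _ => ?_
    have : ((border u T).submatrix (Fin.succ ∘ F)
        (Fin.cons 0 (Fin.succ ∘ g) : Fin (r + 1) → Fin (m + 1))).submatrix l.succAbove Fin.succ =
        T.submatrix (F ∘ l.succAbove) g := by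
      ext i j
      simp
    rw [this]
    simp
    ring
  · rw [LinearMap.sum_apply, Fin.sum_univ_succ]
    rw [Finset.sum_eq_zero]
    · have : F ∘ Fin.succ = f := by
        funext l
        simp [F]
      simp [this, F]
    · intro l _
      simp [F, hρ l]

lemma minorsIdeal_le_iff {n r : ℕ} {A : Matrix (Fin n) (Fin n) R} {I : Ideal R} :
    minorsIdeal n r A ≤ I ↔ ∀ f g : Fin r → Fin n, (A.submatrix f g).det ∈ I := by
  rw [minorsIdeal, Ideal.span_le]
  constructor
  · exact fun h f g => h ⟨f, g, rfl⟩
  · rintro h _ ⟨f, g, rfl⟩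
    exact h f g

lemma minorsIdeal_le_minorsIdeal_border {m r : ℕ} (u : Fin m → R) (T : Matrix (Fin m) (Fin m) R) :
    minorsIdeal m r T ≤ minorsIdeal (m + 1) r (border u T) :=
  minorsIdeal_le_iff.2 fun f g => Ideal.subset_span ⟨Fin.succ ∘ f, Fin.succ ∘ g, rfl⟩

/-- A generic border preserves `MinorsBound`. -/
lemma MinorsBound.exists_lineGeneric_border [IsNoetherianRing R] {k : Subring R} [Infinite k]
    (hk : ∀ a ∈ k, a ≠ 0 → IsUnit a) {x : R} {m : ℕ} {T : Matrix (Fin m) (Fin m) R}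
    (hT : MinorsBound x T) (v : Fin m → R) :
    ∃ U : (Fin m → R) → Prop, LineGeneric k U ∧
      ∀ w, U w → MinorsBound x (border (v + x • w) T) := by
  obtain ⟨U, hU, hU'⟩ : ∃ U, LineGeneric k U ∧ ∀ w, U w → ∀ r ∈ Set.Iio m,
      ∀ Q ∈ {Q | Q ∈ minimalPoints (minorsIdeal m (r + 1) T) ∧ x ∉ Q.asIdeal ∧
        ¬ minorsIdeal m r T ≤ Q.asIdeal},
      ¬ minorsIdeal (m + 1) (r + 1) (border (v + x • w) T) ≤ Q.asIdeal := by
    refine exists_lineGeneric_forall_of_finite (Set.finite_Iio m) fun r hr => ?_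
    refine exists_lineGeneric_forall_of_finite
      ((finite_minimalPoints _).subset fun Q hQ => hQ.1) fun Q hQ => ?_
    obtain ⟨-, hx, hQ⟩ := hQ
    rw [minorsIdeal_le_iff] at hQ
    push Not at hQ
    obtain ⟨f, g, hδ⟩ := hQ
    obtain ⟨ρ, hρ⟩ : ∃ ρ, ∀ l, f l ≠ ρ := by
      by_contra! h
      have := Fintype.card_le_of_surjective f h
      simp only [Fintype.card_fin] at this
      exact absurd hr (by simpa using this)
    obtain ⟨L, hL, hLρ⟩ := exists_det_border_eq T f g ρ hρ
    refine ⟨_, lineGeneric_add_notMem hk Q.2 (L v) (x • L) (w₁ := Pi.single ρ 1) ?_ ?_,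
      fun w hw h => hw ?_⟩
    · exact single_mem ρ
    · rw [LinearMap.smul_apply, hLρ, smul_eq_mul, mul_neg, neg_mem_iff]
      exact fun h => (Q.2.mem_or_mem h).elim hx hδ
    · have := minorsIdeal_le_iff.1 h (Fin.cons ρ.succ (Fin.succ ∘ f)) (Fin.cons 0 (Fin.succ ∘ g))
      rwa [hL, map_add, map_smul] at this
  refine ⟨U, hU, fun w hw => ?_⟩
  replace hw := hU' w hw
  intro P hx i hi
  rcases i with _ | r
  · refine absurd (minorsIdeal_le_iff.1 hi Fin.elim0 Fin.elim0) ?_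
    rw [Matrix.det_fin_zero]
    exact fun h => P.2.ne_top (P.asIdeal.eq_top_iff_one.2 h)
  by_cases hr : r < m
  swap
  · refine le_trans ?_ le_add_self
    exact_mod_cast (by omega : m + 1 ≤ r + 1)
  by_cases h0 : minorsIdeal m r T ≤ P.asIdeal
  · have := hT P hx r h0
    push_cast
    rw [← add_assoc]
    gcongr
  obtain ⟨Q, hQ, hQP⟩ := exists_minimalPoints_le
    ((minorsIdeal_le_minorsIdeal_border (v + x • w) T).trans hi)
  have hxQ : x ∉ Q.asIdeal := fun h => hx (hQP h)
  have h1 := hw r hr Q ⟨hQ, hxQ, fun h => h0 (h.trans hQP)⟩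
  have h2 := hT Q hxQ (r + 1) (minimalPoints.le hQ)
  have h3 : Order.height Q + 1 ≤ Order.height P :=
    Order.height_add_one_le (lt_of_le_of_ne hQP fun e => h1 (e ▸ hi))
  calc ((m + 1 : ℕ) : ℕ∞) ≤ Order.height Q + ((r + 1 : ℕ) : ℕ∞) + 1 := by push_cast at h2 ⊢; gcongr
    _ = (Order.height Q + 1) + ((r + 1 : ℕ) : ℕ∞) := by ring
    _ ≤ _ := by gcongr


/-- The expansion of the Pfaffian of `border u T` along its first row, as a linear form in `u`. -/
def pfExpansion {m : ℕ} (T : Matrix (Fin (m + 1)) (Fin (m + 1)) R) : (Fin (m + 1) → R) →ₗ[R] R :=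
  ∑ j : Fin (m + 1), ((-1) ^ (j : ℕ) * pf m (T.submatrix j.succAbove j.succAbove)) •
    LinearMap.proj j

lemma pf_border {m : ℕ} (u : Fin (m + 1) → R) (T : Matrix (Fin (m + 1)) (Fin (m + 1)) R) :
    pf (m + 2) (border u T) = pfExpansion T u := by
  rw [pf, pfExpansion, LinearMap.sum_apply]
  refine Finset.sum_congr rfl fun j _ => ?_
  simp only [border_zero_succ, LinearMap.smul_apply, LinearMap.proj_apply, smul_eq_mul]
  rw [mul_right_comm]
  rfl

lemma pfExpansion_single {m : ℕ} (T : Matrix (Fin (m + 1)) (Fin (m + 1)) R) (j : Fin (m + 1)) :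
    pfExpansion T (Pi.single j 1) =
      (-1) ^ (j : ℕ) * pf m (T.submatrix j.succAbove j.succAbove) := by
  rw [pfExpansion, LinearMap.sum_apply, Finset.sum_eq_single j]
  · simp
  · intro i _ hij
    simp [hij]
  · simp

lemma PfaffianBound.exists_pfExpansion_single_notMem {x : R} {m : ℕ}
    {T : Matrix (Fin (m + 1)) (Fin (m + 1)) R} (hT : PfaffianBound x T) {Q : PrimeSpectrum R}
    (hx : x ∉ Q.asIdeal) (hQ : Order.height Q < 3) :
    ∃ j, pfExpansion T (Pi.single j 1) ∉ Q.asIdeal := by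
  by_contra! h
  refine hQ.not_ge (hT Q hx fun j => ?_)
  have := h j
  rw [pfExpansion_single] at this
  rcases neg_one_pow_eq_or R (j : ℕ) with h1 | h1 <;> simpa [h1] using this

lemma lineGeneric_forall_notMem {k : Subring R} [Infinite k] (hk : ∀ a ∈ k, a ≠ 0 → IsUnit a)
    {m : ℕ} {A : Set (PrimeSpectrum R)} (hA : A.Finite) (x : R) (v : Fin m → R)
    (L : (Fin m → R) →ₗ[R] R)
    (h : ∀ Q ∈ A, x ∉ Q.asIdeal ∧ ∃ j, L (Pi.single j 1) ∉ Q.asIdeal) :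
    LineGeneric k fun w => ∀ Q ∈ A, L (v + x • w) ∉ Q.asIdeal := by
  refine LineGeneric.forall_of_finite hA fun Q hQ => ?_
  obtain ⟨hx, j, hj⟩ := h Q hQ
  have := lineGeneric_add_notMem hk Q.2 (L v) (x • L) (single_mem j)
    (fun h => (Q.2.mem_or_mem h).elim hx hj)
  simpa only [map_add, map_smul, LinearMap.smul_apply] using this

/-- A generic border of a matrix satisfying `PfaffianBound` has Pfaffian of height at least 1. -/
lemma PfaffianBound.exists_lineGeneric_border [IsNoetherianRing R] {k : Subring R} [Infinite k]
    (hk : ∀ a ∈ k, a ≠ 0 → IsUnit a) {x : R} {m : ℕ} {T : Matrix (Fin (m + 1)) (Fin (m + 1)) R}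
    (hT : PfaffianBound x T) (v : Fin (m + 1) → R) :
    ∃ U : (Fin (m + 1) → R) → Prop, LineGeneric k U ∧
      ∀ w, U w → ∀ P : PrimeSpectrum R, x ∉ P.asIdeal →
        pf (m + 2) (border (v + x • w) T) ∈ P.asIdeal → 1 ≤ Order.height P := by
  refine ⟨_, lineGeneric_forall_notMem hk
    (A := {Q | Q ∈ minimalPoints (⊥ : Ideal R) ∧ x ∉ Q.asIdeal ∧ Order.height Q < 3})
    ((finite_minimalPoints _).subset fun Q hQ => hQ.1) x v (pfExpansion T) fun Q hQ =>
      ⟨hQ.2.1, hT.exists_pfExpansion_single_notMem hQ.2.1 hQ.2.2⟩, fun w hw P hx hP => ?_⟩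
  by_contra! hlt
  obtain ⟨Q, hQ, hQP⟩ := exists_minimalPoints_le (bot_le : ⊥ ≤ P.asIdeal)
  have h3 : Order.height Q < 3 :=
    ((height_le_height_of_asIdeal_le hQP).trans_lt hlt).trans (by norm_num : (1 : ℕ∞) < 3)
  rw [pf_border] at hP
  have := height_add_one_le_of_mem_of_notMem hQP hP (hw Q ⟨hQ, fun h => hx (hQP h), h3⟩)
  exact hlt.not_ge (le_trans le_add_self this)

/-- The Pfaffian of `border u T` with the row and column `l.succ` removed, as a linear form
in `u`. -/
def borderPfaffian {m : ℕ} (T : Matrix (Fin (m + 2)) (Fin (m + 2)) R) (l : Fin (m + 2)) :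
    (Fin (m + 2) → R) →ₗ[R] R :=
  pfExpansion (T.submatrix l.succAbove l.succAbove) ∘ₗ LinearMap.funLeft R R l.succAbove

lemma pf_border_submatrix_succ {m : ℕ} (u : Fin (m + 2) → R)
    (T : Matrix (Fin (m + 2)) (Fin (m + 2)) R) (l : Fin (m + 2)) :
    pf (m + 2) ((border u T).submatrix l.succ.succAbove l.succ.succAbove) =
      borderPfaffian T l u := by
  have : (border u T).submatrix l.succ.succAbove l.succ.succAbove =
      border (u ∘ l.succAbove) (T.submatrix l.succAbove l.succAbove) := by
    ext i j
    refine Fin.cases ?_ (fun i => ?_) i <;> refine Fin.cases ?_ (fun j => ?_) j <;> simp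
  rw [this, pf_border]
  rfl

lemma borderPfaffian_zero_single_succ {m : ℕ} (T : Matrix (Fin (m + 2)) (Fin (m + 2)) R)
    (j : Fin (m + 1)) :
    borderPfaffian T 0 (Pi.single j.succ 1) =
      pfExpansion (T.submatrix Fin.succ Fin.succ) (Pi.single j 1) := by
  rw [borderPfaffian, Fin.succAbove_zero, LinearMap.comp_apply]
  congr 1
  funext i
  simp [LinearMap.funLeft_apply, Pi.single_apply]

lemma borderPfaffian_zero_single_zero {m : ℕ} (T : Matrix (Fin (m + 2)) (Fin (m + 2)) R) :
    borderPfaffian T 0 (Pi.single 0 1) = 0 := by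
  rw [borderPfaffian, Fin.succAbove_zero, LinearMap.comp_apply]
  have : LinearMap.funLeft R R Fin.succ (Pi.single 0 1 : Fin (m + 2) → R) = 0 := by
    funext i
    simp [LinearMap.funLeft_apply]
  rw [this, map_zero]

/-- The skew-symmetry of the coefficients of the forms `borderPfaffian T l`, for the coefficients
in the first row and column. -/
lemma sum_borderPfaffian_single_zero {m : ℕ} (T : Matrix (Fin (m + 2)) (Fin (m + 2)) R)
    (ρ : Fin (m + 2) → R) :
    (∑ l : Fin (m + 1), ((-1) ^ (l : ℕ) * ρ l.succ) • borderPfaffian T l.succ)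
      (Pi.single 0 1) = borderPfaffian T 0 ρ := by
  have h (l : Fin (m + 1)) : borderPfaffian T l.succ (Pi.single 0 1) =
      pf m ((T.submatrix Fin.succ Fin.succ).submatrix l.succAbove l.succAbove) := by
    have h1 : LinearMap.funLeft R R l.succ.succAbove (Pi.single 0 1 : Fin (m + 2) → R) =
        Pi.single 0 1 := by
      funext i
      refine Fin.cases ?_ (fun i => ?_) i <;> simp [LinearMap.funLeft_apply]
    rw [borderPfaffian, LinearMap.comp_apply, h1, pfExpansion_single]
    simp only [Fin.val_zero, pow_zero, one_mul, Matrix.submatrix_submatrix]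
    congr 2 <;> funext i <;> simp
  rw [borderPfaffian, Fin.succAbove_zero, LinearMap.comp_apply, pfExpansion, LinearMap.sum_apply,
    LinearMap.sum_apply]
  refine Finset.sum_congr rfl fun l _ => ?_
  simp only [LinearMap.smul_apply, h, LinearMap.proj_apply, LinearMap.funLeft_apply, smul_eq_mul]
  ring

lemma PfaffianBound.exists_border [IsNoetherianRing R] {k : Subring R} [Infinite k]
    (hk : ∀ a ∈ k, a ≠ 0 → IsUnit a) {x : R} {m : ℕ} {T : Matrix (Fin (m + 2)) (Fin (m + 2)) R}
    (hpf : ∀ P : PrimeSpectrum R, x ∉ P.asIdeal → pf (m + 2) T ∈ P.asIdeal → 1 ≤ Order.height P)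
    (hT : PfaffianBound x (T.submatrix Fin.succ Fin.succ)) (v : Fin (m + 2) → R)
    {U : (Fin (m + 2) → R) → Prop} (hU : LineGeneric k U) :
    ∃ w, (∀ j, w j ∈ k) ∧ U w ∧ PfaffianBound x (border (v + x • w) T) := by
  let A (I : Ideal R) : Set (PrimeSpectrum R) :=
    {Q | Q ∈ minimalPoints I ∧ x ∉ Q.asIdeal ∧ Order.height Q < 3}
  have hA (I : Ideal R) : (A I).Finite := (finite_minimalPoints I).subset fun Q hQ => hQ.1
  have hL (I : Ideal R) (Q) (hQ : Q ∈ A I) :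
      ∃ j, borderPfaffian T 0 (Pi.single j 1) ∉ Q.asIdeal := by
    obtain ⟨j, hj⟩ := hT.exists_pfExpansion_single_notMem hQ.2.1 hQ.2.2
    exact ⟨j.succ, by rwa [borderPfaffian_zero_single_succ]⟩
  set p := pf (m + 2) T with hp
  obtain ⟨ρ, hρk, hρ⟩ := (lineGeneric_forall_notMem hk (hA (Ideal.span {p})) 1 0
    (borderPfaffian T 0) fun Q hQ =>
      ⟨fun h => Q.2.ne_top (Q.asIdeal.eq_top_iff_one.2 h), hL _ Q hQ⟩).1
  simp only [zero_add, one_smul] at hρ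
  set g := borderPfaffian T 0 ρ with hg
  obtain ⟨w₀, hw₀k, ⟨hU₀, h₁⟩, h₂⟩ := ((hU.and (lineGeneric_forall_notMem hk
    (hA (Ideal.span {p})) x v (borderPfaffian T 0) fun Q hQ => ⟨hQ.2.1, hL _ Q hQ⟩)).and
    (lineGeneric_forall_notMem hk (hA (Ideal.span {p, g})) x v (borderPfaffian T 0)
      fun Q hQ => ⟨hQ.2.1, hL _ Q hQ⟩)).1
  set f := borderPfaffian T 0 (v + x • w₀) with hf
  let F : (Fin (m + 2) → R) →ₗ[R] R :=
    ∑ l : Fin (m + 1), ((-1) ^ (l : ℕ) * ρ l.succ) • borderPfaffian T l.succ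
  have hF : F (Pi.single 0 1) = g := sum_borderPfaffian_single_zero T ρ
  obtain ⟨t, hUt, htF⟩ : ∃ t : k, U (w₀ + (t : R) • Pi.single 0 1) ∧
      ∀ Q ∈ {Q | Q ∈ A (Ideal.span {p, f}) ∧ g ∉ Q.asIdeal},
        F (v + x • (w₀ + (t : R) • Pi.single 0 1)) ∉ Q.asIdeal := by
    have hfin : {t : k | ¬ ∀ Q ∈ {Q | Q ∈ A (Ideal.span {p, f}) ∧ g ∉ Q.asIdeal},
        F (v + x • (w₀ + (t : R) • Pi.single 0 1)) ∉ Q.asIdeal}.Finite := by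
      have : {t : k | ¬ ∀ Q ∈ {Q | Q ∈ A (Ideal.span {p, f}) ∧ g ∉ Q.asIdeal},
          F (v + x • (w₀ + (t : R) • Pi.single 0 1)) ∉ Q.asIdeal} ⊆
          ⋃ Q ∈ {Q | Q ∈ A (Ideal.span {p, f}) ∧ g ∉ Q.asIdeal},
            {t : k | F (v + x • (w₀ + (t : R) • Pi.single 0 1)) ∈ Q.asIdeal} := by
        intro t ht
        simp only [Set.mem_ofPred_eq, not_forall, not_not] at ht
        obtain ⟨Q, hQ, h⟩ := ht
        exact Set.mem_biUnion hQ h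
      refine (Set.Finite.biUnion ((hA _).subset fun Q hQ => hQ.1) fun Q hQ => ?_).subset this
      refine Set.Subsingleton.finite fun t ht t' ht' => ?_
      by_contra hne
      simp only [Set.mem_ofPred_eq, map_add, map_smul, smul_eq_mul, hF] at ht ht'
      have h1 : ((t : R) - t') * (x * g) ∈ Q.asIdeal := by
        convert Q.asIdeal.sub_mem ht ht' using 1
        ring
      have h2 : IsUnit ((t : R) - t') :=
        hk _ (k.sub_mem t.2 t'.2) (by simpa [sub_eq_zero] using hne)
      have h3 := (Q.2.mem_or_mem h1).resolve_left
        fun h' => Q.2.ne_top (Q.asIdeal.eq_top_of_isUnit_mem h' h2)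
      exact (Q.2.mem_or_mem h3).elim hQ.1.2.1 hQ.2
    obtain ⟨t, ht⟩ := ((hU.2 w₀ (Pi.single 0 1) hw₀k (single_mem 0) hU₀).union
      hfin).infinite_compl.nonempty
    simp only [Set.mem_compl_iff, Set.mem_union, not_or, Set.mem_ofPred_eq, not_not] at ht
    exact ⟨t, ht⟩
  refine ⟨_, fun j => k.add_mem (hw₀k j) (k.mul_mem t.2 (single_mem 0 j)), hUt, ?_⟩
  intro P hx hP
  by_contra! hlt
  have hmemA {I : Ideal R} (hI : I ≤ P.asIdeal) : ∃ Q ∈ A I, Q.asIdeal ≤ P.asIdeal := by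
    obtain ⟨Q, hQ, hQP⟩ := exists_minimalPoints_le hI
    exact ⟨Q, ⟨hQ, fun h => hx (hQP h), (height_le_height_of_asIdeal_le hQP).trans_lt hlt⟩, hQP⟩
  have hpP : p ∈ P.asIdeal := by
    have := hP 0
    rwa [Fin.succAbove_zero] at this
  have hlP (l : Fin (m + 2)) :
      borderPfaffian T l (v + x • (w₀ + (t : R) • Pi.single 0 1)) ∈ P.asIdeal := by
    rw [← pf_border_submatrix_succ]
    exact hP l.succ
  have hfP : f ∈ P.asIdeal := by
    have := hlP 0
    simpa only [map_add, map_smul, borderPfaffian_zero_single_zero, smul_zero, add_zero,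
      hf] using this
  have hFP : F (v + x • (w₀ + (t : R) • Pi.single 0 1)) ∈ P.asIdeal := by
    rw [LinearMap.sum_apply]
    exact P.asIdeal.sum_mem fun l _ => P.asIdeal.mul_mem_left _ (hlP l.succ)
  have hstep {a b : R} (hQp : ∀ Q ∈ A (Ideal.span {p}), a ∉ Q.asIdeal)
      (ha : a ∈ P.asIdeal) (hb : b ∈ P.asIdeal)
      (hQa : ∀ Q ∈ A (Ideal.span {p, a}), Q.asIdeal ≤ P.asIdeal → b ∉ Q.asIdeal) : False := by
    obtain ⟨Q, hQ, hQP⟩ := hmemA (I := Ideal.span {p, a})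
      (by simp [Ideal.span_le, Set.insert_subset_iff, hpP, ha])
    have hpQ := minimalPoints.le hQ.1
    rw [Ideal.span_le, Set.insert_subset_iff, Set.singleton_subset_iff] at hpQ
    obtain ⟨Q₁, hQ₁, hQ₁Q⟩ := exists_minimalPoints_le (I := Ideal.span {p}) (P := Q)
      (by simpa [Ideal.span_le] using hpQ.1)
    have hx₁ : x ∉ Q₁.asIdeal := fun h => hQ.2.1 (hQ₁Q h)
    have h1 : 1 ≤ Order.height Q₁ :=
      hpf Q₁ hx₁ (minimalPoints.le hQ₁ (Ideal.subset_span rfl))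
    have h2 := height_add_one_le_of_mem_of_notMem hQ₁Q hpQ.2
      (hQp Q₁ ⟨hQ₁, hx₁, (height_le_height_of_asIdeal_le hQ₁Q).trans_lt hQ.2.2⟩)
    have h3 := height_add_one_le_of_mem_of_notMem hQP hb (hQa Q hQ hQP)
    refine hlt.not_ge (le_trans ?_ h3)
    calc (3 : ℕ∞) = 1 + 1 + 1 := by norm_num
      _ ≤ Order.height Q₁ + 1 + 1 := by gcongr
      _ ≤ _ := by gcongr
  by_cases hgP : g ∈ P.asIdeal
  · exact hstep hρ hgP hfP fun Q hQ _ => h₂ Q hQ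
  · exact hstep h₁ hfP hFP fun Q hQ hQP => htF Q ⟨hQ, fun h => hgP (hQP h)⟩

lemma IsAlternating.submatrix {m n : ℕ} {A : Matrix (Fin n) (Fin n) R} (hA : IsAlternating A)
    (f : Fin m → Fin n) : IsAlternating (A.submatrix f f) :=
  ⟨fun _ => hA.1 _, fun _ _ => hA.2 _ _⟩

lemma IsAlternating.border {m : ℕ} {T : Matrix (Fin m) (Fin m) R} (hT : IsAlternating T)
    (u : Fin m → R) : IsAlternating (border u T) := by
  constructor
  · intro i
    refine Fin.cases ?_ (fun i => ?_) i <;> simp [hT.1]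
  · intro i j
    refine Fin.cases ?_ (fun i => ?_) i <;> refine Fin.cases ?_ (fun j => ?_) j <;>
      simp [← hT.2]

lemma border_mem {m : ℕ} {k : Subring R} {u : Fin m → R} {T : Matrix (Fin m) (Fin m) R}
    (hu : ∀ j, u j ∈ k) (hT : ∀ i j, T i j ∈ k) (i j : Fin (m + 1)) : border u T i j ∈ k := by
  refine Fin.cases ?_ (fun i => ?_) i <;> refine Fin.cases ?_ (fun j => ?_) j <;> simp [hu, hT]

lemma IsAlternating.add_smul_border {m : ℕ} {φ : Matrix (Fin (m + 1)) (Fin (m + 1)) R}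
    (hφ : IsAlternating φ) (x : R) (w : Fin m → R) (ψ : Matrix (Fin m) (Fin m) R) :
    φ + x • Paper.border w ψ = Paper.border ((fun j => φ 0 j.succ) + x • w)
      (φ.submatrix Fin.succ Fin.succ + x • ψ) := by
  ext i j
  refine Fin.cases ?_ (fun i => ?_) i <;> refine Fin.cases ?_ (fun j => ?_) j
  · simp [hφ.1]
  · simp
  · simp [hφ.2 0 i.succ]
    ring
  · simp

/-- A generic alternating matrix of constants makes the rank loci of `φ + x φ'` of the expected
height away from `x = 0`. -/
theorem exists_alternating_minorsBound_pfaffianBound [IsNoetherianRing R] {k : Subring R}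
    [Infinite k] (hk : ∀ a ∈ k, a ≠ 0 → IsUnit a) (x : R) (N : ℕ)
    (φ : Matrix (Fin (2 * N + 1)) (Fin (2 * N + 1)) R) (hφ : IsAlternating φ) :
    ∃ φ' : Matrix (Fin (2 * N + 1)) (Fin (2 * N + 1)) R, IsAlternating φ' ∧
      (∀ i j, φ' i j ∈ k) ∧ MinorsBound x (φ + x • φ') ∧ PfaffianBound x (φ + x • φ') := by
  induction N with
  | zero =>
    refine ⟨0, ⟨by simp, by simp⟩, by simp, fun P _ i hi => ?_, fun P _ hP => ?_⟩
    · rcases i with _ | i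
      · refine absurd (minorsIdeal_le_iff.1 hi Fin.elim0 Fin.elim0) ?_
        rw [Matrix.det_fin_zero]
        exact fun h => P.2.ne_top (P.asIdeal.eq_top_iff_one.2 h)
      · refine le_trans ?_ le_add_self
        exact_mod_cast (by omega : 2 * 0 + 1 ≤ i + 1)
    · exact absurd (P.asIdeal.eq_top_iff_one.2 (hP 0)) P.2.ne_top
  | succ N ih =>
    obtain ⟨φ₀, hφ₀, hk₀, hM₀, hP₀⟩ := ih _ ((hφ.submatrix Fin.succ).submatrix Fin.succ)
    obtain ⟨U₁, hU₁, hM₁⟩ :=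
      hM₀.exists_lineGeneric_border hk fun j => φ.submatrix Fin.succ Fin.succ 0 j.succ
    obtain ⟨V₁, hV₁, hP₁⟩ :=
      hP₀.exists_lineGeneric_border hk fun j => φ.submatrix Fin.succ Fin.succ 0 j.succ
    obtain ⟨w₁, hw₁, hUw₁, hVw₁⟩ := (hU₁.and hV₁).1
    obtain ⟨U₂, hU₂, hM₂⟩ := (hM₁ w₁ hUw₁).exists_lineGeneric_border hk fun j => φ 0 j.succ
    obtain ⟨w₂, hw₂, hUw₂, hP₂⟩ :=
      PfaffianBound.exists_border hk (hP₁ w₁ hVw₁) hP₀ (fun j => φ 0 j.succ) hU₂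
    refine ⟨border w₂ (border w₁ φ₀), (hφ₀.border w₁).border w₂,
      border_mem hw₂ (border_mem hw₁ hk₀), ?_, ?_⟩
    all_goals
      rw [hφ.add_smul_border, (hφ.submatrix Fin.succ).add_smul_border]
    · exact hM₂ w₂ hUw₂
    · exact hP₂

open Polynomial in
/-- Points of `Spec R[X]` on which `X` vanishes lie strictly above the extension of their
contraction to `R`. -/
lemma height_comap_C_add_one_le {P : PrimeSpectrum R[X]} (hX : X ∈ P.asIdeal) :
    Order.height (PrimeSpectrum.comap C P) + 1 ≤ Order.height P := by
  let F : PrimeSpectrum R → PrimeSpectrum R[X] :=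
    fun q => ⟨q.asIdeal.map C, Ideal.isPrime_map_C_of_isPrime⟩
  have hF (q : PrimeSpectrum R) (r : R) : C r ∈ (F q).asIdeal ↔ r ∈ q.asIdeal := by
    refine ⟨fun h => ?_, fun h => Ideal.mem_map_of_mem C h⟩
    simpa using Ideal.mem_map_C_iff.1 h 0
  have hmono : StrictMono F := by
    refine Monotone.strictMono_of_injective (fun p q h => Ideal.map_mono h) fun p q h => ?_
    refine PrimeSpectrum.ext (Ideal.ext fun r => ?_)
    rw [← hF p, ← hF q, h]
  refine le_trans (add_le_add_left (Order.height_le_height_apply_of_strictMono F hmono _) 1)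
    (height_add_one_le_of_mem_of_notMem (Ideal.map_comap_le) hX fun h => ?_)
  have := Ideal.mem_map_C_iff.1 h 1
  rw [coeff_X_one] at this
  exact P.2.ne_top (P.asIdeal.eq_top_iff_one.2 (by simpa using this))

lemma pf_map {S : Type} [CommRing S] (f : R →+* S) :
    ∀ (n : ℕ) (A : Matrix (Fin n) (Fin n) R), pf n (A.map f) = f (pf n A)
  | 0, _ => by simp [pf]
  | 1, _ => by simp [pf]
  | n + 2, A => by
    simp only [pf, map_sum, map_mul, map_pow, map_neg, map_one, Matrix.map_apply]
    refine Finset.sum_congr rfl fun j _ => ?_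
    rw [← pf_map f n]
    rfl

lemma minorsIdeal_succ_le {n r : ℕ} (A : Matrix (Fin n) (Fin n) R) :
    minorsIdeal n (r + 1) A ≤ minorsIdeal n r A := by
  refine minorsIdeal_le_iff.2 fun f g => ?_
  rw [Matrix.det_succ_row_zero]
  refine Ideal.sum_mem _ fun j _ => Ideal.mul_mem_left _ _ ?_
  rw [Matrix.submatrix_submatrix]
  exact Ideal.subset_span ⟨_, _, rfl⟩

lemma idealHeight_le {I : Ideal R} {P : PrimeSpectrum R} (h : I ≤ P.asIdeal) :
    idealHeight I ≤ Order.height P :=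
  iInf₂_le P h

lemma le_idealHeight_iff {I : Ideal R} {c : ℕ∞} :
    c ≤ idealHeight I ↔ ∀ P : PrimeSpectrum R, I ≤ P.asIdeal → c ≤ Order.height P :=
  le_iInf₂_iff

lemma pf_submatrix_succAbove_mem_pfaffianIdeal {m : ℕ}
    (A : Matrix (Fin (m + 1)) (Fin (m + 1)) R) (i : Fin (m + 1)) :
    pf m (A.submatrix i.succAbove i.succAbove) ∈ pfaffianIdeal (m + 1) m A := by
  have hS : (Finset.univ.erase i).card = m := by simp
  refine Ideal.subset_span ⟨_, hS, ?_⟩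
  rw [← Finset.orderEmbOfFin_unique hS (f := i.succAbove) (by simp) (Fin.strictMono_succAbove i)]

theorem statement18
    (𝒜 : ℤ → AddSubgroup R) [GradedRing 𝒜]
    (hNoeth : IsNoetherianRing R)
    (hnonneg : ∀ i : ℤ, i < 0 → 𝒜 i = ⊥)
    -- `R₀ = k` is an infinite field, and `R` is standard graded: `R = R₀[R₁]`
    (hfield : IsField ↥(𝒜 0)) (hinf : Infinite ↥(𝒜 0))
    (hstd : Subring.closure ((𝒜 0 : Set R) ∪ (𝒜 1 : Set R)) = ⊤)
    -- `R` is Cohen–Macaulay with `dim R = d`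
    (d : ℕ) (hdim : ringKrullDim R = (d : WithBot (WithTop ℕ)))
    (hCM : depthGE (maxHomIdeal 𝒜) R d)
    -- `3 ≤ n` odd, `s` an integer
    (s n : ℕ) (hn3 : 3 ≤ n) (hnodd : Odd n)
    -- `φ` an `n × n` alternating matrix with homogeneous linear entries
    (φ : Matrix (Fin n) (Fin n) R) (halt : IsAlternating φ)
    (hlin : ∀ i j, φ i j ∈ 𝒜 1)
    -- (a) `d < (s+2 choose 2)`
    (ha : d < (s + 2) * (s + 1) / 2)
    -- (b) `3 ≤ ht Pf_{n-1}(φ)`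
    (hb : (3 : ℕ∞) ≤ idealHeight (pfaffianIdeal n (n - 1) φ))
    -- (c) `n − i ≤ ht I_i(φ)` for `n − s ≤ i ≤ n − 1`
    (hc : ∀ i : ℕ, (n : ℤ) - s ≤ i → (i : ℤ) ≤ (n : ℤ) - 1 →
      ((n - i : ℕ) : ℕ∞) ≤ idealHeight (minorsIdeal n i φ)) :
    -- conclusion: there is an alternating matrix `φ'` of constants such that
    -- `Φ = φ + x_{d+1}·φ'` (which specializes to `φ` under `x_{d+1} ↦ 0`) satisfies:
    ∃ φ' : Matrix (Fin n) (Fin n) R,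
      IsAlternating φ' ∧ (∀ i j, φ' i j ∈ 𝒜 0) ∧
      (letI Φ : Matrix (Fin n) (Fin n) (Polynomial R) := fun i j =>
        Polynomial.C (φ i j) + Polynomial.X * Polynomial.C (φ' i j)
       -- (2) `3 ≤ ht Pf_{n-1}(Φ)`
       ((3 : ℕ∞) ≤ idealHeight (pfaffianIdeal n (n - 1) Φ)
       -- (3) `n − i ≤ ht I_i(Φ)` for `n − s − 1 ≤ i ≤ n − 1`
       ∧ ∀ i : ℕ, (n : ℤ) - s - 1 ≤ i → (i : ℤ) ≤ (n : ℤ) - 1 →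
          ((n - i : ℕ) : ℕ∞) ≤ idealHeight (minorsIdeal n i Φ))) := by
  let k : Subring (Polynomial R) := (SetLike.GradeZero.subring 𝒜).map Polynomial.C
  have hkinf : Infinite k :=
    Infinite.of_injective (fun a : 𝒜 0 => (⟨Polynomial.C (a : R), a, a.2, rfl⟩ : k))
      fun a b hab => Subtype.ext (Polynomial.C_injective (congrArg Subtype.val hab))
  have hk : ∀ a ∈ k, a ≠ 0 → IsUnit a := by
    rintro _ ⟨a, ha, rfl⟩ h0
    obtain ⟨b, hab⟩ := hfield.mul_inv_cancel (a := ⟨a, ha⟩) fun h =>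
      h0 (by rw [show a = 0 from congrArg Subtype.val h, map_zero])
    exact (IsUnit.of_mul_eq_one (b : R) (congrArg Subtype.val hab)).map Polynomial.C
  obtain ⟨N, rfl⟩ := hnodd
  obtain ⟨ψ, ⟨hψ₀, hψ⟩, hψk, hM, hP⟩ := exists_alternating_minorsBound_pfaffianBound hk
    Polynomial.X N (φ.map Polynomial.C) ⟨fun i => by simp [halt.1],
      fun i j => by simp [halt.2 i j]⟩
  choose φ' hφ' hφ'ψ using hψk
  have hΦ : (fun i j => Polynomial.C (φ i j) + Polynomial.X * Polynomial.C (φ' i j) :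
      Matrix (Fin (2 * N + 1)) (Fin (2 * N + 1)) (Polynomial R)) =
      φ.map Polynomial.C + (Polynomial.X : Polynomial R) • ψ := by
    funext i j
    simp [← hφ'ψ]
  refine ⟨φ', ⟨fun i => Polynomial.C_injective ?_, fun i j => Polynomial.C_injective ?_⟩, hφ', ?_⟩
  · exact (hφ'ψ i i).trans ((hψ₀ i).trans (map_zero _).symm)
  · rw [map_neg]
    exact (hφ'ψ j i).trans ((hψ i j).trans (congrArg _ (hφ'ψ i j).symm))
  rw [hΦ]
  set Φ := φ.map Polynomial.C + (Polynomial.X : Polynomial R) • ψ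
  have hmk {P : PrimeSpectrum (Polynomial R)} (hX : Polynomial.X ∈ P.asIdeal) :
      Φ.map (Ideal.Quotient.mk P.asIdeal) =
        φ.map ((Ideal.Quotient.mk P.asIdeal).comp Polynomial.C) := by
    ext i j
    simp [Φ, Ideal.Quotient.eq_zero_iff_mem.2 hX]
  simp only [le_idealHeight_iff]
  refine ⟨fun P hPf => ?_, fun i hi hi' P hI => ?_⟩
  · by_cases hX : Polynomial.X ∈ P.asIdeal
    · refine le_trans (hb.trans (idealHeight_le (Ideal.span_le.2 ?_)))
        (le_self_add.trans (height_comap_C_add_one_le hX))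
      rintro _ ⟨S, hS, rfl⟩
      have h := hPf (Ideal.subset_span ⟨S, hS, rfl⟩)
      rw [← Ideal.Quotient.eq_zero_iff_mem, ← pf_map, ← Matrix.submatrix_map, hmk hX,
        Matrix.submatrix_map, pf_map] at h
      exact (Ideal.Quotient.eq_zero_iff_mem (I := P.asIdeal)).1 h
    · exact hP P hX fun i => hPf (pf_submatrix_succAbove_mem_pfaffianIdeal Φ i)
  · by_cases hX : Polynomial.X ∈ P.asIdeal
    · have hq : minorsIdeal (2 * N + 1) i φ ≤ (PrimeSpectrum.comap Polynomial.C P).asIdeal := by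
        refine minorsIdeal_le_iff.2 fun f g => ?_
        have h := minorsIdeal_le_iff.1 hI f g
        rw [← Ideal.Quotient.eq_zero_iff_mem, RingHom.map_det, RingHom.mapMatrix_apply,
          ← Matrix.submatrix_map, hmk hX, Matrix.submatrix_map, ← RingHom.mapMatrix_apply,
          ← RingHom.map_det] at h
        exact (Ideal.Quotient.eq_zero_iff_mem (I := P.asIdeal)).1 h
      refine le_trans ?_ (height_comap_C_add_one_le hX)
      rw [show 2 * N + 1 - i = 2 * N + 1 - (i + 1) + 1 by omega, Nat.cast_add, Nat.cast_one]
      gcongr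
      by_cases hlt : i + 1 < 2 * N + 1
      · exact (hc (i + 1) (by push_cast; omega) (by push_cast; omega)).trans
          (idealHeight_le ((minorsIdeal_succ_le φ).trans hq))
      · simp [show 2 * N + 1 - (i + 1) = 0 by omega]
    · rw [ENat.natCast_sub, tsub_le_iff_right]
      exact hM P hX i hI

end Paper
end
end
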